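/- Let Ω, K ⊂ ℝⁿ be convex bodies with nonempty interior, r = r(Ω,K), and for i ∈ {0,…,n−1} let v_i(λ) := V(Ω∼λK,…,Ω∼λK, K,…,K) be the mixed volume with n−i copies of Ω∼λK and i copies of K. Then f_i(λ) := v_i(λ)^{1/(n−i)} is concave on [0, r]. -/

import Mathlib

open Pointwise MeasureTheory Set

noncomputable section

/-- The inner parallel body `Ω ∼ λK = {x : x + λK ⊆ Ω}`. -/
def innerPar {n : ℕ} (Ω K : Set (EuclideanSpace ℝ (Fin n))) (l : ℝ) :
    Set (EuclideanSpace ℝ (Fin n)) :=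
  {x | ∀ y ∈ K, x + l • y ∈ Ω}

/-- The inradius of `Ω` relative to `K`. -/
def inrad {n : ℕ} (Ω K : Set (EuclideanSpace ℝ (Fin n))) : ℝ :=
  sSup {l : ℝ | 0 ≤ l ∧ ∃ x, ∀ y ∈ K, x + l • y ∈ Ω}

/-- The anisotropic perimeter of `C` relative to `K`, realized as the anisotropic
Minkowski content `d/dt V_n(C + tK) |_{t=0⁺}`. -/
def aniPer {n : ℕ} (C K : Set (EuclideanSpace ℝ (Fin n))) : ℝ :=
  derivWithin (fun t : ℝ => (volume (C + t • K)).toReal) (Set.Ici (0:ℝ)) 0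

/-- The mixed volume `V(C,…,C,K,…,K)` with `i` copies of `K`, extracted as the
`i`-th Taylor coefficient (over `binom n i`) of `t ↦ V_n(C + tK)` at `t = 0⁺`. -/
def mixedVol {n : ℕ} (i : ℕ) (C K : Set (EuclideanSpace ℝ (Fin n))) : ℝ :=
  iteratedDerivWithin i (fun t : ℝ => (volume (C + t • K)).toReal) (Set.Ici (0:ℝ)) 0
    / (n.choose i * i.factorial)

namespace ConvexMixed

open Matrix Filter Topology
open scoped ContDiff

/-! ### Coordinate calculus on Euclidean space -/

/-- The coordinate model space. -/
abbrev Euc (n : ℕ) := EuclideanSpace ℝ (Fin n)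

variable {n : ℕ}

/-- The `i`-th partial derivative. -/
def pd (i : Fin n) (f : Euc n → ℝ) (x : Euc n) : ℝ :=
  fderiv ℝ f x (EuclideanSpace.single i 1)

/-- The gradient, in coordinates. -/
def grd (f : Euc n → ℝ) (x : Euc n) : Euc n := WithLp.toLp 2 fun i => pd i f x

/-- The Jacobian matrix of a vector field. -/
def jac (v : Euc n → Euc n) (x : Euc n) : Matrix (Fin n) (Fin n) ℝ :=
  Matrix.of fun i j => pd j (fun y => v y i) x

/-- The Hessian matrix. -/
def hess (f : Euc n → ℝ) (x : Euc n) : Matrix (Fin n) (Fin n) ℝ :=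
  Matrix.of fun i j => pd j (pd i f) x

lemma grd_apply (f : Euc n → ℝ) (x : Euc n) (i : Fin n) : grd f x i = pd i f x := rfl

lemma jac_grd (f : Euc n → ℝ) : jac (grd f) = hess f := rfl

lemma jac_apply (v : Euc n → Euc n) (x : Euc n) (i j : Fin n) :
    jac v x i j = pd j (fun y => v y i) x := rfl

lemma jac_zero (x : Euc n) : jac (fun _ : Euc n => (0 : Euc n)) x = 0 := by
  ext a b
  rw [jac_apply]
  simp [pd]

lemma hess_apply (f : Euc n → ℝ) (x : Euc n) (i j : Fin n) :
    hess f x i j = pd j (pd i f) x := rfl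

lemma sum_single_eq (u : Euc n) : u = ∑ i, u i • EuclideanSpace.single i (1 : ℝ) := by
  ext j
  simp [Finset.sum_apply, Pi.single_apply]

lemma fderiv_eq_sum_pd (f : Euc n → ℝ) (x u : Euc n) :
    fderiv ℝ f x u = ∑ i, pd i f x * u i := by
  conv_lhs => rw [sum_single_eq u]
  simp [map_sum, pd, mul_comm]

lemma pd_eq_of_hasFDerivAt {f : Euc n → ℝ} {f' : Euc n →L[ℝ] ℝ} {x : Euc n}
    (h : HasFDerivAt f f' x) (i : Fin n) : pd i f x = f' (EuclideanSpace.single i 1) := by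
  rw [pd, h.fderiv]

lemma contDiff_pd {f : Euc n → ℝ} (hf : ContDiff ℝ ∞ f) (i : Fin n) : ContDiff ℝ ∞ (pd i f) :=
  (hf.fderiv_right (m := ∞) (by simp)).clm_apply contDiff_const

lemma contDiff_differentiable {F : Type*} [NormedAddCommGroup F] [NormedSpace ℝ F]
    {f : Euc n → F} (hf : ContDiff ℝ ∞ f) : Differentiable ℝ f :=
  hf.differentiable (by simp)

lemma contDiff_euc {v : Euc n → Euc n} (hv : ∀ i, ContDiff ℝ ∞ (fun x => v x i)) :
    ContDiff ℝ ∞ v :=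
  contDiff_euclidean.2 hv

lemma contDiff_coord {v : Euc n → Euc n} (hv : ContDiff ℝ ∞ v) (i : Fin n) :
    ContDiff ℝ ∞ (fun x => v x i) :=
  contDiff_euclidean.1 hv i

lemma contDiff_grd {f : Euc n → ℝ} (hf : ContDiff ℝ ∞ f) : ContDiff ℝ ∞ (grd f) :=
  contDiff_euc fun i => contDiff_pd hf i

lemma contDiff_jac {v : Euc n → Euc n} (hv : ContDiff ℝ ∞ v) (i j : Fin n) :
    ContDiff ℝ ∞ (fun x => jac v x i j) :=
  contDiff_pd (contDiff_coord hv i) j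

lemma contDiff_hess {f : Euc n → ℝ} (hf : ContDiff ℝ ∞ f) (i j : Fin n) :
    ContDiff ℝ ∞ (fun x => hess f x i j) :=
  contDiff_pd (contDiff_pd hf i) j

lemma pd_add {f g : Euc n → ℝ} (hf : Differentiable ℝ f) (hg : Differentiable ℝ g) (i : Fin n) :
    pd i (fun x => f x + g x) = fun x => pd i f x + pd i g x := by
  ext x
  simp [pd, fderiv_fun_add (hf x) (hg x)]

lemma pd_sub {f g : Euc n → ℝ} (hf : Differentiable ℝ f) (hg : Differentiable ℝ g) (i : Fin n) :
    pd i (fun x => f x - g x) = fun x => pd i f x - pd i g x := by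
  ext x
  simp [pd, fderiv_fun_sub (hf x) (hg x)]

lemma pd_mul {f g : Euc n → ℝ} (hf : Differentiable ℝ f) (hg : Differentiable ℝ g) (i : Fin n) :
    pd i (fun x => f x * g x) = fun x => f x * pd i g x + g x * pd i f x := by
  ext x
  simp [pd, fderiv_fun_mul (hf x) (hg x)]

lemma pd_const_mul (c : ℝ) {f : Euc n → ℝ} (hf : Differentiable ℝ f) (i : Fin n) :
    pd i (fun x => c * f x) = fun x => c * pd i f x := by
  ext x
  simp [pd, fderiv_const_mul (hf x)]

lemma pd_const (c : ℝ) (i : Fin n) : pd i (fun _ : Euc n => c) = fun _ => 0 := by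
  ext x
  simp [pd]

lemma pd_coord (i j : Fin n) : pd i (fun x : Euc n => x j) = fun _ => if i = j then 1 else 0 := by
  ext x
  have h : HasFDerivAt (fun x : Euc n => x j) (EuclideanSpace.proj j : Euc n →L[ℝ] ℝ) x :=
    (EuclideanSpace.proj j : Euc n →L[ℝ] ℝ).hasFDerivAt
  rw [pd_eq_of_hasFDerivAt h]
  simp [eq_comm]

lemma pd_comp {θ : ℝ → ℝ} {f : Euc n → ℝ} (hθ : Differentiable ℝ θ) (hf : Differentiable ℝ f)
    (i : Fin n) : pd i (fun x => θ (f x)) = fun x => deriv θ (f x) * pd i f x := by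
  ext x
  have h := (hθ (f x)).hasDerivAt.comp_hasFDerivAt x (hf x).hasFDerivAt
  rw [pd_eq_of_hasFDerivAt (f := fun x => θ (f x)) h]
  simp [pd]

lemma hess_symm {f : Euc n → ℝ} (hf : ContDiff ℝ ∞ f) (x : Euc n) : (hess f x).IsHermitian := by
  have hs : IsSymmSndFDerivAt ℝ f x :=
    hf.contDiffAt.isSymmSndFDerivAt (by
      rw [minSmoothness_of_isRCLikeNormedField]
      exact ENat.LEInfty.out)
  have hd : DifferentiableAt ℝ (fderiv ℝ f) x :=
    (hf.fderiv_right (m := ∞) (by simp)).differentiable (by simp) x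
  have key : ∀ i j, hess f x i j
      = fderiv ℝ (fderiv ℝ f) x (EuclideanSpace.single j 1) (EuclideanSpace.single i 1) := by
    intro i j
    rw [hess_apply, pd]
    have h := hd.hasFDerivAt.clm_apply
      (hasFDerivAt_const (EuclideanSpace.single i (1 : ℝ) : Euc n) x)
    have h2 : fderiv ℝ (pd i f) x = _ := HasFDerivAt.fderiv (f := pd i f) h
    rw [h2]
    simp
  ext i j
  simp only [conjTranspose_apply, star_trivial]
  rw [key, key]
  exact hs _ _

lemma fderiv_apply_eq_jac {v : Euc n → Euc n} (hv : Differentiable ℝ v) (x u : Euc n) (i : Fin n) :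
    fderiv ℝ v x u i = (jac v x *ᵥ u.ofLp) i := by
  have h1 : HasFDerivAt (fun y => v y i)
      ((EuclideanSpace.proj i : Euc n →L[ℝ] ℝ).comp (fderiv ℝ v x)) x :=
    (EuclideanSpace.proj i : Euc n →L[ℝ] ℝ).hasFDerivAt.comp x (hv x).hasFDerivAt
  have h2 := fderiv_eq_sum_pd (fun y => v y i) x u
  rw [h1.fderiv] at h2
  simpa [mulVec, dotProduct, jac_apply] using h2

lemma det_fderiv_eq_jac {v : Euc n → Euc n} (hv : Differentiable ℝ v) (x : Euc n) :
    (fderiv ℝ v x).det = (jac v x).det := by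
  rw [ContinuousLinearMap.det,
    ← LinearMap.det_toMatrix (EuclideanSpace.basisFun (Fin n) ℝ).toBasis]
  congr 1
  ext i j
  rw [LinearMap.toMatrix_apply]
  simp [fderiv_apply_eq_jac hv]

lemma jac_add {v w : Euc n → Euc n} (hv : Differentiable ℝ v) (hw : Differentiable ℝ w)
    (x : Euc n) : jac (fun y => v y + w y) x = jac v x + jac w x := by
  ext i j
  have hvi : Differentiable ℝ fun y => v y i := fun y => differentiableAt_euclidean.1 (hv y) i
  have hwi : Differentiable ℝ fun y => w y i := fun y => differentiableAt_euclidean.1 (hw y) i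
  have := congrFun (pd_add hvi hwi j) x
  simpa [jac_apply] using this

lemma hess_add {f g : Euc n → ℝ} (hf : ContDiff ℝ ∞ f) (hg : ContDiff ℝ ∞ g) (x : Euc n) :
    hess (fun y => f y + g y) x = hess f x + hess g x := by
  ext i j
  rw [hess_apply, pd_add (contDiff_differentiable hf) (contDiff_differentiable hg),
    pd_add (contDiff_differentiable (contDiff_pd hf i))
      (contDiff_differentiable (contDiff_pd hg i))]
  rfl

lemma hess_const_mul (c : ℝ) {f : Euc n → ℝ} (hf : ContDiff ℝ ∞ f) (x : Euc n) :
    hess (fun y => c * f y) x = c • hess f x := by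
  ext i j
  rw [hess_apply, pd_const_mul c (contDiff_differentiable hf),
    pd_const_mul c (contDiff_differentiable (contDiff_pd hf i))]
  rfl

lemma tsupport_pd_subset (f : Euc n → ℝ) (i : Fin n) : tsupport (pd i f) ⊆ tsupport f := by
  refine closure_minimal (fun x hx => ?_) (isClosed_tsupport f)
  by_contra h
  apply hx
  have : f =ᶠ[𝓝 x] 0 := notMem_tsupport_iff_eventuallyEq.1 h
  rw [pd, this.fderiv_eq]
  simp

lemma pd_hasCompactSupport {f : Euc n → ℝ} (hf : HasCompactSupport f) (i : Fin n) :
    HasCompactSupport (pd i f) :=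
  hf.of_isClosed_subset (isClosed_tsupport _) (tsupport_pd_subset f i)

/-- Integration by parts against a compactly supported function. -/
lemma integral_mul_pd {f g : Euc n → ℝ} (hf : ContDiff ℝ ∞ f) (hg : ContDiff ℝ ∞ g)
    (hc : HasCompactSupport g) (i : Fin n) :
    ∫ x, f x * pd i g x = - ∫ x, g x * pd i f x := by
  have h := integral_mul_fderiv_eq_neg_fderiv_mul_of_integrable (μ := (volume : Measure (Euc n)))
    (f := f) (g := g) (v := EuclideanSpace.single i 1)
    (((contDiff_pd hf i).continuous.mul hg.continuous).integrable_of_hasCompactSupport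
      hc.mul_left)
    ((hf.continuous.mul (contDiff_pd hg i).continuous).integrable_of_hasCompactSupport
      (pd_hasCompactSupport hc i).mul_left)
    ((hf.continuous.mul hg.continuous).integrable_of_hasCompactSupport hc.mul_left)
    (fun x _ => contDiff_differentiable hf x) (fun x _ => contDiff_differentiable hg x)
  simpa [pd, mul_comm] using h

lemma dot_mulVec_eq_sum (A : Matrix (Fin n) (Fin n) ℝ) (u w : Fin n → ℝ) :
    u ⬝ᵥ A *ᵥ w = ∑ i, ∑ j, A i j * u i * w j := by
  simp only [dotProduct, mulVec, Finset.mul_sum]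
  refine Finset.sum_congr rfl fun i _ => Finset.sum_congr rfl fun j _ => by ring

/-! ### Extracting coefficients by interpolation -/

/-- Interpolation weights: the `i`-th coefficient of a polynomial of degree at most `n` is the
weighted sum of its values at `0, …, n`. -/
def wt (n i k : ℕ) : ℝ :=
  (Lagrange.basis (Finset.range (n + 1)) (fun k : ℕ => (k : ℝ)) k).coeff i

lemma coeff_eq_sum_wt {p : Polynomial ℝ} (hp : p.natDegree ≤ n) (i : ℕ) :
    p.coeff i = ∑ k ∈ Finset.range (n + 1), wt n i k * p.eval (k : ℝ) := by
  have h := Lagrange.eq_interpolate (s := Finset.range (n + 1)) (v := fun k : ℕ => (k : ℝ)) (f := p)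
    (by intro a _ b _ h; exact Nat.cast_injective h)
    (by
      rw [Finset.card_range]
      exact lt_of_le_of_lt Polynomial.degree_le_natDegree (by exact_mod_cast Nat.lt_succ_of_le hp))
  conv_lhs => rw [h]
  rw [Lagrange.interpolate_apply, Polynomial.finsetSum_coeff]
  refine Finset.sum_congr rfl fun k _ => ?_
  rw [Polynomial.coeff_C_mul, wt, mul_comm]

lemma sum_wt_pow {i j : ℕ} (hj : j ≤ n) :
    ∑ k ∈ Finset.range (n + 1), wt n i k * (k : ℝ) ^ j = if i = j then 1 else 0 := by
  have h := coeff_eq_sum_wt (n := n) (p := Polynomial.X ^ j) (by simpa using hj) i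
  rw [Polynomial.coeff_X_pow] at h
  simpa using h.symm

lemma coeff_eq_sum_wt_complex {p : Polynomial ℂ} (hp : p.natDegree ≤ n) {i : ℕ} (hi : i ≤ n) :
    p.coeff i = ∑ k ∈ Finset.range (n + 1), (wt n i k : ℂ) * p.eval (k : ℂ) := by
  have hs : ∀ j ∈ Finset.range (n + 1),
      ∑ k ∈ Finset.range (n + 1), (wt n i k : ℂ) * (k : ℂ) ^ j = if i = j then 1 else 0 := by
    intro j hj
    have := sum_wt_pow (n := n) (i := i) (j := j) (by simpa [Nat.lt_succ_iff] using hj)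
    have h2 := congrArg (fun r : ℝ => (r : ℂ)) this
    push_cast at h2
    rw [h2]
    split_ifs <;> simp
  have he : ∀ k : ℕ, p.eval (k : ℂ) =
      ∑ j ∈ Finset.range (n + 1), p.coeff j * (k : ℂ) ^ j := fun k =>
    Polynomial.eval_eq_sum_range' (Nat.lt_succ_of_le hp) _
  simp_rw [he, Finset.mul_sum]
  rw [Finset.sum_comm]
  have : ∀ j ∈ Finset.range (n + 1),
      ∑ k ∈ Finset.range (n + 1), (wt n i k : ℂ) * (p.coeff j * (k : ℂ) ^ j)
        = p.coeff j * if i = j then 1 else 0 := by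
    intro j hj
    rw [← hs j hj, Finset.mul_sum]
    exact Finset.sum_congr rfl fun k _ => by ring
  rw [Finset.sum_congr rfl this]
  simp [Nat.lt_succ_of_le hi]

/-! ### Pencils of matrices -/

/-- The polynomial `det (P + X Q)`. -/
def detPoly {R : Type*} [CommRing R] (P Q : Matrix (Fin n) (Fin n) R) : Polynomial R :=
  (P.map Polynomial.C + (Polynomial.X : Polynomial R) • Q.map Polynomial.C).det

lemma detPoly_eval {R : Type*} [CommRing R] (P Q : Matrix (Fin n) (Fin n) R) (s : R) :
    (detPoly P Q).eval s = (P + s • Q).det := by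
  rw [detPoly, ← Polynomial.coe_evalRingHom, RingHom.map_det]
  congr 1
  ext i j
  simp only [RingHom.mapMatrix_apply, Matrix.map_apply, Matrix.add_apply, Matrix.smul_apply,
    smul_eq_mul, Polynomial.coe_evalRingHom, Polynomial.eval_add, Polynomial.eval_mul,
    Polynomial.eval_X, Polynomial.eval_C]

lemma detPoly_natDegree_le {R : Type*} [CommRing R] (P Q : Matrix (Fin n) (Fin n) R) :
    (detPoly P Q).natDegree ≤ n := by
  have := Polynomial.natDegree_det_X_add_C_le Q P
  rw [add_comm] at this
  simpa [detPoly] using this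

lemma detPoly_coeff_top {R : Type*} [CommRing R] (P Q : Matrix (Fin n) (Fin n) R) :
    (detPoly P Q).coeff n = Q.det := by
  have := Polynomial.coeff_det_X_add_C_card Q P
  rw [add_comm] at this
  simpa [detPoly] using this

lemma detPoly_coeff_one {P : Matrix (Fin n) (Fin n) ℝ} (hP : IsUnit P.det)
    (Q : Matrix (Fin n) (Fin n) ℝ) :
    (detPoly P Q).coeff 1 = (P.adjugate * Q).trace := by
  have h : detPoly P Q
      = Polynomial.C P.det *
        (1 + (Polynomial.X : Polynomial ℝ) • (P⁻¹ * Q).map Polynomial.C).det := by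
    have h1 : Polynomial.C P.det = (P.map (Polynomial.C : ℝ →+* Polynomial ℝ)).det := by
      rw [RingHom.map_det]; rfl
    rw [h1, ← det_mul, detPoly]
    congr 1
    rw [mul_add, mul_one, Matrix.mul_smul, ← Matrix.map_mul,
      Matrix.mul_nonsing_inv_cancel_left _ _ hP]
  rw [h, Polynomial.coeff_C_mul, coeff_det_one_add_X_smul_one, Matrix.inv_def, Matrix.smul_mul,
    trace_smul, smul_eq_mul, ← mul_assoc, Ring.mul_inverse_cancel _ hP, one_mul]

/-- The coefficient of `z ^ i` in `det (M + z N)`. -/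
def cmix (i : ℕ) (M N : Matrix (Fin n) (Fin n) ℝ) : ℝ :=
  ∑ k ∈ Finset.range (n + 1), wt n i k * (M + (k : ℝ) • N).det

/-- The coefficient of `z ^ i` in `adj (M + z N)`. -/
def gmat (i : ℕ) (M N : Matrix (Fin n) (Fin n) ℝ) : Matrix (Fin n) (Fin n) ℝ :=
  ∑ k ∈ Finset.range (n + 1), wt n i k • (M + (k : ℝ) • N).adjugate

/-- The polynomial in `s` whose value is the coefficient of `z ^ i` in `det (M + s X + z N)`. -/
def qpoly (i : ℕ) (M N X : Matrix (Fin n) (Fin n) ℝ) : Polynomial ℝ :=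
  ∑ k ∈ Finset.range (n + 1), Polynomial.C (wt n i k) * detPoly (M + (k : ℝ) • N) X

lemma cmix_eq_coeff (i : ℕ) (M N : Matrix (Fin n) (Fin n) ℝ) :
    cmix i M N = (detPoly M N).coeff i := by
  rw [coeff_eq_sum_wt (detPoly_natDegree_le M N)]
  simp [cmix, detPoly_eval]

lemma qpoly_eval (i : ℕ) (M N X : Matrix (Fin n) (Fin n) ℝ) (s : ℝ) :
    (qpoly i M N X).eval s = cmix i (M + s • X) N := by
  simp only [qpoly, cmix, Polynomial.eval_finsetSum, Polynomial.eval_mul, Polynomial.eval_C,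
    detPoly_eval]
  refine Finset.sum_congr rfl fun k _ => ?_
  rw [add_right_comm]

lemma qpoly_natDegree_le_card (i : ℕ) (M N X : Matrix (Fin n) (Fin n) ℝ) :
    (qpoly i M N X).natDegree ≤ n := by
  refine Polynomial.natDegree_sum_le_of_forall_le _ _ fun k _ => ?_
  exact (Polynomial.natDegree_C_mul_le _ _).trans (detPoly_natDegree_le _ _)

lemma qpoly_coeff_zero (i : ℕ) (M N X : Matrix (Fin n) (Fin n) ℝ) :
    (qpoly i M N X).coeff 0 = cmix i M N := by
  rw [Polynomial.coeff_zero_eq_eval_zero, qpoly_eval]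
  simp

lemma posDef_add_smul {M N : Matrix (Fin n) (Fin n) ℝ} (hM : M.PosDef) (hN : N.PosDef) (k : ℕ) :
    (M + (k : ℝ) • N).PosDef :=
  hM.add_posSemidef (hN.posSemidef.smul (Nat.cast_nonneg k))

lemma qpoly_coeff_one (i : ℕ) {M N : Matrix (Fin n) (Fin n) ℝ} (hM : M.PosDef) (hN : N.PosDef)
    (X : Matrix (Fin n) (Fin n) ℝ) :
    (qpoly i M N X).coeff 1 = (gmat i M N * X).trace := by
  simp only [qpoly, gmat, Polynomial.finsetSum_coeff, Polynomial.coeff_C_mul, Finset.sum_mul,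
    trace_sum, Matrix.smul_mul, trace_smul, smul_eq_mul]
  refine Finset.sum_congr rfl fun k _ => ?_
  rw [detPoly_coeff_one (posDef_add_smul hM hN k).det_pos.ne'.isUnit]

lemma cmix_smul {i : ℕ} (hi : i ≤ n) {a : ℝ} (ha : a ≠ 0) (A N : Matrix (Fin n) (Fin n) ℝ) :
    cmix i (a • A) N = a ^ (n - i) * cmix i A N := by
  rw [cmix_eq_coeff, cmix_eq_coeff]
  have h : detPoly (a • A) N =
      Polynomial.C (a ^ n) * (detPoly A N).comp (Polynomial.C a⁻¹ * Polynomial.X) := by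
    refine Polynomial.funext fun z => ?_
    simp only [detPoly_eval, Polynomial.eval_mul, Polynomial.eval_C, Polynomial.eval_comp,
      Polynomial.eval_X]
    have : a • A + z • N = a • (A + (a⁻¹ * z) • N) := by
      rw [smul_add, smul_smul, mul_inv_cancel_left₀ ha]
    rw [this, det_smul, Fintype.card_fin]
  rw [h, Polynomial.coeff_C_mul, Polynomial.comp_C_mul_X_coeff]
  obtain ⟨m, rfl⟩ := Nat.exists_eq_add_of_le hi
  rw [Nat.add_sub_cancel_left, pow_add, inv_pow]
  have := pow_ne_zero i ha
  field_simp

open scoped MatrixOrder in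
lemma exists_eq_conjTranspose_mul_self {N : Matrix (Fin n) (Fin n) ℝ} (hN : N.PosSemidef) :
    ∃ B : Matrix (Fin n) (Fin n) ℝ, N = Bᴴ * B := by
  obtain ⟨B, hB⟩ := CStarAlgebra.nonneg_iff_eq_star_mul_self.mp hN.nonneg
  exact ⟨B, hB⟩

/-- Simultaneous diagonalization of two positive definite matrices. -/
lemma exists_simul_diag {M N : Matrix (Fin n) (Fin n) ℝ} (hM : M.PosDef) (hN : N.PosDef) :
    ∃ (T : Matrix (Fin n) (Fin n) ℝ) (d : Fin n → ℝ), IsUnit T.det ∧ (∀ j, 0 < d j) ∧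
      N = Tᵀ * T ∧ M = Tᵀ * diagonal d * T := by
  obtain ⟨B, hB⟩ := exists_eq_conjTranspose_mul_self hN.posSemidef
  have hBu : IsUnit B.det := by
    have := hN.det_pos
    rw [hB, det_mul] at this
    exact (right_ne_zero_of_mul this.ne').isUnit
  have hBinj : Function.Injective B⁻¹.mulVec :=
    Matrix.mulVec_injective_iff_isUnit.2 ((Matrix.isUnit_iff_isUnit_det _).2
      (Matrix.isUnit_nonsing_inv_det _ hBu))
  have hM' : (B⁻¹ᴴ * M * B⁻¹).PosDef := hM.conjTranspose_mul_mul_same hBinj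
  have hspec := hM'.1.spectral_theorem
  set U : Matrix (Fin n) (Fin n) ℝ := (hM'.1.eigenvectorUnitary : Matrix (Fin n) (Fin n) ℝ)
  have hU1 : star U * U = 1 := Unitary.coe_star_mul_self hM'.1.eigenvectorUnitary
  have hU2 : U * star U = 1 := Unitary.coe_mul_star_self hM'.1.eigenvectorUnitary
  have hspec' : B⁻¹ᴴ * M * B⁻¹ = U * diagonal hM'.1.eigenvalues * star U := by
    conv_lhs => rw [hspec]
    rw [Unitary.conjStarAlgAut_apply]
    rfl
  have hBB : B⁻¹ * B = 1 := Matrix.nonsing_inv_mul _ hBu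
  have hBB' : Bᴴ * B⁻¹ᴴ = 1 := by rw [← conjTranspose_mul, hBB, conjTranspose_one]
  refine ⟨star U * B, hM'.1.eigenvalues, ?_, hM'.eigenvalues_pos, ?_, ?_⟩
  · rw [det_mul]
    refine IsUnit.mul ?_ hBu
    have := congrArg det hU1
    rw [det_mul, det_one] at this
    exact IsUnit.of_mul_eq_one _ this
  · rw [← conjTranspose_eq_transpose_of_trivial, conjTranspose_mul, star_eq_conjTranspose,
      conjTranspose_conjTranspose]
    rw [star_eq_conjTranspose] at hU2
    calc N = Bᴴ * B := hB
      _ = Bᴴ * (U * Uᴴ) * B := by rw [hU2, mul_one]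
      _ = _ := by simp only [mul_assoc]
  · rw [← conjTranspose_eq_transpose_of_trivial, conjTranspose_mul, star_eq_conjTranspose,
      conjTranspose_conjTranspose]
    rw [star_eq_conjTranspose] at hspec'
    calc M = (Bᴴ * B⁻¹ᴴ) * M * (B⁻¹ * B) := by rw [hBB, hBB', one_mul, mul_one]
      _ = Bᴴ * (B⁻¹ᴴ * M * B⁻¹) * B := by simp only [mul_assoc]
      _ = Bᴴ * (U * diagonal hM'.1.eigenvalues * Uᴴ) * B :=
          congrArg (fun Z => Bᴴ * Z * B) hspec'
      _ = _ := by simp only [mul_assoc]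

lemma prod_X_add_C_coeff_pos {ι : Type*} [DecidableEq ι] (S : Finset ι) {d : ι → ℝ}
    (hd : ∀ j, 0 < d j) :
    ∀ i : ℕ, 0 ≤ (∏ j ∈ S, (Polynomial.X + Polynomial.C (d j))).coeff i ∧
      (i ≤ S.card → 0 < (∏ j ∈ S, (Polynomial.X + Polynomial.C (d j))).coeff i) := by
  induction S using Finset.induction_on with
  | empty =>
    intro i
    rcases Nat.eq_zero_or_pos i with rfl | hi
    · simp
    · simp [Polynomial.coeff_one, hi.ne']
  | insert a S ha ih =>
    intro i
    rw [Finset.prod_insert ha, Finset.card_insert_of_notMem ha, add_mul]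
    rcases i with _ | i
    · have h0 := ih 0
      have h1 := mul_pos (hd a) (h0.2 (Nat.zero_le _))
      simp only [Polynomial.coeff_add, Polynomial.coeff_X_mul_zero,
        Polynomial.coeff_C_mul, zero_add]
      exact ⟨h1.le, fun _ => h1⟩
    · simp only [Polynomial.coeff_add, Polynomial.coeff_X_mul, Polynomial.coeff_C_mul]
      have h1 := mul_nonneg (hd a).le (ih (i + 1)).1
      refine ⟨add_nonneg (ih i).1 h1, fun h => add_pos_of_pos_of_nonneg ((ih i).2 ?_) h1⟩
      omega

lemma cmix_pos {i : ℕ} (hi : i ≤ n) {M N : Matrix (Fin n) (Fin n) ℝ} (hM : M.PosDef)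
    (hN : N.PosDef) : 0 < cmix i M N := by
  obtain ⟨T, d, hT, hd, rfl, rfl⟩ := exists_simul_diag hM hN
  have h : detPoly (Tᵀ * diagonal d * T) (Tᵀ * T)
      = Polynomial.C (T.det ^ 2) * ∏ j, (Polynomial.X + Polynomial.C (d j)) := by
    refine Polynomial.funext fun z => ?_
    rw [detPoly_eval]
    have : Tᵀ * diagonal d * T + z • (Tᵀ * T) = Tᵀ * diagonal (fun j => z + d j) * T := by
      have h2 : diagonal (fun j => z + d j) = z • (1 : Matrix (Fin n) (Fin n) ℝ) + diagonal d := by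
        rw [Matrix.smul_one_eq_diagonal, diagonal_add]
      rw [h2, mul_add, add_mul, add_comm]
      simp
    rw [this, det_mul, det_mul, det_transpose, det_diagonal]
    simp only [Polynomial.eval_mul, Polynomial.eval_C, Polynomial.eval_prod, Polynomial.eval_add,
      Polynomial.eval_X]
    ring
  rw [cmix_eq_coeff, h, Polynomial.coeff_C_mul]
  refine mul_pos (by have := hT.ne_zero; positivity) ((prod_X_add_C_coeff_pos _ hd i).2 ?_)
  simpa using hi

lemma gmat_posDef {i : ℕ} (hi : i < n) {M N : Matrix (Fin n) (Fin n) ℝ} (hM : M.PosDef)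
    (hN : N.PosDef) : (gmat i M N).PosDef := by
  have hherm : (gmat i M N).IsHermitian := by
    unfold gmat IsHermitian
    rw [conjTranspose_sum]
    refine Finset.sum_congr rfl fun k _ => ?_
    rw [conjTranspose_smul, star_trivial, (posDef_add_smul hM hN k).1.adjugate]
  refine Matrix.PosDef.of_dotProduct_mulVec_pos hherm fun v hv => ?_
  obtain ⟨T, d, hT, hd, rfl, rfl⟩ := exists_simul_diag hM hN
  set w : Fin n → ℝ := Tᵀ.adjugate *ᵥ v with hw
  have hw0 : w ≠ 0 := by
    intro h0
    apply hv
    have h1 : Tᵀ *ᵥ w = T.det • v := by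
      rw [hw, mulVec_mulVec, mul_adjugate, det_transpose, smul_mulVec, one_mulVec]
    rw [h0, mulVec_zero] at h1
    exact (smul_eq_zero.1 h1.symm).resolve_left hT.ne_zero
  have key : ∀ z : ℝ, v ⬝ᵥ (Tᵀ * diagonal d * T + z • (Tᵀ * T)).adjugate *ᵥ v
      = (∑ j, Polynomial.C (w j ^ 2) *
        ∏ l ∈ Finset.univ.erase j, (Polynomial.X + Polynomial.C (d l))).eval z := by
    intro z
    have h1 : Tᵀ * diagonal d * T + z • (Tᵀ * T) = Tᵀ * diagonal (fun j => z + d j) * T := by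
      have h2 : diagonal (fun j => z + d j) = z • (1 : Matrix (Fin n) (Fin n) ℝ) + diagonal d := by
        rw [Matrix.smul_one_eq_diagonal, diagonal_add]
      rw [h2, mul_add, add_mul, add_comm]
      simp
    have h3 : T.adjugate = Tᵀ.adjugateᵀ := by rw [← adjugate_transpose, transpose_transpose]
    rw [h1, adjugate_mul_distrib, adjugate_mul_distrib, adjugate_diagonal, h3, ← mul_assoc,
      ← mulVec_mulVec, ← hw, ← mulVec_mulVec, dotProduct_mulVec, vecMul_transpose, ← hw]
    simp only [Polynomial.eval_finsetSum, Polynomial.eval_mul, Polynomial.eval_C,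
      Polynomial.eval_prod, Polynomial.eval_add, Polynomial.eval_X, dotProduct, mulVec_diagonal]
    exact Finset.sum_congr rfl fun j _ => by ring
  have hdeg : (∑ j, Polynomial.C (w j ^ 2) *
        ∏ l ∈ Finset.univ.erase j, (Polynomial.X + Polynomial.C (d l))).natDegree ≤ n := by
    refine Polynomial.natDegree_sum_le_of_forall_le _ _ fun j _ => ?_
    refine (Polynomial.natDegree_C_mul_le _ _).trans ?_
    refine (Polynomial.natDegree_prod_le _ _).trans ?_
    simp
  have hsum : star v ⬝ᵥ gmat i (Tᵀ * diagonal d * T) (Tᵀ * T) *ᵥ v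
      = (∑ j, Polynomial.C (w j ^ 2) *
        ∏ l ∈ Finset.univ.erase j, (Polynomial.X + Polynomial.C (d l))).coeff i := by
    rw [coeff_eq_sum_wt hdeg, star_trivial, gmat, Matrix.sum_mulVec, dotProduct_sum]
    refine Finset.sum_congr rfl fun k _ => ?_
    rw [← key, smul_mulVec, dotProduct_smul, smul_eq_mul]
  rw [hsum, Polynomial.finsetSum_coeff]
  obtain ⟨j, hj⟩ := Function.ne_iff.1 hw0
  have hc : ∀ j : Fin n, 0 < (∏ l ∈ Finset.univ.erase j,
      (Polynomial.X + Polynomial.C (d l))).coeff i := by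
    intro j
    refine (prod_X_add_C_coeff_pos _ hd i).2 ?_
    rw [Finset.card_erase_of_mem (Finset.mem_univ j), Finset.card_univ, Fintype.card_fin]
    omega
  refine Finset.sum_pos' (fun j _ => ?_) ⟨j, Finset.mem_univ j, ?_⟩
  · rw [Polynomial.coeff_C_mul]
    exact mul_nonneg (sq_nonneg _) (hc j).le
  · rw [Polynomial.coeff_C_mul]
    have : w j ≠ 0 := hj
    exact mul_pos (by positivity) (hc j)

lemma trace_gmat_mul_self (i : ℕ) {M N : Matrix (Fin n) (Fin n) ℝ} (hM : M.PosDef)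
    (hN : N.PosDef) : (gmat i M N * M).trace = ((n : ℝ) - i) * cmix i M N := by
  set p := detPoly M N with hp
  have hder : ∀ k : ℕ, ((M + (k : ℝ) • N).adjugate * N).trace = p.derivative.eval (k : ℝ) := by
    intro k
    rw [← detPoly_coeff_one (posDef_add_smul hM hN k).det_pos.ne'.isUnit]
    have h1 : detPoly (M + (k : ℝ) • N) N = p.comp (Polynomial.X + Polynomial.C (k : ℝ)) := by
      refine Polynomial.funext fun z => ?_
      simp only [detPoly_eval, hp, Polynomial.eval_comp, Polynomial.eval_add, Polynomial.eval_X,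
        Polynomial.eval_C, add_smul]
      congr 1
      abel
    rw [h1]
    have h2 := Polynomial.coeff_derivative (p.comp (Polynomial.X + Polynomial.C (k : ℝ))) 0
    simp only [zero_add, Nat.cast_zero, mul_one] at h2
    rw [← h2, Polynomial.derivative_comp, Polynomial.coeff_zero_eq_eval_zero]
    simp [Polynomial.eval_comp]
  have htr : ∀ k : ℕ, ((M + (k : ℝ) • N).adjugate * M).trace
      = (Polynomial.C (n : ℝ) * p - Polynomial.X * p.derivative).eval (k : ℝ) := by
    intro k
    have h1 : (M + (k : ℝ) • N).adjugate * M + (k : ℝ) • ((M + (k : ℝ) • N).adjugate * N)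
        = (M + (k : ℝ) • N).det • (1 : Matrix (Fin n) (Fin n) ℝ) := by
      rw [← adjugate_mul, mul_add, Matrix.mul_smul]
    have h2 := congrArg trace h1
    rw [trace_add, trace_smul, trace_smul, trace_one, Fintype.card_fin, hder, ← detPoly_eval] at h2
    simp only [Polynomial.eval_sub, Polynomial.eval_mul, Polynomial.eval_C, Polynomial.eval_X]
    simp only [smul_eq_mul] at h2
    linarith
  have hdeg : (Polynomial.C (n : ℝ) * p - Polynomial.X * p.derivative).natDegree ≤ n := by
    refine (Polynomial.natDegree_sub_le _ _).trans (max_le ?_ ?_)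
    · exact (Polynomial.natDegree_C_mul_le _ _).trans (detPoly_natDegree_le _ _)
    · by_cases h0 : p.natDegree = 0
      · rw [Polynomial.eq_C_of_natDegree_eq_zero h0]
        simp
      · refine Polynomial.natDegree_mul_le.trans ?_
        have h1 := Polynomial.natDegree_derivative_lt h0
        have h2 : p.natDegree ≤ n := detPoly_natDegree_le _ _
        rw [Polynomial.natDegree_X]
        omega
  have hfin : (gmat i M N * M).trace
      = (Polynomial.C (n : ℝ) * p - Polynomial.X * p.derivative).coeff i := by
    rw [coeff_eq_sum_wt hdeg, gmat, Finset.sum_mul, trace_sum]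
    refine Finset.sum_congr rfl fun k _ => ?_
    rw [Matrix.smul_mul, trace_smul, smul_eq_mul, htr]
  rw [hfin, cmix_eq_coeff, Polynomial.coeff_sub, Polynomial.coeff_C_mul]
  rcases i with _ | i
  · simp [hp]
  · rw [Polynomial.coeff_X_mul, Polynomial.coeff_derivative]
    push_cast
    ring

lemma trace_mul_vecMulVec (G : Matrix (Fin n) (Fin n) ℝ) (u v : Fin n → ℝ) :
    (G * vecMulVec u v).trace = v ⬝ᵥ G *ᵥ u := by
  rw [mul_vecMulVec, trace_vecMulVec, dotProduct_comm]

/-! ### Hyperbolicity of mixed discriminants -/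

lemma qpoly_natDegree_le {i : ℕ} (hi : i ≤ n) (M N X : Matrix (Fin n) (Fin n) ℝ) :
    (qpoly i M N X).natDegree ≤ n - i := by
  have key : Polynomial.X ^ n * qpoly i M N X
      = Polynomial.X ^ (n - i) * (qpoly i X N M).reflect n := by
    refine Polynomial.eq_of_infinite_eval_eq _ _ ((Set.Ioi_infinite (0 : ℝ)).mono fun s hs => ?_)
    have hs0 : s ≠ 0 := ne_of_gt hs
    let : Invertible (s⁻¹) := invertibleOfNonzero (inv_ne_zero hs0)
    have h1 := Polynomial.eval₂_reflect_mul_pow (RingHom.id ℝ) (s⁻¹) n (qpoly i X N M)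
      (qpoly_natDegree_le_card i X N M)
    rw [invOf_eq_inv, inv_inv, Polynomial.eval₂_id, Polynomial.eval₂_id, qpoly_eval] at h1
    have h2 : M + s • X = s • (X + s⁻¹ • M) := by
      rw [smul_add, smul_smul, mul_inv_cancel₀ hs0, one_smul, add_comm]
    change Polynomial.eval s _ = Polynomial.eval s _
    rw [Polynomial.eval_mul, Polynomial.eval_mul, Polynomial.eval_X_pow, Polynomial.eval_X_pow,
      qpoly_eval, h2, cmix_smul hi hs0, ← h1, inv_pow]
    have := pow_ne_zero n hs0
    field_simp
  by_cases hq : qpoly i M N X = 0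
  · rw [hq]
    simp
  have h1 := congrArg Polynomial.natDegree key
  rw [Polynomial.natDegree_mul (pow_ne_zero _ Polynomial.X_ne_zero) hq,
    Polynomial.natDegree_X_pow] at h1
  have h2 : (Polynomial.X ^ (n - i) * (qpoly i X N M).reflect n).natDegree ≤ (n - i) + n := by
    refine Polynomial.natDegree_mul_le.trans ?_
    rw [Polynomial.natDegree_X_pow]
    have := (Polynomial.natDegree_reflect_le (N := n) (p := qpoly i X N M)).trans
      (max_le le_rfl (qpoly_natDegree_le_card i X N M))
    omega
  omega

lemma rootSet_iterate_derivative_subset {H : Set ℂ} (hH : Convex ℝ H) {p : Polynomial ℂ}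
    (hp : p.rootSet ℂ ⊆ H) (j : ℕ) : (Polynomial.derivative^[j] p).rootSet ℂ ⊆ H := by
  induction j with
  | zero => simpa using hp
  | succ j ih =>
    rw [Function.iterate_succ_apply']
    rcases lt_or_ge 0 (Polynomial.derivative^[j] p).degree with h | h
    · exact (Polynomial.rootSet_derivative_subset_convexHull_rootSet h).trans (convexHull_min ih hH)
    · rw [Polynomial.eq_C_of_degree_le_zero h]
      simp

lemma convex_im_half_plane (s : ℂ) :
    Convex ℝ {z : ℂ | 0 < (z * (starRingEnd ℂ) s).im * s.im} := by
  intro x hx y hy a b ha hb hab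
  simp only [mem_ofPred_eq] at *
  have : ((a • x + b • y) * (starRingEnd ℂ) s).im * s.im
      = a * ((x * (starRingEnd ℂ) s).im * s.im) + b * ((y * (starRingEnd ℂ) s).im * s.im) := by
    simp
    ring
  rw [this]
  rcases ha.eq_or_lt with rfl | ha
  · have : b = 1 := by linarith
    subst this
    simpa using hy
  · have := mul_nonneg hb hy.le
    have := mul_pos ha hx
    linarith

/-- The complexification of a real matrix. -/
def cplx (M : Matrix (Fin n) (Fin n) ℝ) : Matrix (Fin n) (Fin n) ℂ := M.map Complex.ofReal

lemma cplx_det (M : Matrix (Fin n) (Fin n) ℝ) : (cplx M).det = (M.det : ℂ) := by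
  have := (Complex.ofRealHom).map_det M
  exact this.symm

open scoped ComplexOrder in
lemma cplx_posDef {M : Matrix (Fin n) (Fin n) ℝ} (hM : M.PosDef) : (cplx M).PosDef := by
  obtain ⟨B, rfl⟩ := exists_eq_conjTranspose_mul_self hM.posSemidef
  have h : cplx (Bᴴ * B) = (cplx B)ᴴ * cplx B := by
    ext i j
    simp [cplx, Matrix.mul_apply]
  rw [h]
  refine Matrix.PosDef.conjTranspose_mul_self _ (Matrix.mulVec_injective_iff_isUnit.2
    ((Matrix.isUnit_iff_isUnit_det _).2 ?_))
  rw [cplx_det]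
  have := hM.det_pos
  rw [det_mul] at this
  have := right_ne_zero_of_mul this.ne'
  exact isUnit_iff_ne_zero.2 (by exact_mod_cast this)

lemma cplx_isHermitian {X : Matrix (Fin n) (Fin n) ℝ} (hX : X.IsHermitian) :
    (cplx X).IsHermitian := by
  ext i j
  have := congrFun (congrFun hX i) j
  simp only [conjTranspose_apply, star_trivial] at this
  simp [cplx, this]

open scoped ComplexOrder in
lemma root_mem_half_plane {M N X : Matrix (Fin n) (Fin n) ℝ} (hM : M.PosDef) (hN : N.PosDef)
    (hX : X.IsHermitian) {s z : ℂ} (hs : s.im ≠ 0)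
    (h : (cplx M + s • cplx X + z • cplx N).det = 0) :
    0 < (z * (starRingEnd ℂ) s).im * s.im := by
  obtain ⟨w, hw, hw0⟩ := Matrix.exists_mulVec_eq_zero_iff.2 h
  have h1 := congrArg (fun u => star w ⬝ᵥ u) hw0
  simp only [add_mulVec, smul_mulVec, dotProduct_add, dotProduct_smul, dotProduct_zero,
    smul_eq_mul] at h1
  have ha := (cplx_posDef hM).dotProduct_mulVec_pos hw
  have hc := (cplx_posDef hN).dotProduct_mulVec_pos hw
  have hb : (star w ⬝ᵥ cplx X *ᵥ w).im = 0 :=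
    (cplx_isHermitian hX).im_star_dotProduct_mulVec_self w
  generalize star w ⬝ᵥ cplx M *ᵥ w = a at *
  generalize star w ⬝ᵥ cplx N *ᵥ w = c at *
  generalize star w ⬝ᵥ cplx X *ᵥ w = b at *
  rw [Complex.lt_def] at ha hc
  have e1 := congrArg Complex.re h1
  have e2 := congrArg Complex.im h1
  simp only [Complex.add_re, Complex.add_im, Complex.mul_re, Complex.mul_im, Complex.zero_re,
    Complex.zero_im, hb, ← ha.2, ← hc.2, mul_zero, sub_zero, zero_add] at e1 e2 ha hc
  have key : c.re * ((z * (starRingEnd ℂ) s).im * s.im) = a.re * s.im ^ 2 := by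
    simp only [Complex.mul_im, Complex.conj_re, Complex.conj_im]
    linear_combination (-s.im ^ 2) * e1 + s.re * s.im * e2
  have h2 : 0 < a.re * s.im ^ 2 := mul_pos ha.1 (by positivity)
  rw [← key] at h2
  exact (pos_iff_pos_of_mul_pos h2).1 hc.1

lemma qpoly_map_eval_ne_zero {i : ℕ} (hi : i ≤ n) {M N X : Matrix (Fin n) (Fin n) ℝ}
    (hM : M.PosDef) (hN : N.PosDef) (hX : X.IsHermitian) {s : ℂ} (hs : s.im ≠ 0) :
    ((qpoly i M N X).map Complex.ofRealHom).eval s ≠ 0 := by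
  set r := detPoly (cplx M + s • cplx X) (cplx N) with hr
  have hmap : ∀ P Q : Matrix (Fin n) (Fin n) ℝ,
      (detPoly P Q).map Complex.ofRealHom = detPoly (cplx P) (cplx Q) := by
    intro P Q
    rw [detPoly, detPoly, ← Polynomial.coe_mapRingHom, RingHom.map_det]
    congr 1
    ext1 a b
    simp [cplx]
  have h1 : ((qpoly i M N X).map Complex.ofRealHom).eval s = r.coeff i := by
    rw [coeff_eq_sum_wt_complex (detPoly_natDegree_le _ _) hi]
    simp only [qpoly, Polynomial.map_sum, Polynomial.map_mul, Polynomial.map_C, hmap,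
      Polynomial.eval_finsetSum, Polynomial.eval_mul, Polynomial.eval_C, detPoly_eval]
    refine Finset.sum_congr rfl fun k _ => ?_
    congr 2
    have : cplx (M + (k : ℝ) • N) = cplx M + (k : ℂ) • cplx N := by
      ext a b
      simp [cplx]
    rw [this, add_right_comm]
  rw [h1]
  intro h0
  have hcn : r.coeff n ≠ 0 := by
    rw [hr, detPoly_coeff_top, cplx_det]
    exact_mod_cast hN.det_pos.ne'
  have hroots : r.rootSet ℂ ⊆ {z : ℂ | 0 < (z * (starRingEnd ℂ) s).im * s.im} := by
    intro z hz
    rw [Polynomial.mem_rootSet] at hz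
    refine root_mem_half_plane hM hN hX hs ?_
    have h2 := hz.2
    rwa [Polynomial.coe_aeval_eq_eval, hr, detPoly_eval] at h2
  have h2 := rootSet_iterate_derivative_subset (convex_im_half_plane s) hroots i
  have h3 : (0 : ℂ) ∈ (Polynomial.derivative^[i] r).rootSet ℂ := by
    rw [Polynomial.mem_rootSet]
    constructor
    · intro h4
      have h5 := Polynomial.coeff_iterate_derivative (k := i) r (n - i)
      rw [h4, Polynomial.coeff_zero, Nat.sub_add_cancel hi, nsmul_eq_mul] at h5
      refine (mul_ne_zero ?_ hcn) h5.symm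
      exact_mod_cast (Nat.descFactorial_pos.2 hi).ne'
    · rw [Polynomial.coe_aeval_eq_eval, ← Polynomial.coeff_zero_eq_eval_zero,
        Polynomial.coeff_iterate_derivative, zero_add, h0, smul_zero]
  have := h2 h3
  simp at this

lemma qpoly_splits {i : ℕ} (hi : i ≤ n) {M N X : Matrix (Fin n) (Fin n) ℝ}
    (hM : M.PosDef) (hN : N.PosDef) (hX : X.IsHermitian) : (qpoly i M N X).Splits := by
  refine Polynomial.Splits.of_splits_map Complex.ofRealHom (IsAlgClosed.splits _) fun z hz => ?_
  by_cases hz0 : z.im = 0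
  · exact ⟨z.re, Complex.ext (by simp) (by simp [hz0])⟩
  · exact absurd (Polynomial.isRoot_of_mem_roots hz) (qpoly_map_eval_ne_zero hi hM hN hX hz0)

lemma coeff_prod_one_add (S : Multiset ℝ) :
    (S.map fun c => (1 + Polynomial.C c * Polynomial.X : Polynomial ℝ)).prod.coeff 0 = 1 ∧
    (S.map fun c => (1 + Polynomial.C c * Polynomial.X : Polynomial ℝ)).prod.coeff 1 = S.sum ∧
    2 * (S.map fun c => (1 + Polynomial.C c * Polynomial.X : Polynomial ℝ)).prod.coeff 2
      = S.sum ^ 2 - (S.map (· ^ 2)).sum := by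
  induction S using Multiset.induction_on with
  | empty => simp [Polynomial.coeff_one]
  | cons c S ih =>
    obtain ⟨h0, h1, h2⟩ := ih
    simp only [Multiset.map_cons, Multiset.prod_cons, Multiset.sum_cons, add_mul, one_mul,
      mul_assoc, Polynomial.coeff_add, Polynomial.coeff_C_mul, Polynomial.coeff_X_mul_zero,
      Polynomial.coeff_X_mul, h0, h1]
    refine ⟨by simp, by ring, by linarith⟩

lemma multiset_sum_sq_le (S : Multiset ℝ) :
    S.sum ^ 2 ≤ S.card * (S.map (· ^ 2)).sum ∧ 0 ≤ (S.map (· ^ 2)).sum := by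
  induction S using Multiset.induction_on with
  | empty => simp
  | cons c S ih =>
    obtain ⟨h1, h2⟩ := ih
    simp only [Multiset.map_cons, Multiset.sum_cons, Multiset.card_cons]
    refine ⟨?_, by positivity⟩
    push_cast
    rcases Nat.eq_zero_or_pos S.card with h | h
    · rw [Multiset.card_eq_zero.1 h]
      simp
    · have hk : (0 : ℝ) < S.card := by exact_mod_cast h
      have : 2 * c * S.sum ≤ S.card * c ^ 2 + (S.map (· ^ 2)).sum := by
        have := sq_nonneg (S.card * c - S.sum)
        refine le_of_mul_le_mul_left ?_ hk
        nlinarith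
      nlinarith

lemma splits_newton {q : Polynomial ℝ} (hq : q.Splits) (h0 : q.coeff 0 ≠ 0) {m : ℕ}
    (hm : q.natDegree ≤ m) (hm0 : 0 < m) :
    2 * q.coeff 0 * q.coeff 2 ≤ (1 - 1 / (m : ℝ)) * q.coeff 1 ^ 2 := by
  set S := q.roots.map fun r => -r⁻¹ with hS
  have hroot : ∀ r ∈ q.roots, r ≠ 0 := by
    rintro r hr rfl
    have := Polynomial.isRoot_of_mem_roots hr
    rw [Polynomial.IsRoot, ← Polynomial.coeff_zero_eq_eval_zero] at this
    exact h0 this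
  have hfac : ∃ a : ℝ, q = Polynomial.C a *
      (S.map fun c => (1 + Polynomial.C c * Polynomial.X : Polynomial ℝ)).prod := by
    refine ⟨q.leadingCoeff * (q.roots.map fun r => -r).prod, ?_⟩
    conv_lhs => rw [hq.eq_prod_roots]
    rw [Polynomial.C_mul, mul_assoc]
    congr 1
    rw [hS, Multiset.map_map, map_multiset_prod, Multiset.map_map, ← Multiset.prod_map_mul]
    refine congrArg _ (Multiset.map_congr rfl fun r hr => ?_)
    simp only [Function.comp]
    rw [mul_add, mul_one, ← mul_assoc, ← Polynomial.C_mul, neg_mul_neg,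
      mul_inv_cancel₀ (hroot r hr)]
    simp
    ring
  obtain ⟨a, ha⟩ := hfac
  obtain ⟨e0, e1, e2⟩ := coeff_prod_one_add S
  obtain ⟨hcs, hQ⟩ := multiset_sum_sq_le S
  have hcard : (S.card : ℝ) ≤ m := by
    rw [hS, Multiset.card_map]
    exact_mod_cast (Polynomial.card_roots' q).trans hm
  rw [ha]
  simp only [Polynomial.coeff_C_mul, e0, e1]
  have hm' : (0 : ℝ) < m := by exact_mod_cast hm0
  have h3 : S.sum ^ 2 / m ≤ (S.map (· ^ 2)).sum := by
    rw [div_le_iff₀ hm']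
    nlinarith
  have h4 : 0 ≤ a ^ 2 * ((S.map (· ^ 2)).sum - S.sum ^ 2 / m) :=
    mul_nonneg (sq_nonneg _) (by linarith)
  have h5 : 2 * (a * 1) * (a * (S.map fun c =>
      (1 + Polynomial.C c * Polynomial.X : Polynomial ℝ)).prod.coeff 2)
      = a ^ 2 * (S.sum ^ 2 - (S.map (· ^ 2)).sum) := by rw [← e2]; ring
  rw [h5]
  have h6 : (1 - 1 / (m : ℝ)) * (a * S.sum) ^ 2 = a ^ 2 * (S.sum ^ 2 - S.sum ^ 2 / m) := by
    field_simp
  rw [h6]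
  nlinarith

/-- The pointwise Alexandrov inequality for mixed discriminants. -/
lemma qpoly_newton {i : ℕ} (hi : i < n) {M N X : Matrix (Fin n) (Fin n) ℝ}
    (hM : M.PosDef) (hN : N.PosDef) (hX : X.IsHermitian) :
    2 * cmix i M N * (qpoly i M N X).coeff 2
      ≤ (1 - 1 / ((n : ℝ) - i)) * (gmat i M N * X).trace ^ 2 := by
  have h := splits_newton (qpoly_splits hi.le hM hN hX)
    (by rw [qpoly_coeff_zero]; exact (cmix_pos hi.le hM hN).ne')
    (qpoly_natDegree_le hi.le M N X) (Nat.sub_pos_of_lt hi)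
  rwa [qpoly_coeff_zero, qpoly_coeff_one i hM hN, Nat.cast_sub hi.le] at h

/-! ### Convex bodies and their potentials -/

/-- A compact convex set with nonempty interior. -/
structure IsBody (C : Set (Euc n)) : Prop where
  compact : IsCompact C
  convex : Convex ℝ C
  interior_nonempty : (interior C).Nonempty

/-- A strictly convex function whose gradient parametrizes the interior of `C`, with enough control
at infinity to integrate by parts. -/
structure IsPotential (φ : Euc n → ℝ) (C : Set (Euc n)) : Prop where
  contDiff : ContDiff ℝ ∞ φ
  posDef : ∀ x, (hess φ x).PosDef
  grd_mem : ∀ x, grd φ x ∈ C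
  tendsto_sub_inner : ∀ y ∈ interior C,
    Tendsto (fun x => φ x - inner ℝ x y) (cocompact (Euc n)) atTop
  hess_radial_le : ∃ c, ∀ x, x.ofLp ⬝ᵥ hess φ x *ᵥ x.ofLp ≤ c
  tendsto_legendre : Tendsto (fun x => (∑ i, x i * pd i φ x) - φ x) (cocompact (Euc n)) atTop

lemma IsBody.nonempty {C : Set (Euc n)} (hC : IsBody C) : C.Nonempty :=
  hC.interior_nonempty.mono interior_subset

lemma IsBody.add {C D : Set (Euc n)} (hC : IsBody C) (hD : IsBody D) : IsBody (C + D) where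
  compact := hC.compact.add hD.compact
  convex := hC.convex.add hD.convex
  interior_nonempty :=
    (hC.interior_nonempty.add hD.interior_nonempty).mono
      (interior_maximal (add_subset_add interior_subset interior_subset)
        (isOpen_interior.add_right))

lemma IsBody.smul {C : Set (Euc n)} (hC : IsBody C) {a : ℝ} (ha : 0 < a) : IsBody (a • C) where
  compact := hC.compact.smul a
  convex := hC.convex.smul a
  interior_nonempty := by
    rw [interior_smul₀ ha.ne']
    exact hC.interior_nonempty.smul_set

lemma interior_add_subset {C D : Set (Euc n)} (hC : IsBody C) (hD : IsBody D) :
    interior (C + D) ⊆ interior C + interior D := by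
  have hopen : IsOpen (interior C + interior D) := isOpen_interior.add_right
  have hconv : Convex ℝ (interior C + interior D) := hC.convex.interior.add hD.convex.interior
  have hne : (interior (interior C + interior D)).Nonempty := by
    rw [hopen.interior_eq]
    exact hC.interior_nonempty.add hD.interior_nonempty
  have h := hconv.interior_closure_eq_interior_of_nonempty_interior hne
  rw [hopen.interior_eq] at h
  rw [← h]
  refine interior_mono ?_
  have hcl : ∀ {S : Set (Euc n)}, IsBody S → S ⊆ closure (interior S) := fun {S} hS => by
    rw [hS.convex.closure_interior_eq_closure_of_nonempty_interior hS.interior_nonempty]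
    exact subset_closure
  rintro _ ⟨x, hx, y, hy, rfl⟩
  exact map_mem_closure₂ continuous_add (hcl hC hx) (hcl hD hy)
    fun a ha b hb => add_mem_add ha hb

/-! ### Exponential integrals -/

/-- The exponential integral of `F` over `C`. -/
def lap (C : Set (Euc n)) (F : Euc n → ℝ) (x : Euc n) : ℝ :=
  ∫ y in C, F y * Real.exp (inner ℝ x y)

section lap

variable {C : Set (Euc n)}

lemma lap_integrable (hC : IsCompact C) {F : Euc n → ℝ} (hF : Continuous F) (x : Euc n) :
    IntegrableOn (fun y => F y * Real.exp (inner ℝ x y)) C := by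
  refine ContinuousOn.integrableOn_compact hC ?_
  fun_prop

lemma lap_add (hC : IsCompact C) {F G : Euc n → ℝ} (hF : Continuous F) (hG : Continuous G)
    (x : Euc n) : lap C (fun y => F y + G y) x = lap C F x + lap C G x := by
  simp only [lap, add_mul]
  exact integral_add (lap_integrable hC hF x) (lap_integrable hC hG x)

lemma lap_const_mul (c : ℝ) (F : Euc n → ℝ) (x : Euc n) :
    lap C (fun y => c * F y) x = c * lap C F x := by
  simp only [lap, mul_assoc]
  exact integral_const_mul _ _

lemma lap_sum (hC : IsCompact C) {ι : Type*} (S : Finset ι) {F : ι → Euc n → ℝ}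
    (hF : ∀ i, Continuous (F i)) (x : Euc n) :
    lap C (fun y => ∑ i ∈ S, F i y) x = ∑ i ∈ S, lap C (F i) x := by
  simp only [lap, Finset.sum_mul]
  exact integral_finsetSum _ fun i _ => lap_integrable hC (hF i) x

lemma lap_mono (hC : IsCompact C) {F G : Euc n → ℝ} (hF : Continuous F) (hG : Continuous G)
    (h : ∀ y ∈ C, F y ≤ G y) (x : Euc n) : lap C F x ≤ lap C G x :=
  setIntegral_mono_on (lap_integrable hC hF x) (lap_integrable hC hG x) hC.measurableSet
    fun y hy => mul_le_mul_of_nonneg_right (h y hy) (Real.exp_pos _).le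

lemma lap_pos (hC : IsCompact C) {F : Euc n → ℝ} (hF : Continuous F) (h0 : ∀ y ∈ C, 0 ≤ F y)
    {y₀ : Euc n} (hy₀ : y₀ ∈ interior C) (h : F y₀ ≠ 0) (x : Euc n) : 0 < lap C F x := by
  rw [lap, setIntegral_pos_iff_support_of_nonneg_ae _ (lap_integrable hC hF x)]
  · have hopen : IsOpen (interior C ∩ {y | F y ≠ 0}) :=
      isOpen_interior.inter (isOpen_ne_fun hF continuous_const)
    refine (hopen.measure_pos volume ⟨y₀, hy₀, h⟩).trans_le (measure_mono ?_)
    rintro y ⟨hy, hFy⟩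
    exact ⟨mul_ne_zero hFy (Real.exp_pos _).ne', interior_subset hy⟩
  · refine (ae_restrict_iff' hC.measurableSet).2 (Eventually.of_forall fun y hy => ?_)
    exact mul_nonneg (h0 y hy) (Real.exp_pos _).le

lemma lap_one_pos (hC : IsBody C) (x : Euc n) : 0 < lap C (fun _ => 1) x :=
  lap_pos hC.compact continuous_const (fun _ _ => zero_le_one) hC.interior_nonempty.some_mem
    one_ne_zero x

lemma hasFDerivAt_lap (hC : IsCompact C) {F : Euc n → ℝ} (hF : Continuous F) (x : Euc n) :
    HasFDerivAt (lap C F)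
      (∑ i, lap C (fun y => F y * y i) x • (EuclideanSpace.proj i : Euc n →L[ℝ] ℝ)) x := by
  obtain ⟨R, hR⟩ := hC.isBounded.exists_norm_le
  obtain ⟨B, hB⟩ := (hC.image hF).isBounded.exists_norm_le
  have hderiv : ∀ y : Euc n, ∀ z : Euc n,
      HasFDerivAt (fun z => F y * Real.exp (inner ℝ z y))
        ((F y * Real.exp (inner ℝ z y)) • (innerSL ℝ y : Euc n →L[ℝ] ℝ)) z := by
    intro y z
    have h1 : HasFDerivAt (fun z : Euc n => inner ℝ z y) (innerSL ℝ y : Euc n →L[ℝ] ℝ) z := by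
      have := (innerSL ℝ y : Euc n →L[ℝ] ℝ).hasFDerivAt (x := z)
      refine this.congr_of_eventuallyEq (Eventually.of_forall fun w => ?_)
      simp [real_inner_comm]
    have := (h1.exp).const_mul (F y)
    simpa [smul_smul] using this
  have h := hasFDerivAt_integral_of_dominated_of_fderiv_le (𝕜 := ℝ) (μ := volume.restrict C)
    (F := fun z y => F y * Real.exp (inner ℝ z y))
    (F' := fun z y => (F y * Real.exp (inner ℝ z y)) • (innerSL ℝ y : Euc n →L[ℝ] ℝ))
    (x₀ := x) (s := Metric.ball x 1) (bound := fun _ => (B * Real.exp ((‖x‖ + 1) * R)) * R)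
    (Metric.ball_mem_nhds x one_pos)
    (Eventually.of_forall fun z => (lap_integrable hC hF z).aestronglyMeasurable)
    (lap_integrable hC hF x)
    (by
      refine Continuous.aestronglyMeasurable ?_
      have : Continuous fun y : Euc n => (innerSL ℝ y : Euc n →L[ℝ] ℝ) := (innerSL ℝ).continuous
      fun_prop)
    (by
      refine (ae_restrict_iff' hC.measurableSet).2 (Eventually.of_forall fun y hy z hz => ?_)
      rw [norm_smul, norm_mul, innerSL_apply_norm, Real.norm_eq_abs (Real.exp _), Real.abs_exp]
      have hB' : ‖F y‖ ≤ B := hB _ (mem_image_of_mem F hy)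
      have hz' : ‖z‖ ≤ ‖x‖ + 1 := by
        have : ‖z - x‖ < 1 := by simpa [dist_eq_norm] using hz
        have := norm_le_norm_add_norm_sub' z x
        linarith
      have hR0 := (norm_nonneg y).trans (hR y hy)
      have : inner ℝ z y ≤ (‖x‖ + 1) * R :=
        (real_inner_le_norm z y).trans (mul_le_mul hz' (hR y hy) (norm_nonneg _) (by positivity))
      have hB0 := (norm_nonneg _).trans hB'
      gcongr
      exact hR y hy)
    (continuous_const.continuousOn.integrableOn_compact hC)
    (Eventually.of_forall fun y z _ => hderiv y z)
  have hi : IntegrableOn (fun y => (F y * Real.exp (inner ℝ x y)) • (innerSL ℝ y : Euc n →L[ℝ] ℝ))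
      C := by
    refine ContinuousOn.integrableOn_compact hC ?_
    have : Continuous fun y : Euc n => (innerSL ℝ y : Euc n →L[ℝ] ℝ) := (innerSL ℝ).continuous
    fun_prop
  have heq : (∑ i, lap C (fun y => F y * y i) x • (EuclideanSpace.proj i : Euc n →L[ℝ] ℝ))
      = ∫ y in C, (F y * Real.exp (inner ℝ x y)) • (innerSL ℝ y : Euc n →L[ℝ] ℝ) := ?_
  · rw [heq]
    exact h
  refine ContinuousLinearMap.ext fun u => ?_
  rw [ContinuousLinearMap.integral_apply hi]
  simp only [_root_.sum_apply, _root_.smul_apply, smul_eq_mul, lap,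
    PiLp.proj_apply, innerSL_apply_apply]
  simp_rw [← integral_mul_const]
  rw [← integral_finsetSum]
  · refine integral_congr_ae (Eventually.of_forall fun y => ?_)
    simp only [PiLp.inner_apply, RCLike.inner_apply, conj_trivial, Finset.mul_sum]
    exact Finset.sum_congr rfl fun i _ => by ring
  · intro i _
    refine ContinuousOn.integrableOn_compact hC ?_
    fun_prop

lemma contDiff_lap (hC : IsCompact C) {F : Euc n → ℝ} (hF : Continuous F) :
    ContDiff ℝ ∞ (lap C F) := by
  rw [contDiff_infty]
  intro m
  induction m generalizing F with
  | zero =>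
    rw [Nat.cast_zero, contDiff_zero]
    exact continuous_iff_continuousAt.2 fun x => (hasFDerivAt_lap hC hF x).continuousAt
  | succ m ih =>
    push_cast
    rw [contDiff_succ_iff_hasFDerivAt]
    refine ⟨_, ?_, fun x => hasFDerivAt_lap hC hF x⟩
    exact ContDiff.sum fun i _ => (ih (by fun_prop)).smul contDiff_const

end lap

/-! ### The logarithmic Laplace transform of a convex body -/

/-- The logarithmic Laplace transform of the indicator of `C`. -/
def logLap (C : Set (Euc n)) (x : Euc n) : ℝ := Real.log (lap C (fun _ => 1) x)

/-- The mean of `F` under the exponentially tilted uniform measure on `C`. -/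
def tmean (C : Set (Euc n)) (F : Euc n → ℝ) (x : Euc n) : ℝ := lap C F x / lap C (fun _ => 1) x

section

variable {C : Set (Euc n)}

lemma tmean_const (hC : IsBody C) (c : ℝ) (x : Euc n) : tmean C (fun _ => c) x = c := by
  have h := lap_const_mul (C := C) c (fun _ => 1) x
  simp only [mul_one] at h
  rw [tmean, h, mul_div_assoc, div_self (lap_one_pos hC x).ne', mul_one]

lemma tmean_add (hC : IsBody C) {F G : Euc n → ℝ} (hF : Continuous F) (hG : Continuous G)
    (x : Euc n) : tmean C (fun y => F y + G y) x = tmean C F x + tmean C G x := by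
  rw [tmean, lap_add hC.compact hF hG, add_div]; rfl

lemma tmean_const_mul (c : ℝ) (F : Euc n → ℝ) (x : Euc n) :
    tmean C (fun y => c * F y) x = c * tmean C F x := by
  rw [tmean, lap_const_mul, mul_div_assoc]; rfl

lemma tmean_sum (hC : IsBody C) {ι : Type*} (S : Finset ι) {F : ι → Euc n → ℝ}
    (hF : ∀ i, Continuous (F i)) (x : Euc n) :
    tmean C (fun y => ∑ i ∈ S, F i y) x = ∑ i ∈ S, tmean C (F i) x := by
  rw [tmean, lap_sum hC.compact S hF, Finset.sum_div]; rfl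

lemma tmean_mono (hC : IsBody C) {F G : Euc n → ℝ} (hF : Continuous F) (hG : Continuous G)
    (h : ∀ y ∈ C, F y ≤ G y) (x : Euc n) : tmean C F x ≤ tmean C G x :=
  div_le_div_of_nonneg_right (lap_mono hC.compact hF hG h x) (lap_one_pos hC x).le

lemma tmean_inner (hC : IsBody C) (u x : Euc n) :
    tmean C (fun y => inner ℝ u y) x = ∑ i, u i * tmean C (fun y => y i) x := by
  have : (fun y : Euc n => inner ℝ u y) = fun y => ∑ i, u i * y i := by
    ext y
    simp only [PiLp.inner_apply, RCLike.inner_apply, conj_trivial]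
    exact Finset.sum_congr rfl fun i _ => mul_comm _ _
  rw [this, tmean_sum hC _ (fun i => by fun_prop)]
  exact Finset.sum_congr rfl fun i _ => tmean_const_mul _ _ _

lemma contDiff_logLap (hC : IsBody C) : ContDiff ℝ ∞ (logLap C) :=
  (contDiff_lap hC.compact continuous_const).log fun x => (lap_one_pos hC x).ne'

lemma pd_logLap (hC : IsBody C) (i : Fin n) :
    pd i (logLap C) = fun x => tmean C (fun y => y i) x := by
  ext x
  have h := (hasFDerivAt_lap hC.compact (continuous_const (y := (1 : ℝ))) x).log
    (lap_one_pos hC x).ne'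
  rw [pd_eq_of_hasFDerivAt (f := logLap C) h]
  simp [tmean, div_eq_inv_mul]

lemma hess_logLap (hC : IsBody C) (x : Euc n) (i j : Fin n) :
    hess (logLap C) x i j = tmean C (fun y => y i * y j) x
      - tmean C (fun y => y i) x * tmean C (fun y => y j) x := by
  have hci : Continuous fun y : Euc n => y i := by fun_prop
  have hZ := (lap_one_pos hC x).ne'
  have h1 : pd i (logLap C)
      = fun x => lap C (fun y => y i) x * (lap C (fun _ => 1) x)⁻¹ := by
    rw [pd_logLap hC]; rfl
  have h2 := (hasFDerivAt_lap hC.compact hci x).mul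
    ((hasDerivAt_inv hZ).comp_hasFDerivAt x
      (hasFDerivAt_lap hC.compact (continuous_const (y := (1 : ℝ))) x))
  rw [hess_apply, h1, pd_eq_of_hasFDerivAt (f := fun x => lap C (fun y => y i) x *
    (lap C (fun _ => 1) x)⁻¹) h2]
  simp [tmean]
  field_simp
  ring

/-- The Hessian of the logarithmic Laplace transform is a covariance matrix. -/
lemma quad_hess_logLap (hC : IsBody C) (x u : Euc n) :
    u.ofLp ⬝ᵥ hess (logLap C) x *ᵥ u.ofLp = tmean C (fun y => inner ℝ u y ^ 2) x
      - tmean C (fun y => inner ℝ u y) x ^ 2 := by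
  have h2 : (fun y : Euc n => inner ℝ u y ^ 2) = fun y => ∑ i, ∑ j, (u i * u j) * (y i * y j) := by
    ext y
    simp only [PiLp.inner_apply, RCLike.inner_apply, conj_trivial, sq, Finset.sum_mul_sum]
    exact Finset.sum_congr rfl fun i _ => Finset.sum_congr rfl fun j _ => by ring
  rw [dot_mulVec_eq_sum, tmean_inner hC, h2, tmean_sum hC _ (fun i => by fun_prop), sq,
    Finset.sum_mul_sum, ← Finset.sum_sub_distrib]
  refine Finset.sum_congr rfl fun i _ => ?_
  rw [tmean_sum hC _ (fun i => by fun_prop), ← Finset.sum_sub_distrib]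
  refine Finset.sum_congr rfl fun j _ => ?_
  rw [tmean_const_mul, hess_logLap hC]
  ring

lemma quad_hess_logLap_eq (hC : IsBody C) (x u : Euc n) (a : ℝ) :
    u.ofLp ⬝ᵥ hess (logLap C) x *ᵥ u.ofLp = tmean C (fun y => (inner ℝ u y - a) ^ 2) x
      - (tmean C (fun y => inner ℝ u y) x - a) ^ 2 := by
  have h : (fun y : Euc n => (inner ℝ u y - a) ^ 2)
      = fun y => (inner ℝ u y ^ 2 + (-2 * a) * inner ℝ u y) + a ^ 2 := by
    ext y; ring
  rw [quad_hess_logLap hC, h, tmean_add hC (by fun_prop) (by fun_prop),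
    tmean_add hC (by fun_prop) (by fun_prop), tmean_const_mul, tmean_const hC]
  ring

lemma posDef_hess_logLap (hC : IsBody C) (x : Euc n) : (hess (logLap C) x).PosDef := by
  refine Matrix.PosDef.of_dotProduct_mulVec_pos (hess_symm (contDiff_logLap hC) x) fun v hv => ?_
  set u : Euc n := WithLp.toLp 2 v with hu
  have hu0 : u ≠ 0 := fun h => hv (congrArg WithLp.ofLp h)
  set m := tmean C (fun y => inner ℝ u y) x
  have h := quad_hess_logLap_eq hC x u m
  have hm : m - m = 0 := sub_self m
  rw [hm] at h
  have : ∃ y ∈ interior C, (inner ℝ u y - m) ^ 2 ≠ 0 := by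
    obtain ⟨y, hy⟩ := hC.interior_nonempty
    by_contra! hcon
    have hcont : ContinuousAt (fun t : ℝ => y + t • u) 0 := by fun_prop
    have hev := hcont.eventually_mem
      (isOpen_interior.mem_nhds (show y + (0 : ℝ) • u ∈ interior C by simpa using hy))
    have hev2 : ∀ᶠ t : ℝ in 𝓝[≠] 0, y + t • u ∈ interior C := hev.filter_mono nhdsWithin_le_nhds
    obtain ⟨t, ht, ht0⟩ := (hev2.and self_mem_nhdsWithin).exists
    have e1 := pow_eq_zero_iff two_ne_zero |>.1 (hcon y hy)
    have e2 := pow_eq_zero_iff two_ne_zero |>.1 (hcon _ ht)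
    rw [inner_add_right, inner_smul_right] at e2
    have e3 : t * inner ℝ u u = 0 := by linarith
    rcases mul_eq_zero.1 e3 with h3 | h3
    · exact ht0 h3
    · exact hu0 (inner_self_eq_zero.1 h3)
  obtain ⟨y, hy, hyne⟩ := this
  have hpos := lap_pos hC.compact (F := fun y => (inner ℝ u y - m) ^ 2) (by fun_prop)
    (fun _ _ => sq_nonneg _) hy hyne x
  have : star v ⬝ᵥ hess (logLap C) x *ᵥ v = tmean C (fun y => (inner ℝ u y - m) ^ 2) x := by
    simpa using h
  rw [this]
  exact div_pos hpos (lap_one_pos hC x)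

lemma grd_logLap_mem (hC : IsBody C) (x : Euc n) : grd (logLap C) x ∈ C := by
  by_contra hcon
  obtain ⟨f, s, hs1, hs2⟩ := geometric_hahn_banach_closed_point hC.convex hC.compact.isClosed hcon
  set u := (InnerProductSpace.toDual ℝ (Euc n)).symm f with hu
  have hf : ∀ y, f y = inner ℝ u y := fun y => by
    rw [hu, InnerProductSpace.toDual_symm_apply]
  have h1 : tmean C (fun y => inner ℝ u y) x ≤ s := by
    rw [← tmean_const hC s x]
    exact tmean_mono hC (by fun_prop) continuous_const (fun y hy => by
      rw [← hf]; exact (hs1 y hy).le) x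
  have h2 : inner ℝ u (grd (logLap C) x) = tmean C (fun y => inner ℝ u y) x := by
    rw [tmean_inner hC]
    simp only [PiLp.inner_apply, RCLike.inner_apply, conj_trivial, grd_apply, pd_logLap hC]
    exact Finset.sum_congr rfl fun i _ => mul_comm _ _
  rw [hf, h2] at hs2
  linarith

lemma logLap_mono (hC : IsBody C) {D : Set (Euc n)} (hD : IsBody D) (h : C ⊆ D) (x : Euc n) :
    logLap C x ≤ logLap D x := by
  refine Real.log_le_log (lap_one_pos hC x) ?_
  exact setIntegral_mono_set (lap_integrable hD.compact continuous_const x)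
    (Eventually.of_forall fun y => by positivity) h.eventuallyLE

lemma tendsto_logLap_sub_inner (hC : IsBody C) {y₀ : Euc n} (hy₀ : y₀ ∈ interior C) :
    Tendsto (fun x => logLap C x - inner ℝ x y₀) (cocompact (Euc n)) atTop := by
  obtain ⟨r, hr, hball⟩ := Metric.mem_nhds_iff.1 (isOpen_interior.mem_nhds hy₀)
  set v := (volume (Metric.ball (0 : Euc n) (r / 4))).toReal with hv
  have hvpos : 0 < v := ENNReal.toReal_pos
    (Metric.measure_ball_pos _ _ (by positivity)).ne' measure_ball_lt_top.ne
  have key : ∀ x : Euc n, x ≠ 0 →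
      Real.log v + (r / 4) * ‖x‖ ≤ logLap C x - inner ℝ x y₀ := by
    intro x hx
    have hx0 : 0 < ‖x‖ := norm_pos_iff.2 hx
    set y₁ := y₀ + (r / 2 * ‖x‖⁻¹) • x with hy₁
    have hsub : Metric.ball y₁ (r / 4) ⊆ C := by
      intro y hy
      refine interior_subset (hball ?_)
      rw [Metric.mem_ball, dist_eq_norm] at *
      have h1 : ‖y₁ - y₀‖ = r / 2 := by
        rw [hy₁, add_sub_cancel_left, norm_smul, Real.norm_of_nonneg (by positivity)]
        field_simp
      have := norm_add_le (y - y₁) (y₁ - y₀)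
      rw [sub_add_sub_cancel, h1] at this
      linarith
    have hin : ∀ y ∈ Metric.ball y₁ (r / 4), inner ℝ x y₀ + (r / 4) * ‖x‖ ≤ inner ℝ x y := by
      intro y hy
      rw [Metric.mem_ball, dist_eq_norm] at hy
      have h1 : inner ℝ x y = inner ℝ x y₀ + r / 2 * ‖x‖ + inner ℝ x (y - y₁) := by
        have : inner ℝ x y₁ = inner ℝ x y₀ + r / 2 * ‖x‖ := by
          rw [hy₁, inner_add_right, inner_smul_right, real_inner_self_eq_norm_sq]
          field_simp
        rw [← this, ← inner_add_right, add_sub_cancel]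
      have h2 : |inner ℝ x (y - y₁)| ≤ ‖x‖ * (r / 4) :=
        (abs_real_inner_le_norm _ _).trans (mul_le_mul_of_nonneg_left hy.le hx0.le)
      have := (abs_le.1 h2).1
      linarith
    have hlow : v * Real.exp (inner ℝ x y₀ + (r / 4) * ‖x‖) ≤ lap C (fun _ => 1) x := by
      have hintg := lap_integrable hC.compact (continuous_const (y := (1 : ℝ))) x
      have h1 : ∫ y in Metric.ball y₁ (r / 4), 1 * Real.exp (inner ℝ x y)
          ≤ lap C (fun _ => 1) x :=
        setIntegral_mono_set hintg (Eventually.of_forall fun y => by positivity)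
          hsub.eventuallyLE
      refine le_trans ?_ h1
      have h2 : ∫ y in Metric.ball y₁ (r / 4), Real.exp (inner ℝ x y₀ + (r / 4) * ‖x‖)
          = v * Real.exp (inner ℝ x y₀ + (r / 4) * ‖x‖) := by
        rw [setIntegral_const, smul_eq_mul, hv, Measure.real,
          Measure.addHaar_ball_center]
      rw [← h2]
      refine setIntegral_mono_on (integrableOn_const measure_ball_lt_top.ne (by simp))
        (hintg.mono_set hsub) measurableSet_ball fun y hy => ?_
      rw [one_mul]
      exact Real.exp_le_exp.2 (hin y hy)
    have := Real.log_le_log (by positivity) hlow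
    rw [Real.log_mul hvpos.ne' (Real.exp_pos _).ne', Real.log_exp] at this
    rw [logLap]
    linarith
  have hlim : Tendsto (fun x : Euc n => Real.log v + (r / 4) * ‖x‖) (cocompact (Euc n)) atTop :=
    tendsto_atTop_add_const_left _ _
      ((tendsto_norm_cocompact_atTop).const_mul_atTop (by positivity))
  refine tendsto_atTop_mono' _ ?_ hlim
  filter_upwards [(isCompact_singleton (x := (0 : Euc n))).compl_mem_cocompact] with x hx
  exact key x hx

end

section

variable {C : Set (Euc n)}

lemma exists_support_point (hC : IsBody C) (x : Euc n) :
    ∃ y₀ ∈ C, ∀ y ∈ C, inner ℝ x y ≤ inner ℝ x y₀ := by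
  obtain ⟨y₀, h1, h2⟩ := hC.compact.exists_isMaxOn hC.nonempty
    (f := fun y => inner ℝ x y) (by fun_prop)
  exact ⟨y₀, h1, fun y hy => h2 hy⟩

/-- Comparison with the homothetic copy of ratio `1 / 2` at a support point. -/
lemma lap_scaling (hC : IsBody C) {x y₀ : Euc n} (hy₀ : y₀ ∈ C) :
    lap C (fun y => Real.exp (inner ℝ x (y₀ - y) / 2)) x ≤ 2 ^ n * lap C (fun _ => 1) x := by
  have hintg := lap_integrable hC.compact (continuous_const (y := (1 : ℝ))) x
  set T : Euc n → Euc n := fun y => (1 / 2 : ℝ) • y + (1 / 2 : ℝ) • y₀ with hT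
  have hTC : T '' C ⊆ C := by
    rintro _ ⟨y, hy, rfl⟩
    exact hC.convex hy hy₀ (by norm_num) (by norm_num) (by norm_num)
  have h1 : ∫ y in T '' C, 1 * Real.exp (inner ℝ x y) ≤ lap C (fun _ => 1) x :=
    setIntegral_mono_set hintg (Eventually.of_forall fun y => by positivity) hTC.eventuallyLE
  have hinj : Set.InjOn T C := by
    intro a _ b _ hab
    have := add_right_cancel hab
    exact smul_right_injective _ (by norm_num : (1 / 2 : ℝ) ≠ 0) this
  have hder : ∀ y ∈ C, HasFDerivWithinAt T ((1 / 2 : ℝ) • ContinuousLinearMap.id ℝ (Euc n)) C y :=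
    fun y _ => ((((hasFDerivAt_id y).const_smul (1 / 2 : ℝ)).add_const _)).hasFDerivWithinAt
  have h2 := integral_image_eq_integral_abs_det_fderiv_smul volume hC.compact.measurableSet hder
    hinj (fun y => 1 * Real.exp (inner ℝ x y))
  have hdet : |((1 / 2 : ℝ) • ContinuousLinearMap.id ℝ (Euc n)).det| = (1 / 2) ^ n := by
    rw [ContinuousLinearMap.det]
    simp
  rw [h2, hdet] at h1
  have h3 : ∀ y : Euc n, (1 / 2 : ℝ) ^ n • (1 * Real.exp (inner ℝ x (T y)))
      = (1 / 2 : ℝ) ^ n * (Real.exp (inner ℝ x (y₀ - y) / 2) * Real.exp (inner ℝ x y)) := by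
    intro y
    rw [smul_eq_mul, one_mul, ← Real.exp_add]
    congr 2
    simp only [hT, inner_add_right, inner_smul_right, inner_sub_right]
    ring
  simp_rw [h3] at h1
  rw [integral_const_mul] at h1
  have h4 : (2 : ℝ) ^ n * ((1 / 2) ^ n * lap C (fun y => Real.exp (inner ℝ x (y₀ - y) / 2)) x)
      ≤ 2 ^ n * lap C (fun _ => 1) x := mul_le_mul_of_nonneg_left h1 (by positivity)
  rwa [← mul_assoc, ← mul_pow, mul_one_div_cancel two_ne_zero, one_pow, one_mul] at h4

lemma tmean_exp_le (hC : IsBody C) {x y₀ : Euc n} (hy₀ : y₀ ∈ C) :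
    tmean C (fun y => Real.exp (inner ℝ x (y₀ - y) / 2)) x ≤ 2 ^ n := by
  rw [tmean, div_le_iff₀ (lap_one_pos hC x)]
  exact lap_scaling hC hy₀

lemma radial_hess_logLap_le (hC : IsBody C) (x : Euc n) :
    x.ofLp ⬝ᵥ hess (logLap C) x *ᵥ x.ofLp ≤ 8 * 2 ^ n := by
  obtain ⟨y₀, hy₀, hmax⟩ := exists_support_point hC x
  rw [quad_hess_logLap_eq hC x x (inner ℝ x y₀)]
  have h1 : tmean C (fun y => (inner ℝ x y - inner ℝ x y₀) ^ 2) x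
      ≤ tmean C (fun y => 8 * Real.exp (inner ℝ x (y₀ - y) / 2)) x := by
    refine tmean_mono hC (by fun_prop) (by fun_prop) (fun y hy => ?_) x
    have h0 : 0 ≤ inner ℝ x (y₀ - y) := by
      rw [inner_sub_right]
      exact sub_nonneg.2 (hmax y hy)
    have h2 := Real.quadratic_le_exp_of_nonneg (by linarith : 0 ≤ inner ℝ x (y₀ - y) / 2)
    have h3 : inner ℝ x y - inner ℝ x y₀ = - inner ℝ x (y₀ - y) := by
      rw [inner_sub_right]; ring
    rw [h3]
    nlinarith
  rw [tmean_const_mul] at h1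
  have h2 := tmean_exp_le hC (x := x) hy₀
  have h3 := sq_nonneg (tmean C (fun y => inner ℝ x y) x - inner ℝ x y₀)
  linarith

lemma legendre_logLap_ge (hC : IsBody C) {x y₀ : Euc n} (hy₀ : y₀ ∈ C) :
    -(2 * 2 ^ n) - Real.log (lap C (fun _ => 1) x * Real.exp (- inner ℝ x y₀))
      ≤ (∑ i, x i * pd i (logLap C) x) - logLap C x := by
  have h1 : ∑ i, x i * pd i (logLap C) x = tmean C (fun y => inner ℝ x y) x := by
    simp only [tmean_inner hC, pd_logLap hC]
  rw [h1, Real.log_mul (lap_one_pos hC x).ne' (Real.exp_pos _).ne', Real.log_exp]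
  have h2 : tmean C (fun y => inner ℝ x y₀ + (-1) * inner ℝ x y) x
      ≤ tmean C (fun y => 2 * Real.exp (inner ℝ x (y₀ - y) / 2)) x := by
    refine tmean_mono hC (by fun_prop) (by fun_prop) (fun y hy => ?_) x
    have h2 := Real.add_one_le_exp (inner ℝ x (y₀ - y) / 2)
    rw [inner_sub_right] at *
    linarith
  rw [tmean_const_mul, tmean_add hC (by fun_prop) (by fun_prop), tmean_const_mul,
    tmean_const hC] at h2
  have h3 := tmean_exp_le hC (x := x) hy₀
  rw [logLap]
  linarith

lemma tendsto_legendre_logLap (hC : IsBody C) :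
    Tendsto (fun x => (∑ i, x i * pd i (logLap C) x) - logLap C x) (cocompact (Euc n)) atTop := by
  choose s hs hmax using fun x => exists_support_point hC x
  have hcg : (cocompact (Euc n)).IsCountablyGenerated := by
    rw [← Metric.cobounded_eq_cocompact, ← comap_norm_atTop]
    infer_instance
  have hJ : Tendsto (fun x => lap C (fun _ => 1) x * Real.exp (- inner ℝ x (s x)))
      (cocompact (Euc n)) (𝓝 0) := by
    have h0 : ∀ x, lap C (fun _ => 1) x * Real.exp (- inner ℝ x (s x))
        = ∫ y in C, Real.exp (inner ℝ x y - inner ℝ x (s x)) := by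
      intro x
      rw [lap, ← integral_mul_const]
      refine integral_congr_ae (Eventually.of_forall fun y => ?_)
      simp only [one_mul]
      rw [← Real.exp_add, sub_eq_add_neg]
    simp_rw [h0]
    have h1 : (0 : ℝ) = ∫ y in C, (0 : ℝ) := by simp
    rw [h1]
    refine tendsto_integral_filter_of_dominated_convergence (fun _ => 1) ?_ ?_ ?_ ?_
    · refine Eventually.of_forall fun x => Continuous.aestronglyMeasurable ?_
      fun_prop
    · refine Eventually.of_forall fun x =>
        (ae_restrict_iff' hC.compact.measurableSet).2 (Eventually.of_forall fun y hy => ?_)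
      rw [Real.norm_eq_abs, Real.abs_exp, Real.exp_le_one_iff]
      linarith [hmax x y hy]
    · exact continuous_const.continuousOn.integrableOn_compact hC.compact
    · have hfr : ∀ᵐ y ∂(volume.restrict C), y ∈ interior C := by
        have hn := hC.convex.addHaar_frontier volume
        have : ∀ᵐ y ∂(volume : Measure (Euc n)), y ∉ frontier C :=
          measure_eq_zero_iff_ae_notMem.1 hn
        refine (ae_restrict_iff' hC.compact.measurableSet).2 (this.mono fun y hy hyC => ?_)
        by_contra hcon
        exact hy ⟨subset_closure hyC, hcon⟩
      refine hfr.mono fun y hy => ?_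
      obtain ⟨r, hr, hball⟩ := Metric.mem_nhds_iff.1 (isOpen_interior.mem_nhds hy)
      refine Real.tendsto_exp_atBot.comp ?_
      have hle : ∀ x : Euc n, inner ℝ x y - inner ℝ x (s x) ≤ -(r / 2 * ‖x‖) := by
        intro x
        rcases eq_or_ne x 0 with rfl | hx
        · simp
        have hx0 : 0 < ‖x‖ := norm_pos_iff.2 hx
        have hmem : y + (r / 2 * ‖x‖⁻¹) • x ∈ C := by
          refine interior_subset (hball ?_)
          rw [Metric.mem_ball, dist_eq_norm, add_sub_cancel_left, norm_smul,
            Real.norm_of_nonneg (by positivity), mul_assoc, inv_mul_cancel₀ hx0.ne']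
          linarith
        have := hmax x _ hmem
        rw [inner_add_right, inner_smul_right, real_inner_self_eq_norm_sq] at this
        have h5 : r / 2 * ‖x‖⁻¹ * ‖x‖ ^ 2 = r / 2 * ‖x‖ := by field_simp
        linarith
      refine tendsto_atBot_mono hle (tendsto_neg_atTop_atBot.comp ?_)
      exact (tendsto_norm_cocompact_atTop).const_mul_atTop (by positivity)
  have hJ' : Tendsto (fun x => lap C (fun _ => 1) x * Real.exp (- inner ℝ x (s x)))
      (cocompact (Euc n)) (𝓝[>] 0) := by
    refine tendsto_nhdsWithin_iff.2 ⟨hJ, Eventually.of_forall fun x => ?_⟩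
    exact mul_pos (lap_one_pos hC x) (Real.exp_pos _)
  have hlog := tendsto_neg_atBot_atTop.comp (Real.tendsto_log_nhdsGT_zero.comp hJ')
  refine tendsto_atTop_mono (fun x => legendre_logLap_ge hC (hs x)) ?_
  exact tendsto_atTop_add_const_left _ (-(2 * 2 ^ n)) hlog

lemma isPotential_logLap (hC : IsBody C) : IsPotential (logLap C) C where
  contDiff := contDiff_logLap hC
  posDef := posDef_hess_logLap hC
  grd_mem := grd_logLap_mem hC
  tendsto_sub_inner := fun _ hy => tendsto_logLap_sub_inner hC hy
  hess_radial_le := ⟨_, radial_hess_logLap_le hC⟩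
  tendsto_legendre := tendsto_legendre_logLap hC

lemma IsPotential.add {D : Set (Euc n)} {φ ψ : Euc n → ℝ} (hφ : IsPotential φ C)
    (hψ : IsPotential ψ D) (hC : IsBody C) (hD : IsBody D) :
    IsPotential (fun x => φ x + ψ x) (C + D) where
  contDiff := hφ.contDiff.add hψ.contDiff
  posDef x := by
    rw [hess_add hφ.contDiff hψ.contDiff]
    exact (hφ.posDef x).add (hψ.posDef x)
  grd_mem x := by
    have : grd (fun x => φ x + ψ x) x = grd φ x + grd ψ x := by
      ext i
      simp [grd_apply, pd_add (contDiff_differentiable hφ.contDiff)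
        (contDiff_differentiable hψ.contDiff)]
    rw [this]
    exact add_mem_add (hφ.grd_mem x) (hψ.grd_mem x)
  tendsto_sub_inner y hy := by
    obtain ⟨a, ha, b, hb, rfl⟩ := interior_add_subset hC hD hy
    refine ((hφ.tendsto_sub_inner a ha).atTop_add_atTop (hψ.tendsto_sub_inner b hb)).congr
      fun x => ?_
    simp only [inner_add_right]
    ring
  hess_radial_le := by
    obtain ⟨c, hc⟩ := hφ.hess_radial_le
    obtain ⟨d, hd⟩ := hψ.hess_radial_le
    refine ⟨c + d, fun x => ?_⟩
    rw [hess_add hφ.contDiff hψ.contDiff, add_mulVec, dotProduct_add]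
    exact add_le_add (hc x) (hd x)
  tendsto_legendre := by
    refine (hφ.tendsto_legendre.atTop_add_atTop hψ.tendsto_legendre).congr fun x => ?_
    simp only [pd_add (contDiff_differentiable hφ.contDiff) (contDiff_differentiable hψ.contDiff),
      mul_add, Finset.sum_add_distrib]
    ring

lemma IsPotential.smul {φ : Euc n → ℝ} (hφ : IsPotential φ C) {a : ℝ} (ha : 0 < a) :
    IsPotential (fun x => a * φ x) (a • C) where
  contDiff := contDiff_const.mul hφ.contDiff
  posDef x := by
    rw [hess_const_mul a hφ.contDiff]
    exact (hφ.posDef x).smul ha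
  grd_mem x := by
    have : grd (fun x => a * φ x) x = a • grd φ x := by
      ext i
      simp [grd_apply, pd_const_mul a (contDiff_differentiable hφ.contDiff)]
    rw [this]
    exact smul_mem_smul_set (hφ.grd_mem x)
  tendsto_sub_inner y hy := by
    rw [interior_smul₀ ha.ne'] at hy
    obtain ⟨b, hb, rfl⟩ := hy
    refine ((hφ.tendsto_sub_inner b hb).const_mul_atTop ha).congr fun x => ?_
    simp only [inner_smul_right]
    ring
  hess_radial_le := by
    obtain ⟨c, hc⟩ := hφ.hess_radial_le
    refine ⟨a * c, fun x => ?_⟩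
    rw [hess_const_mul a hφ.contDiff, smul_mulVec, dotProduct_smul, smul_eq_mul]
    exact mul_le_mul_of_nonneg_left (hc x) ha.le
  tendsto_legendre := by
    refine (hφ.tendsto_legendre.const_mul_atTop ha).congr fun x => ?_
    simp only [pd_const_mul a (contDiff_differentiable hφ.contDiff), mul_sub, Finset.mul_sum]
    congr 1
    exact Finset.sum_congr rfl fun i _ => by ring

end

/-! ### The volume formula for perturbed gradient maps -/

lemma mulVec_ne_zero_of_quad_pos {A : Matrix (Fin n) (Fin n) ℝ}
    (hA : ∀ u, u ≠ 0 → 0 < u ⬝ᵥ A *ᵥ u) : A.det ≠ 0 := by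
  intro h
  obtain ⟨u, hu, hAu⟩ := Matrix.exists_mulVec_eq_zero_iff.2 h
  have := hA u hu
  rw [hAu, dotProduct_zero] at this
  exact lt_irrefl _ this

lemma det_pos_of_quad_pos {A : Matrix (Fin n) (Fin n) ℝ}
    (hA : ∀ u, u ≠ 0 → 0 < u ⬝ᵥ A *ᵥ u) : 0 < A.det := by
  by_contra! hneg
  let p : ℝ → ℝ := fun t => ((1 - t) • (1 : Matrix (Fin n) (Fin n) ℝ) + t • A).det
  have hp : Continuous p := by
    refine Continuous.matrix_det ?_
    fun_prop
  have h0 : p 0 = 1 := by simp [p]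
  have h1 : p 1 = A.det := by simp [p]
  obtain ⟨t, ht, hpt⟩ : (0 : ℝ) ∈ p '' Icc 0 1 :=
    intermediate_value_Icc' zero_le_one hp.continuousOn
      ⟨by rw [h1]; exact hneg, by rw [h0]; norm_num⟩
  refine mulVec_ne_zero_of_quad_pos (fun u hu => ?_) hpt
  rw [add_mulVec, smul_mulVec, smul_mulVec, one_mulVec, dotProduct_add, dotProduct_smul,
    dotProduct_smul, smul_eq_mul, smul_eq_mul]
  have hu' : 0 < u ⬝ᵥ u := by
    have := Matrix.dotProduct_star_self_pos_iff.2 hu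
    simpa using this
  rcases eq_or_lt_of_le ht.1 with h | h
  · rw [← h]; simpa using hu'
  · have := mul_pos h (hA u hu)
    have := mul_nonneg (sub_nonneg.2 ht.2) hu'.le
    linarith

lemma injective_of_quad_pos {F : Euc n → Euc n} (hF : ContDiff ℝ ∞ F)
    (hq : ∀ x u, u ≠ 0 → 0 < u ⬝ᵥ jac F x *ᵥ u) : Function.Injective F := by
  intro x y hxy
  by_contra hne
  let u : Euc n := y - x
  have hu : u.ofLp ≠ 0 := by
    intro h
    apply hne
    have : u = 0 := by ext i; exact congrFun h i
    exact (sub_eq_zero.1 this).symm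
  have hd : ∀ t : ℝ, HasDerivAt (fun t : ℝ => inner ℝ u (F (x + t • u)))
      (u.ofLp ⬝ᵥ jac F (x + t • u) *ᵥ u.ofLp) t := by
    intro t
    have h1 : HasDerivAt (fun t : ℝ => x + t • u) u t := by
      simpa using ((hasDerivAt_id t).smul_const u).const_add x
    have h2 := (contDiff_differentiable hF (x + t • u)).hasFDerivAt.comp_hasDerivAt t h1
    have h3 := (innerSL ℝ u).hasFDerivAt.comp_hasDerivAt t h2
    refine h3.congr_deriv ?_
    rw [innerSL_apply_apply, PiLp.inner_apply, dotProduct]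
    refine Finset.sum_congr rfl fun i _ => ?_
    rw [fderiv_apply_eq_jac (contDiff_differentiable hF), RCLike.inner_apply, conj_trivial,
      mul_comm]
  have hmono : StrictMono (fun t : ℝ => inner ℝ u (F (x + t • u))) :=
    strictMono_of_deriv_pos fun t => by rw [(hd t).deriv]; exact hq _ _ hu
  have := hmono (zero_lt_one (α := ℝ))
  simp [u, hxy] at this

lemma isOpenMap_of_quad_pos {F : Euc n → Euc n} (hF : ContDiff ℝ ∞ F)
    (hq : ∀ x u, u ≠ 0 → 0 < u ⬝ᵥ jac F x *ᵥ u) : IsOpenMap F := by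
  rw [isOpenMap_iff_nhds_le]
  intro x
  have hs : HasStrictFDerivAt F (fderiv ℝ F x) x :=
    hF.contDiffAt.hasStrictFDerivAt (by simp)
  have hdet : (fderiv ℝ F x).det ≠ 0 := by
    rw [det_fderiv_eq_jac (contDiff_differentiable hF)]
    exact (det_pos_of_quad_pos (hq x)).ne'
  let e := (fderiv ℝ F x).toContinuousLinearEquivOfDetNeZero hdet
  have he : HasStrictFDerivAt F (e : Euc n →L[ℝ] Euc n) x := by
    simpa [e] using hs
  exact he.map_nhds_eq_of_equiv.ge

lemma range_subset_of_eq_off_compact (hn : 0 < n) {F G : Euc n → Euc n} (hFo : IsOpenMap F)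
    (hFc : Continuous F) (hGc : Continuous G) (hGi : Function.Injective G) {R : ℝ}
    (hR : 0 ≤ R) (h : ∀ x, R < ‖x‖ → F x = G x) : range G ⊆ range F := by
  rintro _ ⟨x, rfl⟩
  rcases le_or_gt (R + 1) ‖x‖ with hx | hx
  · exact ⟨x, h x (by linarith)⟩
  let U := Metric.ball (0 : Euc n) (R + 1)
  have hclosed : IsClosed (F '' Metric.closedBall 0 (R + 1)) :=
    ((isCompact_closedBall _ _).image hFc).isClosed
  have hpre : IsPreconnected (G '' U) :=
    (convex_ball _ _).isPreconnected.image _ hGc.continuousOn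
  have hsub : G '' U ⊆ F '' U := by
    refine hpre.subset_left_of_subset_union (hFo _ Metric.isOpen_ball) hclosed.isOpen_compl ?_ ?_ ?_
    · rw [disjoint_compl_right_iff_subset]
      exact image_mono Metric.ball_subset_closedBall
    · rintro _ ⟨z, hz, rfl⟩
      by_cases hm : G z ∈ F '' Metric.closedBall 0 (R + 1)
      · left
        obtain ⟨w, hw, hwz⟩ := hm
        rcases lt_or_ge ‖w‖ (R + 1) with hw' | hw'
        · exact ⟨w, by simpa [U] using hw', hwz⟩
        · rw [h w (by linarith)] at hwz
          rw [hGi hwz] at hw'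
          simp [U] at hz
          linarith
      · exact Or.inr hm
    · let x₀ : Euc n := EuclideanSpace.single ⟨0, hn⟩ (R + 1 / 2)
      have hx₀ : ‖x₀‖ = R + 1 / 2 := by
        simp [x₀, abs_of_nonneg (by positivity : 0 ≤ R + 2⁻¹)]
      have hxU : x₀ ∈ U := by simp only [U, mem_ball_zero_iff, hx₀]; linarith
      exact ⟨G x₀, ⟨x₀, hxU, rfl⟩, ⟨x₀, hxU, h x₀ (by rw [hx₀]; linarith)⟩⟩
  obtain ⟨w, -, hw⟩ := hsub ⟨x, by simpa [U] using hx, rfl⟩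
  exact ⟨w, hw⟩

lemma IsPotential.interior_subset_range {φ : Euc n → ℝ} {C : Set (Euc n)} (hφ : IsPotential φ C) :
    interior C ⊆ range (grd φ) := by
  intro y hy
  have hc : Continuous fun x => φ x - inner ℝ x y := by
    have := hφ.contDiff.continuous
    fun_prop
  obtain ⟨x, hx⟩ := hc.exists_forall_le (hφ.tendsto_sub_inner y hy)
  refine ⟨x, ?_⟩
  have hmin : IsLocalMin (fun x => φ x - inner ℝ x y) x := Filter.Eventually.of_forall hx
  have h0 := hmin.fderiv_eq_zero
  have hd : HasFDerivAt (fun x => φ x - inner ℝ x y) (fderiv ℝ φ x - innerSL ℝ y) x := by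
    have h1 := (innerSL ℝ y).hasFDerivAt (x := x)
    have h2 := (contDiff_differentiable hφ.contDiff x).hasFDerivAt.sub h1
    refine h2.congr_of_eventuallyEq (Filter.Eventually.of_forall fun z => ?_)
    simp [real_inner_comm]
  rw [hd.fderiv] at h0
  ext i
  have := congrArg (fun L : Euc n →L[ℝ] ℝ => L (EuclideanSpace.single i 1)) h0
  simp [sub_eq_zero] at this
  rw [grd_apply, pd, this, EuclideanSpace.inner_single_right]
  simp

/-- Compactly supported perturbations of the gradient map of a potential of `C` still have total
Jacobian `vol C`. -/
theorem IsPotential.integral_det (hn : 0 < n) {φ : Euc n → ℝ} {C : Set (Euc n)}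
    (hφ : IsPotential φ C) (hC : IsBody C) {v : Euc n → Euc n} (hv : ContDiff ℝ ∞ v)
    (hvc : HasCompactSupport v)
    (hq : ∀ x u, u ≠ 0 → 0 < u ⬝ᵥ (hess φ x + jac v x) *ᵥ u) :
    Integrable (fun x => (hess φ x + jac v x).det) ∧
      ∫ x, (hess φ x + jac v x).det = (volume C).toReal := by
  have hg := contDiff_grd hφ.contDiff
  let F : Euc n → Euc n := fun x => grd φ x + v x
  have hF : ContDiff ℝ ∞ F := hg.add hv
  have hjac : ∀ x, jac F x = hess φ x + jac v x := fun x => by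
    rw [← jac_grd, jac_add (contDiff_differentiable hg) (contDiff_differentiable hv)]
  have hqF : ∀ x u, u ≠ 0 → 0 < u ⬝ᵥ jac F x *ᵥ u := fun x u hu => by rw [hjac]; exact hq x u hu
  have hqg : ∀ x u, u ≠ 0 → 0 < u ⬝ᵥ jac (grd φ) x *ᵥ u := fun x u hu => by
    simpa [jac_grd] using (hφ.posDef x).dotProduct_mulVec_pos hu
  have hFi := injective_of_quad_pos hF hqF
  have hgi := injective_of_quad_pos hg hqg
  obtain ⟨R, hR0, hR⟩ : ∃ R, 0 ≤ R ∧ ∀ x, R < ‖x‖ → v x = 0 := by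
    obtain ⟨R, hR⟩ := hvc.isCompact.isBounded.exists_norm_le
    refine ⟨max R 0, le_max_right _ _, fun x hx => ?_⟩
    by_contra hne
    exact absurd (hR x (subset_tsupport _ hne)) (not_le.2 ((le_max_left _ _).trans_lt hx))
  have hrange : range F = range (grd φ) := by
    refine Subset.antisymm ?_ ?_
    · refine range_subset_of_eq_off_compact hn (isOpenMap_of_quad_pos hg hqg) hg.continuous
        hF.continuous hFi hR0 fun x hx => ?_
      simp [F, hR x hx]
    · refine range_subset_of_eq_off_compact hn (isOpenMap_of_quad_pos hF hqF) hF.continuous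
        hg.continuous hgi hR0 fun x hx => ?_
      simp [F, hR x hx]
  have hvol : volume (range F) = volume C := by
    rw [hrange]
    refine le_antisymm (measure_mono (range_subset_iff.2 hφ.grd_mem)) ?_
    calc volume C ≤ volume (interior C ∪ frontier C) :=
          measure_mono (subset_closure.trans (closure_eq_interior_union_frontier C).subset)
      _ ≤ volume (interior C) + volume (frontier C) := measure_union_le _ _
      _ = volume (interior C) := by rw [hC.convex.addHaar_frontier volume, add_zero]
      _ ≤ _ := measure_mono hφ.interior_subset_range
  have hpos : ∀ x, 0 < (hess φ x + jac v x).det := fun x => det_pos_of_quad_pos (hq x)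
  have hlint : ∫⁻ x, ENNReal.ofReal ((hess φ x + jac v x).det) = volume C := by
    rw [← hvol, ← image_univ, ← lintegral_abs_det_fderiv_eq_addHaar_image volume
      MeasurableSet.univ (fun x _ => (contDiff_differentiable hF x).hasFDerivAt.hasFDerivWithinAt)
      hFi.injOn, Measure.restrict_univ]
    refine lintegral_congr fun x => ?_
    rw [det_fderiv_eq_jac (contDiff_differentiable hF), hjac, abs_of_pos (hpos x)]
  have hcont : Continuous fun x => (hess φ x + jac v x).det := by
    refine Continuous.matrix_det ?_
    refine continuous_matrix fun i j => ?_
    exact (contDiff_hess hφ.contDiff i j).continuous.add (contDiff_jac hv i j).continuous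
  refine ⟨⟨hcont.aestronglyMeasurable, ?_⟩, ?_⟩
  · rw [hasFiniteIntegral_iff_ofReal (Eventually.of_forall fun x => (hpos x).le), hlint]
    exact hC.compact.measure_lt_top
  · rw [integral_eq_lintegral_of_nonneg_ae (Eventually.of_forall fun x => (hpos x).le)
      hcont.aestronglyMeasurable, hlint]

section

open scoped ENNReal

/-! ### Mollification -/

lemma exists_lintegral_translate_le {f : Euc n → ℝ} (hf : MemLp f 2) {δ : ℝ} (hδ : 0 < δ) :
    ∃ ε > 0, ∀ z : Euc n, ‖z‖ ≤ ε → ∫⁻ y, ‖f (y + z) - f y‖ₑ ^ (2 : ℝ) ≤ ENNReal.ofReal δ := by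
  have : Fact ((2 : ℝ≥0∞) ≠ ⊤) := ⟨by simp⟩
  let F : Lp ℝ 2 (volume : Measure (Euc n)) := hf.toLp f
  have hcont : Continuous fun z : Euc n => DomAddAct.mk z +ᵥ F := by
    exact (DomAddAct.continuous_mk.vadd continuous_const)
  have h0 : Tendsto (fun z : Euc n => edist (DomAddAct.mk z +ᵥ F) F) (𝓝 0) (𝓝 0) := by
    have h : Tendsto (fun z : Euc n => edist (DomAddAct.mk z +ᵥ F) F) (𝓝 0)
        (𝓝 (edist (DomAddAct.mk (0 : Euc n) +ᵥ F) F)) :=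
      (hcont.tendsto 0).edist tendsto_const_nhds
    have hz : DomAddAct.mk (0 : Euc n) +ᵥ F = F := by
      rw [DomAddAct.mk_zero, zero_vadd]
    rwa [hz, edist_self] at h
  have hpos : (0 : ℝ≥0∞) < ENNReal.ofReal (δ ^ (1 / 2 : ℝ)) := by
    rw [ENNReal.ofReal_pos]; positivity
  obtain ⟨ε, hε, hball⟩ := Metric.eventually_nhds_iff.1 (h0.eventually (gt_mem_nhds hpos))
  refine ⟨ε / 2, by positivity, fun z hz => ?_⟩
  have h1 := hball (y := z) (by rw [dist_zero_right]; linarith)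
  have h2 : edist (DomAddAct.mk z +ᵥ F) F = eLpNorm (fun y => f (y + z) - f y) 2 volume := by
    rw [Lp.edist_def]
    refine eLpNorm_congr_ae ?_
    have ha : (DomAddAct.mk z +ᵥ F : Lp ℝ 2 (volume : Measure (Euc n)))
        =ᵐ[volume] fun y => f (z +ᵥ y) := by
      rw [show F = hf.toLp f from rfl, DomAddAct.mk_vadd_toLp]
      exact MemLp.coeFn_toLp _
    filter_upwards [ha, hf.coeFn_toLp] with y hy1 hy2
    simp only [Pi.sub_apply, hy1]
    rw [hy2, vadd_eq_add, add_comm]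
  rw [h2, eLpNorm_eq_lintegral_rpow_enorm_toReal (by simp) (by simp)] at h1
  simp only [ENNReal.toReal_ofNat] at h1
  rw [← ENNReal.ofReal_rpow_of_pos hδ] at h1
  exact ((ENNReal.rpow_lt_rpow_iff (by norm_num)).1 h1).le

lemma exists_mollifier (n : ℕ) : ∃ C : ℝ, 0 ≤ C ∧ ∀ ε : ℝ, 0 < ε → ∃ g : Euc n → ℝ,
    ContDiff ℝ ∞ g ∧ HasCompactSupport g ∧ ∫ x, g x = 1 ∧ (∀ x, ε < ‖x‖ → g x = 0) ∧
    (∀ x, |g x| ≤ C * (ε ^ n)⁻¹) ∧ (∀ i x, ε < ‖x‖ → pd i g x = 0) ∧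
    ∀ i x, |pd i g x| ≤ C * (ε ^ n)⁻¹ * ε⁻¹ := by
  let b : ContDiffBump (0 : Euc n) := ⟨1 / 2, 1, by norm_num, by norm_num⟩
  let η : Euc n → ℝ := b.normed volume
  have hη : ContDiff ℝ ∞ η := b.contDiff_normed
  have hηc : HasCompactSupport η := b.hasCompactSupport_normed
  have hη0 : ∀ x, x ∉ tsupport η → η x = 0 := fun x hx => image_eq_zero_of_notMem_tsupport hx
  have hts : tsupport η = Metric.closedBall 0 1 := b.tsupport_normed_eq
  have hintg : ∫ x, η x = 1 := b.integral_normed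
  obtain ⟨C0, hC0⟩ : ∃ C, ∀ x, |η x| ≤ C := by
    obtain ⟨C, hC⟩ := hη.continuous.bounded_above_of_compact_support hηc
    exact ⟨C, hC⟩
  have h1 : ∀ i, ∃ C, ∀ x, |pd i η x| ≤ C := by
    intro i
    obtain ⟨C, hC⟩ := (contDiff_pd hη i).continuous.bounded_above_of_compact_support
      (pd_hasCompactSupport hηc i)
    exact ⟨C, hC⟩
  choose C1 hC1 using h1
  have hC0' : 0 ≤ C0 := (abs_nonneg _).trans (hC0 0)
  have hC1' : ∀ i, 0 ≤ C1 i := fun i => (abs_nonneg _).trans (hC1 i 0)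
  refine ⟨C0 + ∑ i, C1 i, add_nonneg hC0' (Finset.sum_nonneg fun i _ => hC1' i), fun ε hε => ?_⟩
  have hsc : Differentiable ℝ fun x : Euc n => η (ε⁻¹ • x) :=
    (contDiff_differentiable hη).comp (differentiable_fun_id.const_smul ε⁻¹)
  have hpd : ∀ i, pd i (fun x => (ε ^ n)⁻¹ * η (ε⁻¹ • x))
      = fun x => (ε ^ n)⁻¹ * (ε⁻¹ * pd i η (ε⁻¹ • x)) := by
    intro i
    rw [pd_const_mul _ hsc]
    ext x
    congr 1
    have h := (contDiff_differentiable hη (ε⁻¹ • x)).hasFDerivAt.comp x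
      ((hasFDerivAt_id x).const_smul ε⁻¹)
    rw [pd_eq_of_hasFDerivAt (f := fun x => η (ε⁻¹ • x)) h]
    simp [pd]
  have hout : ∀ x : Euc n, ε < ‖x‖ → ε⁻¹ • x ∉ tsupport η := by
    intro x hx
    rw [hts, mem_closedBall_zero_iff, norm_smul, norm_inv, Real.norm_of_nonneg hε.le, not_le,
      inv_mul_eq_div, lt_div_iff₀ hε, one_mul]
    exact hx
  refine ⟨fun x => (ε ^ n)⁻¹ * η (ε⁻¹ • x), contDiff_const.mul (hη.comp (contDiff_const_smul _)),
    ?_, ?_, ?_, ?_, ?_, ?_⟩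
  · exact (hηc.comp_homeomorph (Homeomorph.smulOfNeZero ε⁻¹ (inv_ne_zero hε.ne'))).mul_left
  · rw [integral_const_mul, Measure.integral_comp_inv_smul, hintg]
    have : ε ^ n ≠ 0 := pow_ne_zero _ hε.ne'
    simp [abs_of_pos (pow_pos hε n), this]
  · intro x hx
    simp only [hη0 _ (hout x hx), mul_zero]
  · intro x
    rw [abs_mul, abs_of_pos (by positivity : 0 < (ε ^ n)⁻¹), mul_comm]
    gcongr
    exact (hC0 _).trans (le_add_of_nonneg_right (Finset.sum_nonneg fun i _ => hC1' i))
  · intro i x hx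
    rw [hpd]
    have : pd i η (ε⁻¹ • x) = 0 :=
      image_eq_zero_of_notMem_tsupport fun h => hout x hx (tsupport_pd_subset η i h)
    simp [this]
  · intro i x
    rw [hpd, abs_mul, abs_mul, abs_of_pos (by positivity : 0 < (ε ^ n)⁻¹),
      abs_of_pos (inv_pos.2 hε), mul_comm, mul_comm ε⁻¹, mul_assoc, mul_comm ε⁻¹, ← mul_assoc]
    gcongr
    refine (hC1 i _).trans ?_
    have := Finset.single_le_sum (fun i _ => hC1' i) (Finset.mem_univ i)
    linarith

/-- Convolution. -/
def cv (f g : Euc n → ℝ) (y : Euc n) : ℝ := ∫ x, f x * g (y - x)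

lemma cv_eq (f g : Euc n → ℝ) :
    cv f g = convolution f g (ContinuousLinearMap.mul ℝ ℝ) volume := by
  ext y
  simp [cv, convolution_def]

lemma contDiff_cv {f g : Euc n → ℝ} (hf : LocallyIntegrable f) (hg : ContDiff ℝ ∞ g)
    (hc : HasCompactSupport g) : ContDiff ℝ ∞ (cv f g) := by
  rw [cv_eq]
  exact hc.contDiff_convolution_right _ hf hg

lemma cv_integrable {f g : Euc n → ℝ} (hf : LocallyIntegrable f) (hg : Continuous g)
    (hc : HasCompactSupport g) (y : Euc n) : Integrable fun x => f x * g (y - x) := by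
  have h := hc.convolutionExists_right (ContinuousLinearMap.mul ℝ ℝ) hf hg y
  simpa [ConvolutionExistsAt] using h

lemma pd_cv {f g : Euc n → ℝ} (hf : LocallyIntegrable f) (hg : ContDiff ℝ ∞ g)
    (hc : HasCompactSupport g) (i : Fin n) : pd i (cv f g) = cv f (pd i g) := by
  ext y
  rw [cv_eq]
  rw [pd_eq_of_hasFDerivAt (hc.hasFDerivAt_convolution_right _ hf (hg.of_le (by simp)) y)]
  rw [convolution_precompR_apply _ hf (hc.fderiv ℝ) (hg.continuous_fderiv (by simp))]
  simp [cv, convolution_def, pd]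

lemma lintegral_kernel_le {h e : Euc n → ℝ} (hm : Measurable h) {S : Set (Euc n)}
    (hS : MeasurableSet S) {A ε : ℝ} {D : ℝ≥0∞}
    (hw : ∀ z : Euc n, ‖z‖ ≤ ε → ∫⁻ y in S, ‖h (y + z) - h y‖ₑ ^ (2 : ℝ) ≤ D)
    (he : ∀ y ∈ S, ‖e y‖ₑ ≤ ENNReal.ofReal A *
      ∫⁻ z in Metric.closedBall 0 ε, ‖h (y + z) - h y‖ₑ) :
    ∫⁻ y in S, ‖e y‖ₑ ^ (2 : ℝ) ≤
      (ENNReal.ofReal A * volume (Metric.closedBall (0 : Euc n) ε)) ^ (2 : ℝ) * D := by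
  set B := Metric.closedBall (0 : Euc n) ε with hB
  have hjm : Measurable fun p : Euc n × Euc n => ‖h (p.1 + p.2) - h p.1‖ₑ :=
    ((hm.comp (measurable_fst.add measurable_snd)).sub (hm.comp measurable_fst)).enorm
  have hcs : ∀ y, (∫⁻ z in B, ‖h (y + z) - h y‖ₑ) ^ (2 : ℝ)
      ≤ volume B * ∫⁻ z in B, ‖h (y + z) - h y‖ₑ ^ (2 : ℝ) := by
    intro y
    have hy : Measurable fun z => ‖h (y + z) - h y‖ₑ := hjm.comp measurable_prodMk_left
    have h1 := ENNReal.lintegral_mul_le_Lp_mul_Lq (volume.restrict B) Real.HolderConjugate.two_two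
      (f := fun _ => 1) aemeasurable_const hy.aemeasurable
    simp only [Pi.mul_apply, one_mul, ENNReal.one_rpow, lintegral_const,
      Measure.restrict_apply_univ]
      at h1
    have h2 := ENNReal.rpow_le_rpow h1 (by norm_num : (0 : ℝ) ≤ 2)
    rw [ENNReal.mul_rpow_of_nonneg _ _ (by norm_num), ← ENNReal.rpow_mul, ← ENNReal.rpow_mul] at h2
    norm_num at h2
    simpa using h2
  calc ∫⁻ y in S, ‖e y‖ₑ ^ (2 : ℝ)
      ≤ ∫⁻ y in S, (ENNReal.ofReal A) ^ (2 : ℝ) *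
          (volume B * ∫⁻ z in B, ‖h (y + z) - h y‖ₑ ^ (2 : ℝ)) := by
        refine setLIntegral_mono' hS fun y hy => ?_
        refine (ENNReal.rpow_le_rpow (he y hy) (by norm_num)).trans ?_
        rw [ENNReal.mul_rpow_of_nonneg _ _ (by norm_num)]
        gcongr
        exact hcs y
    _ = (ENNReal.ofReal A) ^ (2 : ℝ) * (volume B *
          ∫⁻ y in S, ∫⁻ z in B, ‖h (y + z) - h y‖ₑ ^ (2 : ℝ)) := by
        have hmm : Measurable fun y => ∫⁻ z in B, ‖h (y + z) - h y‖ₑ ^ (2 : ℝ) :=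
          (hjm.pow_const 2).lintegral_prod_right'
        rw [lintegral_const_mul _ (hmm.const_mul _), lintegral_const_mul _ hmm]
    _ = (ENNReal.ofReal A) ^ (2 : ℝ) * (volume B *
          ∫⁻ z in B, ∫⁻ y in S, ‖h (y + z) - h y‖ₑ ^ (2 : ℝ)) := by
        rw [lintegral_lintegral_swap (hjm.pow_const 2).aemeasurable]
    _ ≤ (ENNReal.ofReal A) ^ (2 : ℝ) * (volume B * ∫⁻ z in B, D) := by
        gcongr (ENNReal.ofReal A) ^ (2 : ℝ) * (volume B * ?_)
        refine setLIntegral_mono' measurableSet_closedBall fun z hz => hw z ?_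
        simpa [hB] using hz
    _ = _ := by
        rw [lintegral_const, Measure.restrict_apply_univ,
          ENNReal.mul_rpow_of_nonneg _ _ (by norm_num), ENNReal.rpow_two (volume B)]
        ring

lemma pd_sum {ι : Type*} (S : Finset ι) {f : ι → Euc n → ℝ} (hf : ∀ a, Differentiable ℝ (f a))
    (i : Fin n) : pd i (fun x => ∑ a ∈ S, f a x) = fun x => ∑ a ∈ S, pd i (f a) x := by
  ext x
  have h := HasFDerivAt.fun_sum (u := S) fun a _ => (hf a x).hasFDerivAt
  rw [pd_eq_of_hasFDerivAt h]
  simp [pd]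

lemma pd_comp_sub {g : Euc n → ℝ} (hg : Differentiable ℝ g) (y : Euc n) (i : Fin n) :
    pd i (fun x => g (y - x)) = fun x => - pd i g (y - x) := by
  ext x
  have h := (hg (y - x)).hasFDerivAt.comp x ((hasFDerivAt_id x).const_sub y)
  rw [pd_eq_of_hasFDerivAt (f := fun x => g (y - x)) h]
  simp [pd]

lemma enorm_integral_kernel_le {h k : Euc n → ℝ} {y : Euc n} {A ε : ℝ}
    (hA : ∀ x, ‖y - x‖ ≤ ε → |k x| ≤ A) (hk : ∀ x, ε < ‖y - x‖ → k x = 0) :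
    ‖∫ x, (h x - h y) * k x‖ₑ ≤ ENNReal.ofReal A *
      ∫⁻ z in Metric.closedBall 0 ε, ‖h (y + z) - h y‖ₑ := by
  calc ‖∫ x, (h x - h y) * k x‖ₑ ≤ ∫⁻ x, ‖(h x - h y) * k x‖ₑ := enorm_integral_le_lintegral_enorm _
    _ = ∫⁻ z, ‖(h (y + z) - h y) * k (y + z)‖ₑ :=
        (lintegral_add_left_eq_self (fun x => ‖(h x - h y) * k x‖ₑ) y).symm
    _ ≤ ∫⁻ z, (Metric.closedBall (0 : Euc n) ε).indicator
          (fun z => ENNReal.ofReal A * ‖h (y + z) - h y‖ₑ) z := by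
        refine lintegral_mono fun z => ?_
        by_cases hz : z ∈ Metric.closedBall (0 : Euc n) ε
        · rw [indicator_of_mem hz, enorm_mul, mul_comm]
          gcongr
          rw [Real.enorm_eq_ofReal_abs]
          exact ENNReal.ofReal_le_ofReal (hA _ (by simpa using hz))
        · rw [indicator_of_notMem hz, hk (y + z) (by simpa using hz)]
          simp
    _ = _ := by
        rw [lintegral_indicator measurableSet_closedBall, lintegral_const_mul' _ _ (by simp)]

lemma exists_lipschitz_on_ball {f : Euc n → ℝ} (hf : ContDiff ℝ ∞ f) (R : ℝ) :
    ∃ L : ℝ, 0 ≤ L ∧ ∀ x ∈ Metric.closedBall (0 : Euc n) R, ∀ y ∈ Metric.closedBall (0 : Euc n) R,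
      |f x - f y| ≤ L * ‖x - y‖ := by
  obtain ⟨L, hL⟩ := (isCompact_closedBall (0 : Euc n) R).exists_bound_of_continuousOn
    (hf.continuous_fderiv (by simp)).continuousOn
  refine ⟨max L 0, le_max_right _ _, fun x hx y hy => ?_⟩
  exact (convex_closedBall (0 : Euc n) R).norm_image_sub_le_of_norm_fderiv_le (𝕜 := ℝ)
    (fun z _ => contDiff_differentiable hf z) (fun z hz => (hL z hz).trans (le_max_left _ _)) hy hx

lemma locallyIntegrable_of_memLp_ball {h : Euc n → ℝ}
    (hloc : ∀ R, MemLp ((Metric.closedBall (0 : Euc n) R).indicator h) 2) :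
    LocallyIntegrable h := by
  rw [locallyIntegrable_iff]
  intro k hk
  obtain ⟨R, hR⟩ := hk.isBounded.subset_closedBall 0
  have h1 := ((hloc R).locallyIntegrable (by norm_num)).integrableOn_isCompact hk
  refine h1.congr_fun (fun x hx => ?_) hk.measurableSet
  rw [indicator_of_mem (hR hx)]

lemma locallyIntegrable_mul_continuous {h f : Euc n → ℝ} (hh : LocallyIntegrable h)
    (hf : Continuous f) : LocallyIntegrable fun x => h x * f x := by
  rw [locallyIntegrable_iff]
  intro k hk
  exact (hh.integrableOn_isCompact hk).mul_continuousOn hf.continuousOn hk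

/-- Friedrichs mollification of a weak solution `h` of `∑ G_ij ∂_ij h = 0` with divergence-free
rows: near-solutions with a small flux error in `L²`. -/
theorem exists_mollified_solution {G : Euc n → Matrix (Fin n) (Fin n) ℝ}
    (hG : ∀ i j, ContDiff ℝ ∞ fun x => G x i j)
    (hdiv : ∀ x j, ∑ i, pd i (fun y => G y i j) x = 0) {h : Euc n → ℝ} (hm : Measurable h)
    (hloc : ∀ R, MemLp ((Metric.closedBall (0 : Euc n) R).indicator h) 2)
    (hweak : ∀ g : Euc n → ℝ, ContDiff ℝ ∞ g → HasCompactSupport g →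
      ∫ x, h x * ∑ i, ∑ j, G x i j * hess g x i j = 0) (R : ℝ) {δ : ℝ} (hδ : 0 < δ) :
    ∃ (s : Euc n → ℝ) (U : Fin n → Euc n → ℝ), ContDiff ℝ ∞ s ∧ (∀ j, ContDiff ℝ ∞ (U j)) ∧
      (∀ y, ∑ j, pd j (U j) y = 0) ∧
      ∫⁻ y in Metric.closedBall 0 R, ‖s y - h y‖ₑ ^ (2 : ℝ) ≤ ENNReal.ofReal δ ∧
      ∀ j, ∫⁻ y in Metric.closedBall 0 R, ‖U j y - ∑ i, G y i j * pd i s y‖ₑ ^ (2 : ℝ)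
        ≤ ENNReal.ofReal δ := by
  have hli := locallyIntegrable_of_memLp_ball hloc
  have hGli : ∀ i j, LocallyIntegrable fun x => h x * G x i j := fun i j =>
    locallyIntegrable_mul_continuous hli (hG i j).continuous
  have hLip := fun i j => exists_lipschitz_on_ball (hG i j) (R + 1)
  choose L hL0 hL using hLip
  obtain ⟨C, hC0, hC⟩ := exists_mollifier n
  set Λ := ∑ i, ∑ j, L i j with hΛ
  have hΛ0 : 0 ≤ Λ := Finset.sum_nonneg fun i _ => Finset.sum_nonneg fun j _ => hL0 i j
  have hΛj : ∀ j, ∑ i, L i j ≤ Λ := fun j =>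
    Finset.sum_le_sum fun i _ => Finset.single_le_sum (f := fun j => L i j)
      (fun j _ => hL0 i j) (Finset.mem_univ j)
  set b := (volume (Metric.ball (0 : Euc n) 1)).toReal with hb
  set K := C * (1 + Λ) * b with hK
  obtain ⟨ε₀, hε₀, hw₀⟩ := exists_lintegral_translate_le (hloc (R + 1))
    (show 0 < δ / (K ^ 2 + 1) by positivity)
  set ε := min ε₀ 1 with hε_def
  have hε : 0 < ε := lt_min hε₀ one_pos
  obtain ⟨g, hg, hgc, hg1, hgout, hgC, hpout, hpC⟩ := hC ε hε
  set A := C * (1 + Λ) * (ε ^ n)⁻¹ with hA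
  have hw : ∀ z : Euc n, ‖z‖ ≤ ε → ∫⁻ y in Metric.closedBall 0 R, ‖h (y + z) - h y‖ₑ ^ (2 : ℝ)
      ≤ ENNReal.ofReal (δ / (K ^ 2 + 1)) := by
    intro z hz
    refine le_trans ?_ (hw₀ z (hz.trans (min_le_left _ _)))
    refine le_trans ?_ (setLIntegral_le_lintegral (Metric.closedBall 0 R) _)
    refine setLIntegral_mono' measurableSet_closedBall fun y hy => ?_
    have hz1 : ‖z‖ ≤ 1 := hz.trans (min_le_right _ _)
    rw [mem_closedBall_zero_iff] at hy
    rw [indicator_of_mem, indicator_of_mem]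
    · rw [mem_closedBall_zero_iff]; linarith
    · rw [mem_closedBall_zero_iff]; linarith [norm_add_le y z]
  have hfin : (ENNReal.ofReal A * volume (Metric.closedBall (0 : Euc n) ε)) ^ (2 : ℝ) *
      ENNReal.ofReal (δ / (K ^ 2 + 1)) ≤ ENNReal.ofReal δ := by
    have hv : volume (Metric.closedBall (0 : Euc n) ε) = ENNReal.ofReal (ε ^ n * b) := by
      rw [Measure.addHaar_closedBall _ _ hε.le, ENNReal.ofReal_mul (by positivity), hb,
        ENNReal.ofReal_toReal measure_ball_lt_top.ne]
      simp
    have hAv : ENNReal.ofReal A * volume (Metric.closedBall (0 : Euc n) ε) = ENNReal.ofReal K := by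
      rw [hv, ← ENNReal.ofReal_mul (by positivity), hA, hK]
      congr 1
      have := pow_ne_zero n hε.ne'
      field_simp
    rw [hAv, ENNReal.ofReal_rpow_of_nonneg (by positivity) (by norm_num),
      ← ENNReal.ofReal_mul (by positivity)]
    refine ENNReal.ofReal_le_ofReal ?_
    rw [Real.rpow_two, ← mul_div_assoc, div_le_iff₀ (by positivity)]
    nlinarith [sq_nonneg K]
  have hgy : ∀ y : Euc n, ContDiff ℝ ∞ fun x => g (y - x) := fun y =>
    hg.comp (contDiff_const.sub contDiff_id)
  have hgyc : ∀ y : Euc n, HasCompactSupport fun x => g (y - x) := fun y =>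
    hgc.comp_homeomorph (Homeomorph.subLeft y)
  have hpg := fun i => contDiff_pd hg i
  have hpgc := fun i => pd_hasCompactSupport hgc i
  have hps : ∀ i, pd i (cv h g) = cv h (pd i g) := pd_cv hli hg hgc
  refine ⟨cv h g, fun j y => ∑ i, cv (fun x => h x * G x i j) (pd i g) y, contDiff_cv hli hg hgc,
    fun j => ContDiff.sum fun i _ => contDiff_cv (hGli i j) (hpg i) (hpgc i), fun y => ?_, ?_,
    fun j => ?_⟩
  · have h1 : ∀ j, pd j (fun y => ∑ i, cv (fun x => h x * G x i j) (pd i g) y) y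
        = ∑ i, cv (fun x => h x * G x i j) (pd j (pd i g)) y := by
      intro j
      rw [pd_sum _ fun i => contDiff_differentiable (contDiff_cv (hGli i j) (hpg i) (hpgc i))]
      exact Finset.sum_congr rfl fun i _ => by rw [pd_cv (hGli i j) (hpg i) (hpgc i)]
    simp only [h1]
    rw [← hweak _ (hgy y) (hgyc y)]
    have h2 : ∀ x i j, hess (fun x => g (y - x)) x i j = pd j (pd i g) (y - x) := by
      intro x i j
      rw [hess_apply, pd_comp_sub (contDiff_differentiable hg)]
      have := pd_const_mul (-1)
        (contDiff_differentiable ((hpg i).comp (contDiff_const.sub contDiff_id)) :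
          Differentiable ℝ fun x => pd i g (y - x)) j
      simp only [neg_mul, one_mul] at this
      rw [this, pd_comp_sub (contDiff_differentiable (hpg i))]
      exact neg_neg _
    have hintg : ∀ i j, Integrable fun x => h x * G x i j * pd j (pd i g) (y - x) := fun i j =>
      cv_integrable (hGli i j) (contDiff_pd (hpg i) j).continuous
        (pd_hasCompactSupport (hpgc i) j) y
    rw [Finset.sum_comm]
    simp only [cv]
    simp_rw [h2, Finset.mul_sum, ← mul_assoc]
    rw [integral_finsetSum _ fun i _ => integrable_finsetSum _ fun j _ => hintg i j]
    refine Finset.sum_congr rfl fun i _ => ?_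
    rw [integral_finsetSum _ fun j _ => hintg i j]
  · refine (lintegral_kernel_le hm measurableSet_closedBall hw (A := A) fun y hy => ?_).trans hfin
    have he : cv h g y - h y = ∫ x, (h x - h y) * g (y - x) := by
      simp only [sub_mul]
      rw [integral_sub (cv_integrable hli hg.continuous hgc y)
        (((hgy y).continuous.integrable_of_hasCompactSupport (hgyc y)).const_mul _),
        integral_const_mul, integral_sub_left_eq_self g volume y, hg1, mul_one]
      rfl
    rw [he]
    refine enorm_integral_kernel_le (fun x _ => ?_) fun x hx => hgout _ hx
    refine (hgC _).trans ?_
    rw [hA]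
    gcongr
    nlinarith
  · refine (lintegral_kernel_le hm measurableSet_closedBall hw (A := A) fun y hy => ?_).trans hfin
    have hint1 : ∀ i, Integrable fun x => h x * G x i j * pd i g (y - x) := fun i =>
      cv_integrable (hGli i j) (hpg i).continuous (hpgc i) y
    have hint2 : ∀ i, Integrable fun x => h x * pd i g (y - x) := fun i =>
      cv_integrable hli (hpg i).continuous (hpgc i) y
    have hpgy : ∀ i, pd i (fun x => g (y - x)) = fun x => - pd i g (y - x) :=
      pd_comp_sub (contDiff_differentiable hg) y
    have hint3 : ∀ i, Integrable fun x => (G x i j - G y i j) * pd i g (y - x) := fun i =>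
      (((hG i j).continuous.sub continuous_const).mul
        ((hpg i).continuous.comp
          (continuous_const.sub continuous_id))).integrable_of_hasCompactSupport
        ((hpgc i).comp_homeomorph (Homeomorph.subLeft y)).mul_left
    have hzero : ∑ i, ∫ x, (G x i j - G y i j) * pd i g (y - x) = 0 := by
      have h1 : ∀ i, ∫ x, (G x i j - G y i j) * pd i g (y - x)
          = ∫ x, g (y - x) * pd i (fun y => G y i j) x := by
        intro i
        have h := integral_mul_pd (f := fun x => G x i j - G y i j)
          ((hG i j).sub contDiff_const) (hgy y) (hgyc y) i
        rw [hpgy, pd_sub (contDiff_differentiable (hG i j)) (differentiable_const _), pd_const] at h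
        simp only [sub_zero, mul_neg, integral_neg, neg_inj] at h
        exact h
      simp only [h1]
      rw [← integral_finsetSum]
      · simp [← Finset.mul_sum, hdiv]
      · intro i _
        exact ((hgy y).continuous.mul (contDiff_pd (hG i j) i).continuous
          ).integrable_of_hasCompactSupport (hgyc y).mul_right
    have he : (∑ i, cv (fun x => h x * G x i j) (pd i g) y) - ∑ i, G y i j * pd i (cv h g) y
        = ∫ x, (h x - h y) * ∑ i, (G x i j - G y i j) * pd i g (y - x) := by
      have h4 : ∀ x, (h x - h y) * ∑ i, (G x i j - G y i j) * pd i g (y - x)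
          = ∑ i, ((h x * G x i j * pd i g (y - x) - G y i j * (h x * pd i g (y - x)))
              - h y * ((G x i j - G y i j) * pd i g (y - x))) := by
        intro x
        rw [Finset.mul_sum]
        exact Finset.sum_congr rfl fun i _ => by ring
      simp only [h4]
      rw [integral_finsetSum]
      swap
      · exact fun i _ => ((hint1 i).sub ((hint2 i).const_mul _)).sub ((hint3 i).const_mul _)
      have h5 : ∀ i, ∫ x, ((h x * G x i j * pd i g (y - x) - G y i j * (h x * pd i g (y - x)))
              - h y * ((G x i j - G y i j) * pd i g (y - x)))
          = (cv (fun x => h x * G x i j) (pd i g) y - G y i j * pd i (cv h g) y)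
            - h y * ∫ x, (G x i j - G y i j) * pd i g (y - x) := by
        intro i
        have h6 : Integrable fun x =>
            h x * G x i j * pd i g (y - x) - G y i j * (h x * pd i g (y - x)) :=
          (hint1 i).sub ((hint2 i).const_mul _)
        rw [integral_sub h6 ((hint3 i).const_mul _),
          integral_sub (hint1 i) ((hint2 i).const_mul _), integral_const_mul, integral_const_mul,
          hps]
        rfl
      simp only [h5, Finset.sum_sub_distrib, ← Finset.mul_sum, hzero, mul_zero, sub_zero]
    rw [he]
    refine enorm_integral_kernel_le (fun x hx => ?_) fun x hx => ?_
    · rw [mem_closedBall_zero_iff] at hy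
      have hyR : y ∈ Metric.closedBall (0 : Euc n) (R + 1) := by
        rw [mem_closedBall_zero_iff]; linarith
      have hxR : x ∈ Metric.closedBall (0 : Euc n) (R + 1) := by
        rw [mem_closedBall_zero_iff]
        have h6 : ‖y - x‖ ≤ 1 := hx.trans (min_le_right _ _)
        have h7 : x = y - (y - x) := by abel
        have h8 := norm_sub_le y (y - x)
        rw [← h7] at h8
        linarith
      calc |∑ i, (G x i j - G y i j) * pd i g (y - x)|
          ≤ ∑ i, |(G x i j - G y i j) * pd i g (y - x)| := Finset.abs_sum_le_sum_abs _ _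
        _ ≤ ∑ i, L i j * (C * (ε ^ n)⁻¹) := by
            refine Finset.sum_le_sum fun i _ => ?_
            rw [abs_mul]
            have h6 : |G x i j - G y i j| ≤ L i j * ε := by
              refine (hL i j x hxR y hyR).trans ?_
              rw [norm_sub_rev]
              exact mul_le_mul_of_nonneg_left hx (hL0 i j)
            calc |G x i j - G y i j| * |pd i g (y - x)|
                ≤ (L i j * ε) * (C * (ε ^ n)⁻¹ * ε⁻¹) :=
                  mul_le_mul h6 (hpC _ _) (abs_nonneg _) (mul_nonneg (hL0 i j) hε.le)
              _ = L i j * (C * (ε ^ n)⁻¹) * (ε * ε⁻¹) := by ring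
              _ = _ := by rw [mul_inv_cancel₀ hε.ne', mul_one]
        _ = (∑ i, L i j) * (C * (ε ^ n)⁻¹) := by rw [Finset.sum_mul]
        _ ≤ (1 + Λ) * (C * (ε ^ n)⁻¹) := by
            gcongr
            linarith [hΛj j]
        _ = A := by rw [hA]; ring
    · exact Finset.sum_eq_zero fun i _ => by rw [hpout i _ hx, mul_zero]

lemma ae_const_of_integral_mul_pd_eq_zero {h : Euc n → ℝ} (hli : LocallyIntegrable h)
    (h0 : ∀ (i : Fin n) (ψ : Euc n → ℝ), ContDiff ℝ ∞ ψ → HasCompactSupport ψ →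
      ∫ x, h x * pd i ψ x = 0) : ∃ c, h =ᵐ[volume] fun _ => c := by
  let b : ℕ → ContDiffBump (0 : Euc n) := fun k =>
    ⟨1 / (k + 1), 2 * (1 / (k + 1)), by positivity, by
      have : (0 : ℝ) < 1 / ((k : ℝ) + 1) := by positivity
      linarith⟩
  have hconst : ∀ k y, cv h ((b k).normed volume) y = cv h ((b k).normed volume) 0 := by
    intro k y
    have hg : ContDiff ℝ ∞ ((b k).normed volume) := (b k).contDiff_normed
    have hgc : HasCompactSupport ((b k).normed volume) := (b k).hasCompactSupport_normed
    refine is_const_of_fderiv_eq_zero (𝕜 := ℝ) (contDiff_differentiable (contDiff_cv hli hg hgc))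
      (fun z => ?_) y 0
    ext u
    rw [fderiv_eq_sum_pd, _root_.zero_apply]
    refine Finset.sum_eq_zero fun i _ => ?_
    have h1 := h0 i (fun x => (b k).normed volume (z - x))
        (hg.comp (contDiff_const.sub contDiff_id))
      (hgc.comp_homeomorph (Homeomorph.subLeft z))
    rw [pd_comp_sub (contDiff_differentiable hg)] at h1
    simp only [mul_neg, integral_neg, neg_eq_zero] at h1
    rw [pd_cv hli hg hgc, cv, h1, zero_mul]
  have hlim := ContDiffBump.ae_convolution_tendsto_right_of_locallyIntegrable
    (μ := (volume : Measure (Euc n))) (φ := b) (l := atTop) (g := h) (K := 2)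
    (by
      have : Tendsto (fun k : ℕ => 2 * (1 / ((k : ℝ) + 1))) atTop (𝓝 (2 * 0)) :=
        tendsto_one_div_add_atTop_nhds_zero_nat.const_mul 2
      simpa [b] using this)
    (Eventually.of_forall fun k => le_rfl) hli
  have heq : ∀ k y, (convolution ((b k).normed volume) h (ContinuousLinearMap.lsmul ℝ ℝ) volume) y
      = cv h ((b k).normed volume) 0 := by
    intro k y
    rw [← hconst k y, cv, convolution_eq_swap]
    refine integral_congr_ae (Eventually.of_forall fun x => ?_)
    simp [mul_comm]
  simp only [heq] at hlim
  by_cases hex : ∃ y, Tendsto (fun k => cv h ((b k).normed volume) 0) atTop (𝓝 (h y))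
  · obtain ⟨y, hy⟩ := hex
    refine ⟨h y, ?_⟩
    filter_upwards [hlim] with z hz using tendsto_nhds_unique hz hy
  · refine ⟨0, ?_⟩
    filter_upwards [hlim] with z hz using absurd ⟨z, hz⟩ hex

lemma exists_ellipticity {G : Euc n → Matrix (Fin n) (Fin n) ℝ}
    (hG : ∀ i j, Continuous fun x => G x i j) (hpd : ∀ x, (G x).PosDef) (R : ℝ) :
    ∃ l > 0, ∀ x ∈ Metric.closedBall (0 : Euc n) R, ∀ u : Fin n → ℝ,
      l * (u ⬝ᵥ u) ≤ u ⬝ᵥ G x *ᵥ u := by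
  have hcont : Continuous fun p : Euc n × Euc n => p.2.ofLp ⬝ᵥ G p.1 *ᵥ p.2.ofLp := by
    simp only [dot_mulVec_eq_sum]
    refine continuous_finsetSum _ fun i _ => continuous_finsetSum _ fun j _ => ?_
    have := (hG i j).comp (continuous_fst : Continuous fun p : Euc n × Euc n => p.1)
    simp only [Function.comp_def] at this
    fun_prop
  obtain ⟨l, hl, hb⟩ := ((isCompact_closedBall (0 : Euc n) R).prod
    (isCompact_sphere (0 : Euc n) 1)).exists_forall_le' hcont.continuousOn (a := 0) (by
      rintro ⟨x, u⟩ ⟨-, hu⟩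
      have hu0 : u.ofLp ≠ 0 := by
        intro h
        have : u = 0 := by ext i; exact congrFun h i
        simp [this] at hu
      simpa using (hpd x).dotProduct_mulVec_pos hu0)
  refine ⟨l, hl, fun x hx u => ?_⟩
  by_cases hu : u = 0
  · simp [hu]
  let w : Euc n := WithLp.toLp 2 u
  have hw : w ≠ 0 := by
    intro h
    exact hu (by simpa [w] using congrArg WithLp.ofLp h)
  have hnw : 0 < ‖w‖ := norm_pos_iff.2 hw
  have h1 := hb (x, ‖w‖⁻¹ • w) ⟨hx, by simp [norm_smul, hnw.ne']⟩
  have h2 : u ⬝ᵥ u = ‖w‖ ^ 2 := by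
    rw [EuclideanSpace.norm_sq_eq]
    simp [w, dotProduct, sq]
  simp only [WithLp.ofLp_smul, mulVec_smul, dotProduct_smul, smul_dotProduct, smul_eq_mul] at h1
  have h3 : w.ofLp ⬝ᵥ G x *ᵥ w.ofLp = u ⬝ᵥ G x *ᵥ u := rfl
  rw [h3] at h1
  rw [h2]
  calc l * ‖w‖ ^ 2 ≤ (‖w‖⁻¹ * (‖w‖⁻¹ * (u ⬝ᵥ G x *ᵥ u))) * ‖w‖ ^ 2 := by gcongr
    _ = _ := by field_simp

lemma energy_pointwise {A : Matrix (Fin n) (Fin n) ℝ} (hA : A.PosDef) {a b U : Fin n → ℝ}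
    {l κ c s : ℝ} (hl : 0 < l) (hκ : 0 < κ) (hla : l * (a ⬝ᵥ a) ≤ a ⬝ᵥ A *ᵥ a) :
    1 / 2 * (c ^ 2 * (a ⬝ᵥ A *ᵥ a)) ≤ (c ^ 2 * (U ⬝ᵥ a) + 2 * c * s * (U ⬝ᵥ b))
      + 4 * (s ^ 2 * (b ⬝ᵥ A *ᵥ b))
      + (c ^ 2 / l + (b ⬝ᵥ b) / κ) * ((U - A *ᵥ a) ⬝ᵥ (U - A *ᵥ a)) + κ * (c ^ 2 * s ^ 2) := by
  set E := U - A *ᵥ a with hE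
  have hU : U = A *ᵥ a + E := by rw [hE]; abel
  have hsymm : b ⬝ᵥ A *ᵥ a = a ⬝ᵥ A *ᵥ b := by
    rw [dotProduct_mulVec, ← mulVec_transpose, dotProduct_comm]
    have h := hA.isHermitian.eq
    rw [conjTranspose_eq_transpose_of_trivial] at h
    rw [h]
  have hsymm' : (A *ᵥ a) ⬝ᵥ a = a ⬝ᵥ A *ᵥ a := dotProduct_comm _ _
  have hsymm'' : (A *ᵥ a) ⬝ᵥ b = b ⬝ᵥ A *ᵥ a := dotProduct_comm _ _
  have h1 : 0 ≤ ((c / 2) • a + (2 * s) • b) ⬝ᵥ A *ᵥ ((c / 2) • a + (2 * s) • b) := by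
    simpa using hA.posSemidef.dotProduct_mulVec_nonneg ((c / 2) • a + (2 * s) • b)
  simp only [mulVec_add, mulVec_smul, dotProduct_add, add_dotProduct, dotProduct_smul,
    smul_dotProduct, smul_eq_mul, ← hsymm] at h1
  have h2 : 0 ≤ ((l / 2) • a + E) ⬝ᵥ ((l / 2) • a + E) := by
    rw [dotProduct]; exact Finset.sum_nonneg fun i _ => mul_self_nonneg _
  simp only [dotProduct_add, add_dotProduct, dotProduct_smul, smul_dotProduct, smul_eq_mul,
    dotProduct_comm a E] at h2
  have h3 : (E ⬝ᵥ b) ^ 2 ≤ (E ⬝ᵥ E) * (b ⬝ᵥ b) := by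
    have := Finset.sum_mul_sq_le_sq_mul_sq Finset.univ E b
    simpa [dotProduct, sq] using this
  rw [hU, add_dotProduct, add_dotProduct, hsymm', hsymm'']
  set aa := a ⬝ᵥ a
  set Ea := E ⬝ᵥ a
  set Eb := E ⬝ᵥ b
  set EE := E ⬝ᵥ E
  set bb := b ⬝ᵥ b
  set Q := a ⬝ᵥ A *ᵥ a
  set P := b ⬝ᵥ A *ᵥ a
  set T := b ⬝ᵥ A *ᵥ b
  have h4 : 0 ≤ c ^ 2 * (Q / 4 + Ea + EE / l) := by
    refine mul_nonneg (sq_nonneg _) ?_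
    have : 0 ≤ (l * (l * aa / 4 + Ea + EE / l)) := by
      rw [mul_add, mul_div_cancel₀ _ hl.ne']
      linarith
    have h5 := nonneg_of_mul_nonneg_right this hl
    linarith
  have h6 : 0 ≤ κ * (c ^ 2 * s ^ 2) + 2 * c * s * Eb + bb / κ * EE := by
    have : 0 ≤ κ * (κ * (c ^ 2 * s ^ 2) + 2 * c * s * Eb + bb / κ * EE) := by
      have h7 : κ * (bb / κ * EE) = bb * EE := by field_simp
      rw [mul_add, h7]
      nlinarith [sq_nonneg (κ * c * s + Eb)]
    exact nonneg_of_mul_nonneg_right this hκ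
  have h8 : (c ^ 2 / l + bb / κ) * EE = c ^ 2 * (EE / l) + bb / κ * EE := by ring
  rw [h8]
  nlinarith

lemma setIntegral_sq_le_of_lintegral {f : Euc n → ℝ} (hf : Measurable f) {S : Set (Euc n)} {τ : ℝ}
    (hτ : 0 ≤ τ) (h : ∫⁻ y in S, ‖f y‖ₑ ^ (2 : ℝ) ≤ ENNReal.ofReal τ) :
    IntegrableOn (fun y => f y ^ 2) S ∧ ∫ y in S, f y ^ 2 ≤ τ := by
  have h1 : ∀ y, ‖f y‖ₑ ^ (2 : ℝ) = ENNReal.ofReal (f y ^ 2) := by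
    intro y
    rw [Real.enorm_eq_ofReal_abs, ENNReal.ofReal_rpow_of_nonneg (abs_nonneg _) (by norm_num),
      Real.rpow_two, sq_abs]
  simp only [h1] at h
  have hnn : 0 ≤ᵐ[volume.restrict S] fun y => f y ^ 2 := Eventually.of_forall fun y => sq_nonneg _
  refine ⟨⟨(hf.pow_const 2).aestronglyMeasurable, ?_⟩, ?_⟩
  · rw [hasFiniteIntegral_iff_ofReal hnn]
    exact h.trans_lt ENNReal.ofReal_lt_top
  · rw [integral_eq_lintegral_of_nonneg_ae hnn (hf.pow_const 2).aestronglyMeasurable]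
    exact ENNReal.toReal_le_of_le_ofReal hτ h

lemma integrableOn_sq_of_memLp_ball {h : Euc n → ℝ}
    (hloc : ∀ R, MemLp ((Metric.closedBall (0 : Euc n) R).indicator h) 2) (R : ℝ) :
    IntegrableOn (fun x => h x ^ 2) (Metric.closedBall 0 R) := by
  refine (hloc R).integrable_sq.integrableOn.congr_fun (fun x hx => ?_) measurableSet_closedBall
  simp only [indicator_of_mem hx]

lemma exists_small_gradient {G : Euc n → Matrix (Fin n) (Fin n) ℝ}
    (hG : ∀ i j, ContDiff ℝ ∞ fun x => G x i j) (hpd : ∀ x, (G x).PosDef)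
    (hdiv : ∀ x j, ∑ i, pd i (fun y => G y i j) x = 0) {h : Euc n → ℝ} (hm : Measurable h)
    (hloc : ∀ R, MemLp ((Metric.closedBall (0 : Euc n) R).indicator h) 2)
    (hweak : ∀ g : Euc n → ℝ, ContDiff ℝ ∞ g → HasCompactSupport g →
      ∫ x, h x * ∑ i, ∑ j, G x i j * hess g x i j = 0) {χ : Euc n → ℝ} (hχ : ContDiff ℝ ∞ χ)
    (hχc : HasCompactSupport χ) {δ : ℝ} (hδ : 0 < δ)
    (hχδ : ∫ x, h x ^ 2 * ((fun i => pd i χ x) ⬝ᵥ G x *ᵥ (fun i => pd i χ x)) ≤ δ) (r : ℝ) :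
    ∃ s : Euc n → ℝ, ContDiff ℝ ∞ s ∧
      IntegrableOn (fun y => (s y - h y) ^ 2) (Metric.closedBall 0 r) ∧
      ∫ y in Metric.closedBall 0 r, (s y - h y) ^ 2 ≤ δ ∧
      ∫ y, χ y ^ 2 * ((fun i => pd i s y) ⬝ᵥ G y *ᵥ (fun i => pd i s y)) ≤ 20 * δ := by
  obtain ⟨R₀, hR₀⟩ := hχc.isCompact.isBounded.subset_closedBall 0
  set R := max r R₀ with hR
  set S := Metric.closedBall (0 : Euc n) R with hS
  have hsub : tsupport χ ⊆ S := hR₀.trans (Metric.closedBall_subset_closedBall (le_max_right _ _))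
  have hGc : Continuous G := continuous_matrix fun i j => (hG i j).continuous
  obtain ⟨l, hl, hell⟩ := exists_ellipticity (fun i j => (hG i j).continuous) hpd R
  set b : Euc n → Fin n → ℝ := fun y i => pd i χ y with hb
  have hbc : Continuous b := continuous_pi fun i => (contDiff_pd hχ i).continuous
  have hb0 : ∀ y, y ∉ S → b y = 0 := fun y hy => by
    ext i
    show pd i χ y = 0
    exact image_eq_zero_of_notMem_tsupport fun hmem => hy (hsub (tsupport_pd_subset χ i hmem))
  have hχ0 : ∀ y, y ∉ S → χ y = 0 := fun y hy =>
    image_eq_zero_of_notMem_tsupport fun hmem => hy (hsub hmem)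
  have hci : ∀ {f : Euc n → ℝ}, Continuous f → IntegrableOn f S := fun hf =>
    hf.continuousOn.integrableOn_compact (isCompact_closedBall _ _)
  have hbGb : Continuous fun y => b y ⬝ᵥ G y *ᵥ b y := hbc.dotProduct (hGc.matrix_mulVec hbc)
  obtain ⟨B, hB0, hB1, hB2, hB3⟩ : ∃ B : ℝ, 0 ≤ B ∧ (∀ y ∈ S, χ y ^ 2 ≤ B) ∧
      (∀ y ∈ S, b y ⬝ᵥ b y ≤ B) ∧ ∀ y ∈ S, b y ⬝ᵥ G y *ᵥ b y ≤ B := by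
    obtain ⟨B1, h1⟩ := (isCompact_closedBall (0 : Euc n) R).exists_bound_of_continuousOn
      (hχ.continuous.pow 2).continuousOn
    obtain ⟨B2, h2⟩ := (isCompact_closedBall (0 : Euc n) R).exists_bound_of_continuousOn
      (hbc.dotProduct hbc).continuousOn
    obtain ⟨B3, h3⟩ := (isCompact_closedBall (0 : Euc n) R).exists_bound_of_continuousOn
      hbGb.continuousOn
    refine ⟨max 0 (max B1 (max B2 B3)), le_max_left _ _, fun y hy => ?_, fun y hy => ?_,
      fun y hy => ?_⟩
    · exact (le_abs_self _).trans ((h1 y hy).trans (by simp))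
    · exact (le_abs_self _).trans ((h2 y hy).trans (by simp))
    · exact (le_abs_self _).trans ((h3 y hy).trans (by simp))
  have hbGb0 : ∀ y, 0 ≤ b y ⬝ᵥ G y *ᵥ b y := fun y => by
    simpa using (hpd y).posSemidef.dotProduct_mulVec_nonneg (b y)
  have hh2 : IntegrableOn (fun y => h y ^ 2) S := integrableOn_sq_of_memLp_ball hloc R
  set H := ∫ y in S, h y ^ 2 with hH
  have hH0 : 0 ≤ H := integral_nonneg fun y => sq_nonneg _
  set κ := δ / (2 * (B + 1) * (H + 1)) with hκdef
  have hκ : 0 < κ := by positivity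
  set M := 8 * B + (B / l + B / κ) * n with hM
  have hM0 : 0 ≤ M := by positivity
  set τ := min (min δ 1) (δ / (M + 1)) with hτdef
  have hτ : 0 < τ := lt_min (lt_min hδ one_pos) (by positivity)
  have hτδ : τ ≤ δ := (min_le_left _ _).trans (min_le_left _ _)
  have hτ1 : τ ≤ 1 := (min_le_left _ _).trans (min_le_right _ _)
  have hτM : M * τ ≤ δ := by
    have : τ ≤ δ / (M + 1) := min_le_right _ _
    rw [le_div_iff₀ (by positivity)] at this
    nlinarith
  obtain ⟨s, U, hs, hU, hUdiv, hsh, hE⟩ := exists_mollified_solution hG hdiv hm hloc hweak R hτ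
  obtain ⟨hshi, hsh'⟩ := setIntegral_sq_le_of_lintegral (f := fun y => s y - h y)
    (hs.continuous.measurable.sub hm) hτ.le hsh
  set a : Euc n → Fin n → ℝ := fun y i => pd i s y with ha
  have hac : Continuous a := continuous_pi fun i => (contDiff_pd hs i).continuous
  set V : Euc n → Fin n → ℝ := fun y j => U j y with hV
  have hVc : Continuous V := continuous_pi fun i => (hU i).continuous
  have hsc := hs.continuous
  have hχcont := hχ.continuous
  set E : Euc n → Fin n → ℝ := fun y => V y - G y *ᵥ a y with hEdef
  have hEc : Continuous E := hVc.sub (hGc.matrix_mulVec hac)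
  have hEj : ∀ j, ∫ y in S, E y j ^ 2 ≤ τ := by
    intro j
    have hcont : Continuous fun y => E y j := (continuous_apply j).comp hEc
    refine (setIntegral_sq_le_of_lintegral hcont.measurable hτ.le ?_).2
    refine le_trans (le_of_eq ?_) (hE j)
    refine setLIntegral_congr_fun measurableSet_closedBall fun y _ => ?_
    have h1 : (G y *ᵥ a y) j = ∑ i, G y i j * pd i s y := by
      rw [mulVec, dotProduct]
      refine Finset.sum_congr rfl fun i _ => ?_
      have := (hpd y).isHermitian.apply i j
      rw [star_trivial] at this
      rw [← this]
    simp only [hEdef, Pi.sub_apply, h1, hV]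
  have hf0 : Continuous fun y => χ y ^ 2 * (a y ⬝ᵥ G y *ᵥ a y) :=
    (hχcont.pow 2).mul (hac.dotProduct (hGc.matrix_mulVec hac))
  have hf1 : Continuous fun y => χ y ^ 2 * (V y ⬝ᵥ a y) + 2 * χ y * s y * (V y ⬝ᵥ b y) :=
    ((hχcont.pow 2).mul (hVc.dotProduct hac)).add
      (((continuous_const.mul hχcont).mul hsc).mul (hVc.dotProduct hbc))
  have hf2 : Continuous fun y => s y ^ 2 * (b y ⬝ᵥ G y *ᵥ b y) := (hsc.pow 2).mul hbGb
  have hf3 : Continuous fun y => (χ y ^ 2 / l + (b y ⬝ᵥ b y) / κ) * (E y ⬝ᵥ E y) :=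
    (((hχcont.pow 2).div_const l).add ((hbc.dotProduct hbc).div_const κ)).mul (hEc.dotProduct hEc)
  have hf4 : Continuous fun y => χ y ^ 2 * s y ^ 2 := (hχcont.pow 2).mul (hsc.pow 2)
  have hmain : 1 / 2 * ∫ y in S, χ y ^ 2 * (a y ⬝ᵥ G y *ᵥ a y) ≤
      (∫ y in S, (χ y ^ 2 * (V y ⬝ᵥ a y) + 2 * χ y * s y * (V y ⬝ᵥ b y)))
      + 4 * (∫ y in S, s y ^ 2 * (b y ⬝ᵥ G y *ᵥ b y))
      + (∫ y in S, (χ y ^ 2 / l + (b y ⬝ᵥ b y) / κ) * (E y ⬝ᵥ E y))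
      + κ * ∫ y in S, χ y ^ 2 * s y ^ 2 := by
    have i2 : IntegrableOn (fun y => 4 * (s y ^ 2 * (b y ⬝ᵥ G y *ᵥ b y))) S :=
      hci (continuous_const.mul hf2)
    have i4 : IntegrableOn (fun y => κ * (χ y ^ 2 * s y ^ 2)) S := hci (continuous_const.mul hf4)
    have i12 : IntegrableOn (fun y => (χ y ^ 2 * (V y ⬝ᵥ a y) + 2 * χ y * s y * (V y ⬝ᵥ b y))
        + 4 * (s y ^ 2 * (b y ⬝ᵥ G y *ᵥ b y))) S := (hci hf1).add i2
    have i123 : IntegrableOn (fun y => (χ y ^ 2 * (V y ⬝ᵥ a y) + 2 * χ y * s y * (V y ⬝ᵥ b y))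
        + 4 * (s y ^ 2 * (b y ⬝ᵥ G y *ᵥ b y))
        + (χ y ^ 2 / l + (b y ⬝ᵥ b y) / κ) * (E y ⬝ᵥ E y)) S := i12.add (hci hf3)
    rw [← integral_const_mul, ← integral_const_mul, ← integral_const_mul,
      ← integral_add (hci hf1) i2, ← integral_add i12 (hci hf3), ← integral_add i123 i4]
    refine setIntegral_mono_on (hci (continuous_const.mul hf0)) (i123.add i4)
      measurableSet_closedBall fun y hy => ?_
    exact energy_pointwise (hpd y) hl hκ (hell y hy (a y))
  have hI1 : ∫ y in S, (χ y ^ 2 * (V y ⬝ᵥ a y) + 2 * χ y * s y * (V y ⬝ᵥ b y)) = 0 := by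
    rw [setIntegral_eq_integral_of_forall_compl_eq_zero fun y hy => by
      rw [hχ0 y hy, hb0 y hy]; simp]
    have hχs : ContDiff ℝ ∞ fun y => χ y * (χ y * s y) := hχ.mul (hχ.mul hs)
    have hχsc : HasCompactSupport fun y => χ y * (χ y * s y) := hχc.mul_right
    have hpdχ : ∀ j, pd j (fun y => χ y * (χ y * s y))
        = fun y => χ y ^ 2 * a y j + 2 * χ y * s y * b y j := by
      intro j
      rw [pd_mul (contDiff_differentiable hχ) (contDiff_differentiable (hχ.mul hs)),
        pd_mul (contDiff_differentiable hχ) (contDiff_differentiable hs)]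
      ext y
      simp only [ha, hb]
      ring
    have hI : ∀ j, Integrable fun y => U j y * pd j (fun y => χ y * (χ y * s y)) y := fun j =>
      ((hU j).continuous.mul (contDiff_pd hχs j).continuous).integrable_of_hasCompactSupport
        (pd_hasCompactSupport hχsc j).mul_left
    have hI' : ∀ j, Integrable fun y => χ y * (χ y * s y) * pd j (U j) y := fun j =>
      (hχs.continuous.mul (contDiff_pd (hU j) j).continuous).integrable_of_hasCompactSupport
        hχsc.mul_right
    calc ∫ y, (χ y ^ 2 * (V y ⬝ᵥ a y) + 2 * χ y * s y * (V y ⬝ᵥ b y))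
        = ∫ y, ∑ j, U j y * pd j (fun y => χ y * (χ y * s y)) y := by
          congr 1
          ext y
          simp only [hpdχ, dotProduct, Finset.mul_sum, ← Finset.sum_add_distrib]
          refine Finset.sum_congr rfl fun j _ => ?_
          simp only [hV]
          ring
      _ = ∑ j, ∫ y, U j y * pd j (fun y => χ y * (χ y * s y)) y :=
          integral_finsetSum _ fun j _ => hI j
      _ = ∑ j, - ∫ y, χ y * (χ y * s y) * pd j (U j) y :=
          Finset.sum_congr rfl fun j _ => integral_mul_pd (hU j) hχs hχsc j
      _ = - ∫ y, ∑ j, χ y * (χ y * s y) * pd j (U j) y := by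
          rw [Finset.sum_neg_distrib, integral_finsetSum _ fun j _ => hI' j]
      _ = 0 := by simp [← Finset.mul_sum, hUdiv]
  have hs2 : ∀ y, s y ^ 2 ≤ 2 * h y ^ 2 + 2 * (s y - h y) ^ 2 := fun y => by
    nlinarith [sq_nonneg (2 * h y - s y)]
  have hI2 : ∫ y in S, s y ^ 2 * (b y ⬝ᵥ G y *ᵥ b y) ≤ 2 * δ + 2 * B * τ := by
    have hintg : IntegrableOn (fun y => h y ^ 2 * (b y ⬝ᵥ G y *ᵥ b y)) S :=
      hh2.mul_continuousOn hbGb.continuousOn (isCompact_closedBall _ _)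
    calc ∫ y in S, s y ^ 2 * (b y ⬝ᵥ G y *ᵥ b y)
        ≤ ∫ y in S, (2 * (h y ^ 2 * (b y ⬝ᵥ G y *ᵥ b y)) + 2 * B * (s y - h y) ^ 2) := by
          refine setIntegral_mono_on (hci hf2) ((hintg.const_mul 2).add (hshi.const_mul _))
            measurableSet_closedBall fun y hy => ?_
          have h1 := mul_le_mul_of_nonneg_right (hs2 y) (hbGb0 y)
          have h2 := mul_le_mul_of_nonneg_left (hB3 y hy) (sq_nonneg (s y - h y))
          nlinarith
      _ = 2 * (∫ y in S, h y ^ 2 * (b y ⬝ᵥ G y *ᵥ b y)) + 2 * B * ∫ y in S, (s y - h y) ^ 2 := by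
          rw [integral_add (hintg.const_mul 2) (hshi.const_mul _), integral_const_mul,
            integral_const_mul]
      _ ≤ _ := by
          rw [setIntegral_eq_integral_of_forall_compl_eq_zero fun y hy => by
            rw [hb0 y hy]; simp]
          gcongr
  have hI3 : ∫ y in S, (χ y ^ 2 / l + (b y ⬝ᵥ b y) / κ) * (E y ⬝ᵥ E y)
      ≤ (B / l + B / κ) * (n * τ) := by
    have hEjc : ∀ j, Continuous fun y => E y j ^ 2 := fun j =>
      ((continuous_apply j).comp hEc).pow 2
    calc ∫ y in S, (χ y ^ 2 / l + (b y ⬝ᵥ b y) / κ) * (E y ⬝ᵥ E y)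
        ≤ ∫ y in S, (B / l + B / κ) * ∑ j, E y j ^ 2 := by
          refine setIntegral_mono_on (hci hf3)
            (hci (continuous_const.mul (continuous_finsetSum _ fun j _ => hEjc j)))
            measurableSet_closedBall fun y hy => ?_
          have h1 : E y ⬝ᵥ E y = ∑ j, E y j ^ 2 := by simp [dotProduct, sq]
          rw [h1]
          refine mul_le_mul_of_nonneg_right ?_ (Finset.sum_nonneg fun j _ => sq_nonneg _)
          have := hB1 y hy
          have := hB2 y hy
          gcongr
      _ = (B / l + B / κ) * ∑ j, ∫ y in S, E y j ^ 2 := by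
          rw [integral_const_mul, integral_finsetSum _ fun j _ => hci (hEjc j)]
      _ ≤ (B / l + B / κ) * ∑ j : Fin n, τ := by
          gcongr with j
          exact hEj j
      _ = _ := by simp
  have hI4 : ∫ y in S, χ y ^ 2 * s y ^ 2 ≤ B * (2 * H + 2 * τ) := by
    calc ∫ y in S, χ y ^ 2 * s y ^ 2
        ≤ ∫ y in S, B * (2 * h y ^ 2 + 2 * (s y - h y) ^ 2) := by
          refine setIntegral_mono_on (hci hf4)
            (((hh2.const_mul 2).add (hshi.const_mul 2)).const_mul B)
            measurableSet_closedBall fun y hy => ?_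
          exact mul_le_mul (hB1 y hy) (hs2 y) (sq_nonneg _) hB0
      _ = B * (2 * H + 2 * ∫ y in S, (s y - h y) ^ 2) := by
          rw [integral_const_mul, integral_add (hh2.const_mul 2) (hshi.const_mul 2),
            integral_const_mul, integral_const_mul]
      _ ≤ _ := by gcongr
  have hκB : κ * (B * (2 * H + 2 * τ)) ≤ δ := by
    have h1 : κ * (2 * (B + 1) * (H + 1)) = δ := by
      rw [hκdef]; field_simp
    rw [← h1]
    refine mul_le_mul_of_nonneg_left ?_ hκ.le
    nlinarith [mul_nonneg hB0 hH0, mul_le_mul_of_nonneg_left hτ1 hB0]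
  refine ⟨s, hs, hshi.mono_set (Metric.closedBall_subset_closedBall (le_max_left _ _)), ?_, ?_⟩
  · refine le_trans (setIntegral_mono_set hshi (Eventually.of_forall fun y => sq_nonneg _)
      (Metric.closedBall_subset_closedBall (le_max_left _ _)).eventuallyLE) (hsh'.trans hτδ)
  · rw [← setIntegral_eq_integral_of_forall_compl_eq_zero (s := S) fun y hy => by
      rw [hχ0 y hy]; simp]
    have h5 : κ * ∫ y in S, χ y ^ 2 * s y ^ 2 ≤ δ :=
      (mul_le_mul_of_nonneg_left hI4 hκ.le).trans hκB
    have h6 : 8 * B * τ + (B / l + B / κ) * (n * τ) ≤ δ := by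
      refine le_trans (le_of_eq ?_) hτM
      rw [hM]; ring
    rw [hI1] at hmain
    linarith

/-- A Liouville theorem: a weak solution of `∑ G_ij ∂_ij h = 0`, with `G` elliptic and with
divergence-free rows, is constant if it has small energy cutoffs. -/
theorem ae_const_of_weak_solution {G : Euc n → Matrix (Fin n) (Fin n) ℝ}
    (hG : ∀ i j, ContDiff ℝ ∞ fun x => G x i j) (hpd : ∀ x, (G x).PosDef)
    (hdiv : ∀ x j, ∑ i, pd i (fun y => G y i j) x = 0) {h : Euc n → ℝ} (hm : Measurable h)
    (hloc : ∀ R, MemLp ((Metric.closedBall (0 : Euc n) R).indicator h) 2)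
    (hweak : ∀ g : Euc n → ℝ, ContDiff ℝ ∞ g → HasCompactSupport g →
      ∫ x, h x * ∑ i, ∑ j, G x i j * hess g x i j = 0)
    (hcut : ∀ r δ : ℝ, 0 < δ → ∃ χ : Euc n → ℝ, ContDiff ℝ ∞ χ ∧ HasCompactSupport χ ∧
      (∀ x ∈ Metric.closedBall (0 : Euc n) r, χ x = 1) ∧
      ∫ x, h x ^ 2 * ((fun i => pd i χ x) ⬝ᵥ G x *ᵥ (fun i => pd i χ x)) ≤ δ) :
    ∃ c, h =ᵐ[volume] fun _ => c := by
  have hli := locallyIntegrable_of_memLp_ball hloc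
  have hGc : Continuous G := continuous_matrix fun i j => (hG i j).continuous
  refine ae_const_of_integral_mul_pd_eq_zero hli fun i ψ hψ hψc => ?_
  obtain ⟨r, hr⟩ := hψc.isCompact.isBounded.subset_closedBall 0
  set S := Metric.closedBall (0 : Euc n) r with hS
  have hψ0 : ∀ y, y ∉ S → ψ y = 0 := fun y hy =>
    image_eq_zero_of_notMem_tsupport fun hmem => hy (hr hmem)
  have hpψ0 : ∀ y, y ∉ S → pd i ψ y = 0 := fun y hy =>
    image_eq_zero_of_notMem_tsupport fun hmem => hy (hr (tsupport_pd_subset ψ i hmem))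
  obtain ⟨l, hl, hell⟩ := exists_ellipticity (fun i j => (hG i j).continuous) hpd r
  have hci : ∀ {f : Euc n → ℝ}, Continuous f → IntegrableOn f S := fun hf =>
    hf.continuousOn.integrableOn_compact (isCompact_closedBall _ _)
  have hpψ := (contDiff_pd hψ i).continuous
  set A1 := ∫ y in S, pd i ψ y ^ 2
  set A2 := ∫ y in S, ψ y ^ 2
  have hkey : ∀ θ : ℝ, 0 < θ → |∫ x, h x * pd i ψ x| ≤ θ * (A1 + 1 + A2 + 20 / l) := by
    intro θ hθ
    obtain ⟨χ, hχ, hχc, hχ1, hχδ⟩ := hcut r (θ ^ 2) (by positivity)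
    obtain ⟨s, hs, hshi, hsh, hen⟩ := exists_small_gradient hG hpd hdiv hm hloc hweak hχ hχc
      (by positivity) hχδ r
    have hsc := hs.continuous
    set a : Euc n → Fin n → ℝ := fun y i => pd i s y with ha
    have hac : Continuous a := continuous_pi fun i => (contDiff_pd hs i).continuous
    have hf0 : Continuous fun y => χ y ^ 2 * (a y ⬝ᵥ G y *ᵥ a y) :=
      (hχ.continuous.pow 2).mul (hac.dotProduct (hGc.matrix_mulVec hac))
    have hgrad : ∫ y in S, pd i s y ^ 2 ≤ 20 / l * θ ^ 2 := by
      have h1 : ∫ y in S, l * pd i s y ^ 2 ≤ 20 * θ ^ 2 := by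
        refine le_trans ?_ hen
        have hf0i : Integrable fun y => χ y ^ 2 * (a y ⬝ᵥ G y *ᵥ a y) :=
          hf0.integrable_of_hasCompactSupport (by
            have h2 : HasCompactSupport fun y => χ y * (χ y * (a y ⬝ᵥ G y *ᵥ a y)) := hχc.mul_right
            simpa only [sq, mul_assoc] using h2)
        refine le_trans ?_ (setIntegral_le_integral (s := S) hf0i (Eventually.of_forall fun y =>
          mul_nonneg (sq_nonneg _) ?_))
        · refine setIntegral_mono_on
            (hci (continuous_const.mul ((contDiff_pd hs i).continuous.pow 2)))
            hf0i.integrableOn measurableSet_closedBall fun y hy => ?_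
          rw [hχ1 y hy, one_pow, one_mul]
          refine le_trans ?_ (hell y hy (a y))
          gcongr
          have := Finset.single_le_sum (f := fun i => a y i * a y i)
            (fun i _ => mul_self_nonneg _) (Finset.mem_univ i)
          simpa [dotProduct, sq] using this
        · simpa using (hpd y).posSemidef.dotProduct_mulVec_nonneg (a y)
      rw [integral_const_mul] at h1
      rw [div_mul_eq_mul_div, le_div_iff₀ hl, mul_comm]
      exact h1
    have hmeas : AEStronglyMeasurable (fun y => s y - h y) (volume.restrict S) :=
      (hsc.measurable.sub hm).aestronglyMeasurable
    have hhψ : IntegrableOn (fun y => h y * pd i ψ y) S :=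
      (hli.integrableOn_isCompact (isCompact_closedBall _ _)).mul_continuousOn hpψ.continuousOn
        (isCompact_closedBall _ _)
    have hsψ : IntegrableOn (fun y => s y * pd i ψ y) S := hci (hsc.mul hpψ)
    have hdec : ∫ x, h x * pd i ψ x
        = (∫ y in S, -((s y - h y) * pd i ψ y)) + ∫ y in S, -(ψ y * pd i s y) := by
      have h1 : ∫ y in S, -(ψ y * pd i s y) = ∫ y in S, s y * pd i ψ y := by
        rw [setIntegral_eq_integral_of_forall_compl_eq_zero fun y hy => by rw [hψ0 y hy]; simp,
          setIntegral_eq_integral_of_forall_compl_eq_zero fun y hy => by rw [hpψ0 y hy]; simp,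
          integral_neg, integral_mul_pd hs hψ hψc]
      have h2 : ∫ y in S, -((s y - h y) * pd i ψ y)
          = (∫ y in S, h y * pd i ψ y) - ∫ y in S, s y * pd i ψ y := by
        rw [← integral_sub hhψ hsψ]
        congr 1
        ext y
        ring
      rw [h1, h2, sub_add_cancel,
        setIntegral_eq_integral_of_forall_compl_eq_zero fun y hy => by rw [hpψ0 y hy]; simp]
    have hAB : ∀ x y : ℝ, |-(x * y)| ≤ θ * y ^ 2 + θ⁻¹ * x ^ 2 := by
      intro x y
      rw [abs_neg, abs_mul]
      have h1 : 0 ≤ θ⁻¹ * (θ * |y| - |x|) ^ 2 := by positivity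
      have h2 : θ⁻¹ * (θ * |y| - |x|) ^ 2 = θ * y ^ 2 + θ⁻¹ * x ^ 2 - 2 * (|x| * |y|) := by
        rw [← sq_abs x, ← sq_abs y]
        field_simp
        ring
      have h3 : 0 ≤ |x| * |y| := by positivity
      linarith
    have ip1 : IntegrableOn (fun y => θ * pd i ψ y ^ 2) S := (hci (hpψ.pow 2)).const_mul θ
    have ip2 : IntegrableOn (fun y => θ * ψ y ^ 2) S := (hci (hψ.continuous.pow 2)).const_mul θ
    have ip3 : IntegrableOn (fun y => θ⁻¹ * pd i s y ^ 2) S :=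
      (hci ((contDiff_pd hs i).continuous.pow 2)).const_mul θ⁻¹
    have hb1 : |∫ y in S, -((s y - h y) * pd i ψ y)| ≤ θ * A1 + θ⁻¹ * θ ^ 2 := by
      calc |∫ y in S, -((s y - h y) * pd i ψ y)|
          ≤ ∫ y in S, (θ * pd i ψ y ^ 2 + θ⁻¹ * (s y - h y) ^ 2) := by
            rw [← Real.norm_eq_abs]
            refine norm_integral_le_of_norm_le
              (ip1.add (hshi.const_mul θ⁻¹))
              (Eventually.of_forall fun y => hAB _ _)
        _ = θ * A1 + θ⁻¹ * ∫ y in S, (s y - h y) ^ 2 := by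
            rw [integral_add ip1 (hshi.const_mul θ⁻¹),
              integral_const_mul, integral_const_mul]
        _ ≤ _ := by gcongr
    have hb2 : |∫ y in S, -(ψ y * pd i s y)| ≤ θ * A2 + θ⁻¹ * (20 / l * θ ^ 2) := by
      calc |∫ y in S, -(ψ y * pd i s y)|
          ≤ ∫ y in S, (θ * ψ y ^ 2 + θ⁻¹ * pd i s y ^ 2) := by
            rw [← Real.norm_eq_abs]
            refine norm_integral_le_of_norm_le
              (ip2.add ip3)
              (Eventually.of_forall fun y => ?_)
            rw [mul_comm]
            exact hAB _ _
        _ = θ * A2 + θ⁻¹ * ∫ y in S, pd i s y ^ 2 := by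
            rw [integral_add ip2 ip3,
              integral_const_mul, integral_const_mul]
        _ ≤ _ := by gcongr
    rw [hdec]
    refine (abs_add_le _ _).trans ((add_le_add hb1 hb2).trans (le_of_eq ?_))
    field_simp
    ring
  set Q := A1 + 1 + A2 + 20 / l
  have hQ : 0 < Q := by
    have : 0 ≤ A1 := integral_nonneg fun y => sq_nonneg _
    have : 0 ≤ A2 := integral_nonneg fun y => sq_nonneg _
    positivity
  by_contra hne
  have hpos := abs_pos.2 hne
  have := hkey (|∫ x, h x * pd i ψ x| / (2 * Q)) (by positivity)
  rw [div_mul_eq_mul_div, le_div_iff₀ (by positivity)] at this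
  nlinarith

end

/-! ### Deformations of potentials -/

/-- The coefficient of `t ^ i` in the volume of `C + t K`. -/
def mv (i : ℕ) (C K : Set (Euc n)) : ℝ :=
  ∑ k ∈ Finset.range (n + 1), wt n i k * (volume (C + (k : ℝ) • K)).toReal

lemma IsBody.add_smul {C K : Set (Euc n)} (hC : IsBody C) (hK : IsBody K) {t : ℝ} (ht : 0 ≤ t) :
    IsBody (C + t • K) := by
  rcases ht.eq_or_lt with rfl | ht
  · rwa [zero_smul_set hK.nonempty, add_zero]
  · exact hC.add (hK.smul ht)

lemma IsPotential.add_smul {C K : Set (Euc n)} {φ κ : Euc n → ℝ} (hφ : IsPotential φ C)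
    (hκ : IsPotential κ K) (hC : IsBody C) (hK : IsBody K) {t : ℝ} (ht : 0 ≤ t) :
    IsPotential (fun x => φ x + t * κ x) (C + t • K) := by
  rcases ht.eq_or_lt with rfl | ht
  · simpa [zero_smul_set hK.nonempty] using hφ
  · exact hφ.add (hκ.smul ht) hC (hK.smul ht)

lemma integral_cmix (hn : 0 < n) (i : ℕ) {φ κ : Euc n → ℝ} {C K : Set (Euc n)}
    (hφ : IsPotential φ C) (hC : IsBody C) (hκ : IsPotential κ K) (hK : IsBody K)
    {v : Euc n → Euc n} (hv : ContDiff ℝ ∞ v) (hvc : HasCompactSupport v)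
    (hq : ∀ x u, u ≠ 0 → 0 < u ⬝ᵥ (hess φ x + jac v x) *ᵥ u) :
    Integrable (fun x => cmix i (hess φ x + jac v x) (hess κ x)) ∧
      ∫ x, cmix i (hess φ x + jac v x) (hess κ x) = mv i C K := by
  have h : ∀ k : ℕ, Integrable (fun x => (hess φ x + jac v x + (k : ℝ) • hess κ x).det) ∧
      ∫ x, (hess φ x + jac v x + (k : ℝ) • hess κ x).det = (volume (C + (k : ℝ) • K)).toReal := by
    intro k
    have hk : (0 : ℝ) ≤ k := Nat.cast_nonneg k
    have hess_eq : ∀ x, hess (fun x => φ x + (k : ℝ) * κ x) x + jac v x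
        = hess φ x + jac v x + (k : ℝ) • hess κ x := fun x => by
      rw [hess_add hφ.contDiff (contDiff_const.mul hκ.contDiff), hess_const_mul _ hκ.contDiff]
      abel
    have := (hφ.add_smul hκ hC hK hk).integral_det hn (hC.add_smul hK hk) hv hvc (fun x u hu => by
      rw [hess_eq, add_mulVec, dotProduct_add, smul_mulVec, dotProduct_smul, smul_eq_mul]
      have h1 : 0 ≤ u ⬝ᵥ hess κ x *ᵥ u := by
        simpa using (hκ.posDef x).posSemidef.dotProduct_mulVec_nonneg u
      have := hq x u hu
      positivity)
    simpa only [hess_eq] using this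
  refine ⟨integrable_finsetSum _ fun k _ => (h k).1.const_mul _, ?_⟩
  simp only [cmix, mv]
  rw [integral_finsetSum _ fun k _ => (h k).1.const_mul _]
  exact Finset.sum_congr rfl fun k _ => by rw [integral_const_mul, (h k).2]

lemma integrable_coeff {α : Type*} [MeasurableSpace α] {μ : Measure α} {p : α → Polynomial ℝ}
    {d : ℕ} (hd : ∀ x, (p x).natDegree ≤ d) {S : Set ℝ} (hS : S.Infinite)
    (h : ∀ s ∈ S, Integrable (fun x => (p x).eval s) μ) (j : ℕ) :
    Integrable (fun x => (p x).coeff j) μ := by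
  obtain ⟨T, hTS, hT⟩ := hS.exists_subset_card_eq (d + 1)
  have hp : ∀ x, p x = Lagrange.interpolate T id fun s => (p x).eval s := fun x =>
    Lagrange.eq_interpolate (by simp) (by
      rw [hT]
      exact (Polynomial.degree_le_natDegree).trans_lt (by exact_mod_cast Nat.lt_succ_of_le (hd x)))
  have : (fun x => (p x).coeff j)
      = fun x => ∑ s ∈ T, (Lagrange.basis T id s).coeff j * (p x).eval s := by
    ext x
    conv_lhs => rw [hp x]
    simp [Lagrange.interpolate_apply, Polynomial.finsetSum_coeff, mul_comm]
  rw [this]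
  exact integrable_finsetSum _ fun s hs => (h s (hTS hs)).const_mul _

lemma exists_integral_polynomial {α : Type*} [MeasurableSpace α] {μ : Measure α}
    {p : α → Polynomial ℝ} {d : ℕ} (hd : ∀ x, (p x).natDegree ≤ d)
    (h : ∀ j, Integrable (fun x => (p x).coeff j) μ) :
    ∃ P : Polynomial ℝ, P.natDegree ≤ d ∧ (∀ j, P.coeff j = ∫ x, (p x).coeff j ∂μ) ∧
      ∀ s, P.eval s = ∫ x, (p x).eval s ∂μ := by
  have hP : ∀ j, (∑ k ∈ Finset.range (d + 1),
      Polynomial.monomial k (∫ x, (p x).coeff k ∂μ)).coeff j = ∫ x, (p x).coeff j ∂μ := by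
    intro j
    rw [Polynomial.finsetSum_coeff]
    simp only [Polynomial.coeff_monomial, Finset.sum_ite_eq', Finset.mem_range]
    split_ifs with hj
    · rfl
    · have : ∀ x, (p x).coeff j = 0 := fun x =>
        Polynomial.coeff_eq_zero_of_natDegree_lt ((hd x).trans_lt (by omega))
      simp [this]
  refine ⟨∑ k ∈ Finset.range (d + 1), Polynomial.monomial k (∫ x, (p x).coeff k ∂μ), ?_, hP, ?_⟩
  · refine Polynomial.natDegree_sum_le_of_forall_le _ _ fun k hk => ?_
    exact (Polynomial.natDegree_monomial_le _).trans (by simpa [Nat.lt_succ_iff] using hk)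
  · intro s
    have : (fun x => (p x).eval s)
        = fun x => ∑ k ∈ Finset.range (d + 1), (p x).coeff k * s ^ k := by
      ext x
      exact Polynomial.eval_eq_sum_range' (Nat.lt_succ_of_le (hd x)) s
    rw [this, integral_finsetSum _ fun k _ => (h k).mul_const _, Polynomial.eval_finsetSum]
    refine Finset.sum_congr rfl fun k _ => ?_
    rw [integral_mul_const, Polynomial.eval_monomial]

/-- A potential `φ` staying a potential of some body along `φ + s f` for small `s`, together with
a potential `κ` of a fixed body. -/
structure IsDeformation (ε : ℝ) (φ f κ : Euc n → ℝ) (D : ℝ → Set (Euc n)) (K : Set (Euc n)) :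
    Prop where
  pos : 0 < ε
  contDiff_left : ContDiff ℝ ∞ φ
  contDiff_right : ContDiff ℝ ∞ f
  isBody : ∀ s, |s| < ε → IsBody (D s)
  isPotential : ∀ s, |s| < ε → IsPotential (fun x => φ x + s * f x) (D s)
  isBody_ref : IsBody K
  isPotential_ref : IsPotential κ K

namespace IsDeformation

variable {ε : ℝ} {φ f κ : Euc n → ℝ} {D : ℝ → Set (Euc n)} {K : Set (Euc n)}

lemma hess_eq (h : IsDeformation ε φ f κ D K) (s : ℝ) (x : Euc n) :
    hess (fun x => φ x + s * f x) x = hess φ x + s • hess f x := by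
  rw [hess_add h.contDiff_left (contDiff_const.mul h.contDiff_right),
    hess_const_mul _ h.contDiff_right]

lemma posDef (h : IsDeformation ε φ f κ D K) {s : ℝ} (hs : |s| < ε) (x : Euc n) :
    (hess φ x + s • hess f x).PosDef := by
  rw [← h.hess_eq]
  exact (h.isPotential s hs).posDef x

lemma isPotential_zero (h : IsDeformation ε φ f κ D K) : IsPotential φ (D 0) := by
  simpa using h.isPotential 0 (by simpa using h.pos)

lemma exists_pos_quad (h : IsDeformation ε φ f κ D K) {v : Euc n → Euc n} (hv : ContDiff ℝ ∞ v)
    (hvc : HasCompactSupport v) : ∃ δ > 0, δ ≤ ε ∧ ∀ s, |s| < δ → ∀ x u, u ≠ 0 →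
      0 < u ⬝ᵥ (hess φ x + s • (hess f x + jac v x)) *ᵥ u := by
  obtain ⟨R, hR⟩ := hvc.isCompact.isBounded.subset_closedBall 0
  obtain ⟨l, hl, hell⟩ := exists_ellipticity
    (fun i j => (contDiff_hess h.contDiff_left i j).continuous) h.isPotential_zero.posDef R
  have hYc : Continuous fun x => hess f x + jac v x := continuous_matrix fun i j =>
    (contDiff_hess h.contDiff_right i j).continuous.add (contDiff_jac hv i j).continuous
  have hB : ∃ B : ℝ, 0 ≤ B ∧ ∀ x ∈ Metric.closedBall (0 : Euc n) R, ∀ u : Fin n → ℝ,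
      |u ⬝ᵥ (hess f x + jac v x) *ᵥ u| ≤ B * (u ⬝ᵥ u) := by
    have hc : Continuous fun x => ∑ i, ∑ j, |(hess f x + jac v x) i j| :=
      continuous_finsetSum _ fun i _ => continuous_finsetSum _ fun j _ =>
        ((continuous_apply_apply i j).comp hYc).abs
    obtain ⟨B, hB⟩ := (isCompact_closedBall (0 : Euc n) R).exists_bound_of_continuousOn
      hc.continuousOn
    refine ⟨max B 0, le_max_right _ _, fun x hx u => ?_⟩
    have h1 : ∑ i, ∑ j, |(hess f x + jac v x) i j| ≤ max B 0 :=
      (le_abs_self _).trans ((hB x hx).trans (le_max_left _ _))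
    have huu : ∀ i, u i ^ 2 ≤ u ⬝ᵥ u := fun i => by
      have := Finset.single_le_sum (f := fun i => u i * u i)
        (fun i _ => mul_self_nonneg _) (Finset.mem_univ i)
      simpa [dotProduct, sq] using this
    have huv : ∀ i j, |u i * u j| ≤ u ⬝ᵥ u := fun i j => by
      rw [abs_le]
      constructor <;> nlinarith [huu i, huu j, sq_nonneg (u i + u j), sq_nonneg (u i - u j)]
    calc |u ⬝ᵥ (hess f x + jac v x) *ᵥ u|
        ≤ ∑ i, ∑ j, |(hess f x + jac v x) i j| * (u ⬝ᵥ u) := by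
          rw [dot_mulVec_eq_sum]
          refine (Finset.abs_sum_le_sum_abs _ _).trans (Finset.sum_le_sum fun i _ => ?_)
          refine (Finset.abs_sum_le_sum_abs _ _).trans (Finset.sum_le_sum fun j _ => ?_)
          rw [mul_assoc, abs_mul]
          exact mul_le_mul_of_nonneg_left (huv i j) (abs_nonneg _)
      _ = (∑ i, ∑ j, |(hess f x + jac v x) i j|) * (u ⬝ᵥ u) := by
          simp only [Finset.sum_mul]
      _ ≤ _ := mul_le_mul_of_nonneg_right h1
          (Finset.sum_nonneg fun i _ => mul_self_nonneg (u i))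
  obtain ⟨B, hB0, hB⟩ := hB
  refine ⟨min ε (l / (B + 1)), lt_min h.pos (by positivity), min_le_left _ _,
    fun s hs x u hu => ?_⟩
  by_cases hx : x ∈ Metric.closedBall (0 : Euc n) R
  · have huu : 0 < u ⬝ᵥ u := by
      simpa using dotProduct_star_self_pos_iff.2 hu
    have hs' : |s| < l / (B + 1) := hs.trans_le (min_le_right _ _)
    rw [lt_div_iff₀ (by positivity)] at hs'
    rw [add_mulVec, dotProduct_add, smul_mulVec, dotProduct_smul, smul_eq_mul]
    have h1 := hell x hx u
    have h2 : |s * (u ⬝ᵥ (hess f x + jac v x) *ᵥ u)| ≤ |s| * (B * (u ⬝ᵥ u)) := by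
      rw [abs_mul]
      exact mul_le_mul_of_nonneg_left (hB x hx u) (abs_nonneg s)
    have h3 := neg_abs_le (s * (u ⬝ᵥ (hess f x + jac v x) *ᵥ u))
    have h4 : |s| * (B + 1) * (u ⬝ᵥ u) < l * (u ⬝ᵥ u) := mul_lt_mul_of_pos_right hs' huu
    nlinarith [mul_nonneg (abs_nonneg s) huu.le]
  · have hj : jac v x = 0 := by
      ext i j
      rw [jac_apply]
      have hvz : v =ᶠ[𝓝 x] 0 := by
        have : x ∉ tsupport v := fun hmem => hx (hR hmem)
        exact notMem_tsupport_iff_eventuallyEq.1 this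
      have : (fun y => v y i) =ᶠ[𝓝 x] fun _ => 0 := by
        filter_upwards [hvz] with y hy
        rw [hy]
        rfl
      rw [pd, this.fderiv_eq]
      simp
    rw [hj, add_zero]
    simpa using (h.posDef (hs.trans_le (min_le_left _ _)) x).dotProduct_mulVec_pos hu

lemma integral_qpoly_eval (hn : 0 < n) (i : ℕ) (h : IsDeformation ε φ f κ D K)
    {v : Euc n → Euc n} (hv : ContDiff ℝ ∞ v) (hvc : HasCompactSupport v) :
    ∃ δ > 0, δ ≤ ε ∧ ∀ s, |s| < δ →
      Integrable (fun x => (qpoly i (hess φ x) (hess κ x) (hess f x + jac v x)).eval s) ∧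
      ∫ x, (qpoly i (hess φ x) (hess κ x) (hess f x + jac v x)).eval s = mv i (D s) K := by
  obtain ⟨δ, hδ, hδε, hq⟩ := h.exists_pos_quad hv hvc
  refine ⟨δ, hδ, hδε, fun s hs => ?_⟩
  have hs' := hs.trans_le hδε
  have hjs : ∀ x, jac (fun y => s • v y) x = s • jac v x := fun x => by
    ext a b
    have : (fun y => (s • v y) a) = fun y => s * (v y) a := rfl
    rw [jac_apply, this, pd_const_mul s (contDiff_differentiable (contDiff_coord hv a))]
    rfl
  have hM : ∀ x, hess (fun x => φ x + s * f x) x + jac (fun y => s • v y) x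
      = hess φ x + s • (hess f x + jac v x) := fun x => by
    rw [h.hess_eq, hjs, smul_add, add_assoc]
  have := integral_cmix hn i (h.isPotential s hs') (h.isBody s hs') h.isPotential_ref h.isBody_ref
    (v := fun y => s • v y) (hv.const_smul s) (hvc.mono (fun x hx => by
      contrapose! hx
      simp only [Function.mem_support, ne_eq, not_not] at hx ⊢
      simp [hx])) (fun x u hu => by rw [hM]; exact hq s hs x u hu)
  simpa only [hM, qpoly_eval] using this

lemma abs_lt_infinite {δ : ℝ} (hδ : 0 < δ) : {s : ℝ | |s| < δ}.Infinite := by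
  refine (Ioo_infinite (neg_lt_self hδ)).mono fun s hs => ?_
  exact abs_lt.2 hs

/-- Adding a compactly supported field does not change the integrated coefficients. -/
lemma integral_coeff_add (hn : 0 < n) (i : ℕ) (h : IsDeformation ε φ f κ D K)
    {v : Euc n → Euc n} (hv : ContDiff ℝ ∞ v) (hvc : HasCompactSupport v) (j : ℕ) :
    Integrable (fun x => (qpoly i (hess φ x) (hess κ x) (hess f x + jac v x)).coeff j) ∧
    Integrable (fun x => (qpoly i (hess φ x) (hess κ x) (hess f x)).coeff j) ∧
    ∫ x, (qpoly i (hess φ x) (hess κ x) (hess f x + jac v x)).coeff j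
      = ∫ x, (qpoly i (hess φ x) (hess κ x) (hess f x)).coeff j := by
  obtain ⟨δ, hδ, hδε, hI⟩ := h.integral_qpoly_eval hn i hv hvc
  obtain ⟨δ', hδ', hδε', hI'⟩ := h.integral_qpoly_eval hn i (v := fun _ => 0) contDiff_const
    HasCompactSupport.zero
  simp only [jac_zero, add_zero] at hI'
  have h1 := fun j => integrable_coeff (fun x => qpoly_natDegree_le_card i (hess φ x) (hess κ x)
    (hess f x + jac v x)) (abs_lt_infinite hδ) (fun s hs => (hI s hs).1) j
  have h2 := fun j => integrable_coeff (fun x => qpoly_natDegree_le_card i (hess φ x) (hess κ x)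
    (hess f x)) (abs_lt_infinite hδ') (fun s hs => (hI' s hs).1) j
  obtain ⟨P, -, hP, hPe⟩ := exists_integral_polynomial
    (fun x => qpoly_natDegree_le_card i (hess φ x) (hess κ x) (hess f x + jac v x)) h1
  obtain ⟨Q, -, hQ, hQe⟩ := exists_integral_polynomial
    (fun x => qpoly_natDegree_le_card i (hess φ x) (hess κ x) (hess f x)) h2
  refine ⟨h1 j, h2 j, ?_⟩
  rw [← hP, ← hQ]
  congr 1
  refine Polynomial.eq_of_infinite_eval_eq _ _ ((abs_lt_infinite (lt_min hδ hδ')).mono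
    fun s hs => ?_)
  have hs' : |s| < min δ δ' := hs
  show P.eval s = Q.eval s
  rw [hPe, hQe, (hI s (hs'.trans_le (min_le_left _ _))).2,
    (hI' s (hs'.trans_le (min_le_right _ _))).2]

end IsDeformation

lemma contDiff_det {m : ℕ} {A : Euc n → Matrix (Fin m) (Fin m) ℝ}
    (hA : ∀ i j, ContDiff ℝ ∞ fun x => A x i j) : ContDiff ℝ ∞ fun x => (A x).det := by
  simp only [det_apply]
  exact ContDiff.sum fun σ _ => (contDiff_prod fun i _ => hA _ _).const_smul _

lemma contDiff_gmat (i : ℕ) {M N : Euc n → Matrix (Fin n) (Fin n) ℝ}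
    (hM : ∀ i j, ContDiff ℝ ∞ fun x => M x i j) (hN : ∀ i j, ContDiff ℝ ∞ fun x => N x i j)
    (a b : Fin n) : ContDiff ℝ ∞ fun x => gmat i (M x) (N x) a b := by
  simp only [gmat, Matrix.sum_apply, Matrix.smul_apply, smul_eq_mul, adjugate_apply]
  refine ContDiff.sum fun k _ => contDiff_const.mul (contDiff_det fun c d => ?_)
  simp only [updateRow_apply]
  split_ifs
  · exact contDiff_const
  · exact (hM _ _).add (contDiff_const.mul (hN _ _))

lemma contDiff_cmix (i : ℕ) {M N : Euc n → Matrix (Fin n) (Fin n) ℝ}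
    (hM : ∀ i j, ContDiff ℝ ∞ fun x => M x i j) (hN : ∀ i j, ContDiff ℝ ∞ fun x => N x i j) :
    ContDiff ℝ ∞ fun x => cmix i (M x) (N x) := by
  simp only [cmix]
  exact ContDiff.sum fun k _ => contDiff_const.mul (contDiff_det fun c d =>
    (hM _ _).add (contDiff_const.mul (hN _ _)))

lemma trace_mul_nonneg {G P : Matrix (Fin n) (Fin n) ℝ} (hG : G.PosSemidef) (hP : P.PosSemidef) :
    0 ≤ (G * P).trace := by
  obtain ⟨B, rfl⟩ := exists_eq_conjTranspose_mul_self hP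
  rw [← Matrix.mul_assoc, trace_mul_comm, ← Matrix.mul_assoc]
  exact (hG.mul_mul_conjTranspose_same B).trace_nonneg

/-- For `M` positive definite, `(M x) (M x)ᵀ ≤ (xᵀ M x) M`. -/
lemma dot_mulVec_mulVec_le {G M : Matrix (Fin n) (Fin n) ℝ} (hG : G.PosSemidef)
    (hM : M.PosSemidef) (x : Fin n → ℝ) :
    (M *ᵥ x) ⬝ᵥ G *ᵥ (M *ᵥ x) ≤ (G * M).trace * (x ⬝ᵥ M *ᵥ x) := by
  have hMs : ∀ y z, y ⬝ᵥ M *ᵥ z = z ⬝ᵥ M *ᵥ y := fun y z => by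
    have h := hM.isHermitian.eq
    rw [conjTranspose_eq_transpose_of_trivial] at h
    rw [dotProduct_mulVec, ← mulVec_transpose, h, dotProduct_comm]
  have hP : ((x ⬝ᵥ M *ᵥ x) • M - vecMulVec (M *ᵥ x) (M *ᵥ x)).PosSemidef := by
    refine Matrix.PosSemidef.of_dotProduct_mulVec_nonneg ?_ fun y => ?_
    · ext a b
      have := hM.isHermitian.apply a b
      rw [star_trivial] at this
      simp [vecMulVec_apply, this, mul_comm]
    · rw [star_trivial, sub_mulVec, dotProduct_sub, smul_mulVec, dotProduct_smul, smul_eq_mul,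
        vecMulVec_mulVec, dotProduct_smul, op_smul_eq_smul, smul_eq_mul,
        dotProduct_comm (M *ᵥ x) y]
      have hq : ∀ t : ℝ, 0 ≤ (y ⬝ᵥ M *ᵥ y) * (t * t) + (2 * (y ⬝ᵥ M *ᵥ x)) * t + x ⬝ᵥ M *ᵥ x := by
        intro t
        have h0 : 0 ≤ (x + t • y) ⬝ᵥ M *ᵥ (x + t • y) := by
          simpa using hM.dotProduct_mulVec_nonneg (x + t • y)
        rw [mulVec_add, dotProduct_add, add_dotProduct, add_dotProduct, mulVec_smul,
          dotProduct_smul, dotProduct_smul, smul_dotProduct, smul_dotProduct, hMs x y] at h0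
        simp only [smul_eq_mul] at h0
        nlinarith
      have := discrim_le_zero hq
      rw [discrim] at this
      nlinarith
  have := trace_mul_nonneg hG hP
  rw [Matrix.mul_sub, trace_sub, Matrix.mul_smul, trace_smul, trace_mul_vecMulVec,
    smul_eq_mul] at this
  linarith

namespace IsDeformation

variable {ε : ℝ} {φ f κ : Euc n → ℝ} {D : ℝ → Set (Euc n)} {K : Set (Euc n)} {i : ℕ}

lemma posDef_zero (h : IsDeformation ε φ f κ D K) (x : Euc n) : (hess φ x).PosDef :=
  h.isPotential_zero.posDef x

lemma posDef_ref (h : IsDeformation ε φ f κ D K) (x : Euc n) : (hess κ x).PosDef :=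
  h.isPotential_ref.posDef x

lemma contDiff_G (h : IsDeformation ε φ f κ D K) (a b : Fin n) :
    ContDiff ℝ ∞ fun x => gmat i (hess φ x) (hess κ x) a b :=
  contDiff_gmat i (contDiff_hess h.contDiff_left) (contDiff_hess h.isPotential_ref.contDiff) a b

lemma continuous_rho (h : IsDeformation ε φ f κ D K) :
    Continuous fun x => cmix i (hess φ x) (hess κ x) :=
  (contDiff_cmix i (contDiff_hess h.contDiff_left)
    (contDiff_hess h.isPotential_ref.contDiff)).continuous

lemma integrable_rho (hn : 0 < n) (h : IsDeformation ε φ f κ D K) :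
    Integrable fun x => cmix i (hess φ x) (hess κ x) := by
  have := (h.integral_coeff_add hn i (v := fun _ => 0) contDiff_const HasCompactSupport.zero 0).2.1
  simpa only [qpoly_coeff_zero] using this

lemma integrable_trace (hn : 0 < n) (h : IsDeformation ε φ f κ D K) :
    Integrable fun x => (gmat i (hess φ x) (hess κ x) * hess f x).trace := by
  have := (h.integral_coeff_add hn i (v := fun _ => 0) contDiff_const HasCompactSupport.zero 1).2.1
  simpa only [qpoly_coeff_one i (h.posDef_zero _) (h.posDef_ref _)] using this

lemma integral_trace_jac (hn : 0 < n) (h : IsDeformation ε φ f κ D K)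
    {v : Euc n → Euc n} (hv : ContDiff ℝ ∞ v) (hvc : HasCompactSupport v) :
    Integrable (fun x => (gmat i (hess φ x) (hess κ x) * jac v x).trace) ∧
      ∫ x, (gmat i (hess φ x) (hess κ x) * jac v x).trace = 0 := by
  obtain ⟨h1, h2, h3⟩ := h.integral_coeff_add hn i hv hvc 1
  simp only [qpoly_coeff_one i (h.posDef_zero _) (h.posDef_ref _), Matrix.mul_add,
    trace_add] at h1 h2 h3
  have h4 : Integrable fun x => (gmat i (hess φ x) (hess κ x) * jac v x).trace := by
    refine (h1.sub h2).congr (Eventually.of_forall fun x => ?_)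
    simp
  refine ⟨h4, ?_⟩
  rw [integral_add h2 h4] at h3
  linarith

lemma div_eq_zero (hn : 0 < n) (h : IsDeformation ε φ f κ D K) (x : Euc n) (b : Fin n) :
    ∑ a, pd a (fun y => gmat i (hess φ y) (hess κ y) a b) x = 0 := by
  have hc : Continuous fun x => ∑ a, pd a (fun y => gmat i (hess φ y) (hess κ y) a b) x :=
    continuous_finsetSum _ fun a _ => (contDiff_pd (h.contDiff_G a b) a).continuous
  have hae := ae_eq_zero_of_integral_contDiff_smul_eq_zero (μ := (volume : Measure (Euc n)))
    hc.locallyIntegrable fun ψ hψ hψc => by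
      have hv : ContDiff ℝ ∞ fun y => ψ y • EuclideanSpace.single b (1 : ℝ) :=
        hψ.smul contDiff_const
      have hvc : HasCompactSupport fun y => ψ y • EuclideanSpace.single b (1 : ℝ) :=
        hψc.smul_right
      have hJ : ∀ x, jac (fun y => ψ y • EuclideanSpace.single b (1 : ℝ)) x
          = vecMulVec (Pi.single b 1) (fun j => pd j ψ x) := by
        intro x
        ext c d
        have : (fun y => (ψ y • EuclideanSpace.single b (1 : ℝ)) c)
            = fun y => (Pi.single b 1 : Fin n → ℝ) c * ψ y := by
          ext y
          simp [mul_comm, Pi.single_apply]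
        rw [jac_apply, this, pd_const_mul _ (contDiff_differentiable hψ)]
        rfl
      have h0 := (h.integral_trace_jac (i := i) hn hv hvc).2
      simp only [hJ, trace_mul_vecMulVec, mulVec_single_one, dotProduct, Matrix.col_apply] at h0
      have hI : ∀ a, Integrable fun x => gmat i (hess φ x) (hess κ x) a b * pd a ψ x := fun a =>
        ((h.contDiff_G a b).continuous.mul
          (contDiff_pd hψ a).continuous).integrable_of_hasCompactSupport
          (pd_hasCompactSupport hψc a).mul_left
      have hI' : ∀ a, Integrable fun x =>
          ψ x * pd a (fun y => gmat i (hess φ y) (hess κ y) a b) x := fun a =>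
        (hψ.continuous.mul
          (contDiff_pd (h.contDiff_G a b) a).continuous).integrable_of_hasCompactSupport
          hψc.mul_right
      simp only [smul_eq_mul, Finset.mul_sum]
      rw [integral_finsetSum _ fun a _ => hI' a]
      simp only [mul_comm (pd _ ψ _)] at h0
      rw [integral_finsetSum _ fun a _ => hI a] at h0
      simp only [integral_mul_pd (h.contDiff_G _ b) hψ hψc, Finset.sum_neg_distrib] at h0
      linarith
  exact congrFun ((hc.ae_eq_iff_eq volume continuous_const).1 hae) x

lemma abs_trace_le (hi : i < n) (h : IsDeformation ε φ f κ D K) (x : Euc n) :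
    |(gmat i (hess φ x) (hess κ x) * hess f x).trace|
      ≤ 2 / ε * (((n : ℝ) - i) * cmix i (hess φ x) (hess κ x)) := by
  have hε := h.pos
  have hG := (gmat_posDef hi (h.posDef_zero x) (h.posDef_ref x)).posSemidef
  have key : ∀ s : ℝ, |s| < ε → 0 ≤ (((n : ℝ) - i) * cmix i (hess φ x) (hess κ x))
      + s * (gmat i (hess φ x) (hess κ x) * hess f x).trace := fun s hs => by
    have := trace_mul_nonneg hG (h.posDef hs x).posSemidef
    rwa [Matrix.mul_add, trace_add, trace_gmat_mul_self i (h.posDef_zero x) (h.posDef_ref x),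
      Matrix.mul_smul, trace_smul, smul_eq_mul] at this
  have h1 := key (ε / 2) (by rw [abs_of_pos (by positivity)]; linarith)
  have h2 := key (-(ε / 2)) (by rw [abs_neg, abs_of_pos (by positivity)]; linarith)
  rw [abs_le, div_mul_eq_mul_div, ← neg_div, le_div_iff₀ hε, div_le_iff₀ hε]
  constructor <;> linarith

/-- The cutoffs needed for the Liouville theorem. -/
lemma exists_cutoff (hi : i < n) (h : IsDeformation ε φ f κ D K) :
    ∃ c : ℝ, 0 ≤ c ∧ ∀ r T : ℝ, 0 < T → ∃ χ : Euc n → ℝ, ContDiff ℝ ∞ χ ∧ HasCompactSupport χ ∧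
      (∀ x ∈ Metric.closedBall (0 : Euc n) r, χ x = 1) ∧
      ∀ x, (fun i => pd i χ x) ⬝ᵥ gmat i (hess φ x) (hess κ x) *ᵥ (fun i => pd i χ x)
        ≤ c / T ^ 2 * cmix i (hess φ x) (hess κ x) := by
  have hφ := h.isPotential_zero
  obtain ⟨c₀, hc₀⟩ := hφ.hess_radial_le
  set θ : ℝ → ℝ := fun t => Real.smoothTransition (2 - t) with hθdef
  have hθ : ContDiff ℝ ∞ θ := Real.smoothTransition.contDiff.comp (contDiff_const.sub contDiff_id)
  have hθd : Continuous (deriv θ) := hθ.continuous_deriv (by simp)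
  have hθ0 : ∀ t, 2 < t → deriv θ t = 0 := fun t ht => by
    have : θ =ᶠ[𝓝 t] fun _ => 0 := by
      filter_upwards [lt_mem_nhds ht] with s hs
      exact Real.smoothTransition.zero_of_nonpos (by linarith)
    rw [this.deriv_eq, deriv_const]
  have hθ1 : ∀ t, t < 1 → deriv θ t = 0 := fun t ht => by
    have : θ =ᶠ[𝓝 t] fun _ => 1 := by
      filter_upwards [gt_mem_nhds ht] with s hs
      exact Real.smoothTransition.one_of_one_le (by linarith)
    rw [this.deriv_eq, deriv_const]
  obtain ⟨L, hL⟩ := (isCompact_Icc (a := (1 : ℝ)) (b := 2)).exists_bound_of_continuousOn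
    hθd.continuousOn
  have hLb : ∀ t, deriv θ t ^ 2 ≤ L ^ 2 := fun t => by
    by_cases ht : t ∈ Icc (1 : ℝ) 2
    · rw [← sq_abs]
      exact pow_le_pow_left₀ (abs_nonneg _) (hL t ht) 2
    · have : deriv θ t = 0 := by
        rw [mem_Icc, not_and_or, not_le, not_le] at ht
        exact ht.elim (hθ1 t) (hθ0 t)
      rw [this]
      nlinarith [sq_nonneg L]
  set ξ : Euc n → ℝ := fun x => (∑ i, x i * pd i φ x) - φ x with hξdef
  have hcoord : ∀ i : Fin n, ContDiff ℝ ∞ fun x : Euc n => x i := fun i =>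
    (EuclideanSpace.proj i : Euc n →L[ℝ] ℝ).contDiff
  have hsum : ContDiff ℝ ∞ fun x : Euc n => ∑ i, x i * pd i φ x :=
    ContDiff.sum fun i _ => (hcoord i).mul (contDiff_pd hφ.contDiff i)
  have hξ : ContDiff ℝ ∞ ξ := hsum.sub hφ.contDiff
  have hξd : ∀ j x, pd j ξ x = (hess φ x *ᵥ x.ofLp) j := by
    intro j x
    rw [hξdef, pd_sub (contDiff_differentiable hsum) (contDiff_differentiable hφ.contDiff),
      pd_sum _ fun i => contDiff_differentiable ((hcoord i).mul (contDiff_pd hφ.contDiff i))]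
    simp only [pd_mul (contDiff_differentiable (hcoord _))
      (contDiff_differentiable (contDiff_pd hφ.contDiff _)), pd_coord, Finset.sum_add_distrib,
      mul_ite, mul_one, mul_zero, Finset.sum_ite_eq, Finset.mem_univ, if_true, mulVec, dotProduct]
    rw [add_sub_cancel_right]
    refine Finset.sum_congr rfl fun a _ => ?_
    have := (hess_symm hφ.contDiff x).apply a j
    rw [star_trivial] at this
    rw [← hess_apply, ← this, mul_comm]
  refine ⟨L ^ 2 * (((n : ℝ) - i) * |c₀|), ?_, fun r T hT => ?_⟩
  · have : (i : ℝ) < n := by exact_mod_cast hi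
    exact mul_nonneg (sq_nonneg _) (mul_nonneg (by linarith) (abs_nonneg _))
  obtain ⟨B, hB⟩ := (isCompact_closedBall (0 : Euc n) r).exists_bound_of_continuousOn
    hξ.continuous.continuousOn
  set R := max T B with hR
  have hR0 : 0 < R := hT.trans_le (le_max_left _ _)
  have hζ : ContDiff ℝ ∞ fun x => R⁻¹ * ξ x := contDiff_const.mul hξ
  refine ⟨fun x => θ (R⁻¹ * ξ x), hθ.comp hζ, ?_, fun x hx => ?_, fun x => ?_⟩
  · have := hφ.tendsto_legendre.eventually (eventually_gt_atTop (2 * R))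
    rw [Filter.Eventually, mem_cocompact] at this
    obtain ⟨S, hS, hS'⟩ := this
    refine HasCompactSupport.intro hS fun x hx => ?_
    have hx' : 2 * R < ξ x := hS' hx
    refine Real.smoothTransition.zero_of_nonpos ?_
    rw [sub_nonpos, inv_mul_eq_div, le_div_iff₀ hR0]
    exact hx'.le
  · refine Real.smoothTransition.one_of_one_le ?_
    have : ξ x ≤ R := (le_abs_self _).trans ((hB x hx).trans (le_max_right _ _))
    have : R⁻¹ * ξ x ≤ 1 := by rwa [inv_mul_le_one₀ hR0]
    linarith
  · have hχd : (fun j => pd j (fun x => θ (R⁻¹ * ξ x)) x)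
        = (deriv θ (R⁻¹ * ξ x) * R⁻¹) • (hess φ x *ᵥ x.ofLp) := by
      ext j
      rw [pd_comp (hθ.differentiable (by simp)) (contDiff_differentiable hζ),
        pd_const_mul _ (contDiff_differentiable hξ), Pi.smul_apply, smul_eq_mul, ← hξd j x]
      ring
    rw [hχd, mulVec_smul, dotProduct_smul, smul_dotProduct, smul_eq_mul, smul_eq_mul, ← mul_assoc,
      ← sq, mul_pow]
    have h1 := dot_mulVec_mulVec_le (gmat_posDef hi (h.posDef_zero x) (h.posDef_ref x)).posSemidef
      (h.posDef_zero x).posSemidef x.ofLp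
    rw [trace_gmat_mul_self i (h.posDef_zero x) (h.posDef_ref x)] at h1
    have hρ := (cmix_pos hi.le (h.posDef_zero x) (h.posDef_ref x)).le
    have hm : 0 ≤ (n : ℝ) - i := by
      have : (i : ℝ) < n := by exact_mod_cast hi
      linarith
    have h2 : (hess φ x *ᵥ x.ofLp) ⬝ᵥ gmat i (hess φ x) (hess κ x) *ᵥ hess φ x *ᵥ x.ofLp
        ≤ ((n : ℝ) - i) * cmix i (hess φ x) (hess κ x) * |c₀| :=
      h1.trans (mul_le_mul_of_nonneg_left ((hc₀ x).trans (le_abs_self _)) (mul_nonneg hm hρ))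
    have h3 : R⁻¹ ^ 2 ≤ (T ^ 2)⁻¹ := by
      rw [inv_pow]
      exact inv_anti₀ (by positivity) (pow_le_pow_left₀ hT.le (le_max_left _ _) 2)
    calc deriv θ (R⁻¹ * ξ x) ^ 2 * R⁻¹ ^ 2 *
          ((hess φ x *ᵥ x.ofLp) ⬝ᵥ gmat i (hess φ x) (hess κ x) *ᵥ hess φ x *ᵥ x.ofLp)
        ≤ L ^ 2 * (T ^ 2)⁻¹ * (((n : ℝ) - i) * cmix i (hess φ x) (hess κ x) * |c₀|) := by
          refine (mul_le_mul_of_nonneg_left h2 (by positivity)).trans ?_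
          refine mul_le_mul_of_nonneg_right ?_ (by positivity)
          exact mul_le_mul (hLb _) h3 (by positivity) (by positivity)
      _ = _ := by
          field_simp

end IsDeformation

lemma exists_norm_sq_add_le {H : Type*} [NormedAddCommGroup H] [InnerProductSpace ℝ H]
    [CompleteSpace H] {W : Submodule ℝ H} {e : H} (he : e ≠ 0)
    (hW : ∀ k ∈ Wᗮ, ∃ c : ℝ, k = c • e) (a : H) {δ : ℝ} (hδ : 0 < δ) :
    ∃ w ∈ W, ‖a + w‖ ^ 2 ≤ inner ℝ a e ^ 2 / ‖e‖ ^ 2 + δ := by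
  have he' : ‖e‖ ≠ 0 := norm_ne_zero_iff.2 he
  set c := inner ℝ a e / ‖e‖ ^ 2 with hc
  have hmem : c • e - a ∈ Wᗮᗮ := by
    intro k hk
    obtain ⟨d, rfl⟩ := hW k hk
    rw [inner_smul_left, inner_sub_right, inner_smul_right, real_inner_self_eq_norm_sq,
      real_inner_comm, hc]
    field_simp
    simp
  rw [Submodule.orthogonal_orthogonal_eq_closure, ← SetLike.mem_coe,
    Submodule.topologicalClosure_coe, mem_closure_iff] at hmem
  have hopen : IsOpen {w : H | ‖a + w‖ ^ 2 < inner ℝ a e ^ 2 / ‖e‖ ^ 2 + δ} :=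
    isOpen_lt (by fun_prop) continuous_const
  obtain ⟨w, hw, hwW⟩ := hmem _ hopen (by
    show ‖a + (c • e - a)‖ ^ 2 < _
    have : ‖a + (c • e - a)‖ ^ 2 = inner ℝ a e ^ 2 / ‖e‖ ^ 2 := by
      rw [add_sub_cancel, norm_smul, mul_pow, Real.norm_eq_abs, sq_abs, hc]
      field_simp
    rw [this]
    linarith)
  exact ⟨w, hwW, le_of_lt hw⟩

lemma Lp_two_norm_sq {α : Type*} [MeasurableSpace α] {μ : Measure α} (F : Lp ℝ 2 μ) {f : α → ℝ}
    (h : F =ᵐ[μ] f) : ‖F‖ ^ 2 = ∫ x, f x ^ 2 ∂μ := by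
  rw [← real_inner_self_eq_norm_sq, L2.inner_def]
  refine integral_congr_ae ?_
  filter_upwards [h] with x hx
  rw [hx]
  simp [sq]

lemma Lp_two_inner {α : Type*} [MeasurableSpace α] {μ : Measure α} {F G : Lp ℝ 2 μ} {f g : α → ℝ}
    (h : F =ᵐ[μ] f) (h' : G =ᵐ[μ] g) : inner ℝ F G = ∫ x, f x * g x ∂μ := by
  rw [L2.inner_def]
  refine integral_congr_ae ?_
  filter_upwards [h, h'] with x hx hx'
  rw [hx, hx']
  simp [mul_comm]

namespace IsDeformation

variable {ε : ℝ} {φ f κ : Euc n → ℝ} {D : ℝ → Set (Euc n)} {K : Set (Euc n)} {i : ℕ}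

/-- An `L²` function orthogonal to the image of `g ↦ tr (G hess g) / √ρ` is a multiple
of `√ρ`. -/
lemma ae_eq_const_mul_sqrt (hi : i < n) (h : IsDeformation ε φ f κ D K) {k : Euc n → ℝ}
    (hkm : Measurable k) (hk : MemLp k 2)
    (horth : ∀ g, ContDiff ℝ ∞ g → HasCompactSupport g →
      ∫ x, k x * ((gmat i (hess φ x) (hess κ x) * hess g x).trace
        / √(cmix i (hess φ x) (hess κ x))) = 0) :
    ∃ c, k =ᵐ[volume] fun x => c * √(cmix i (hess φ x) (hess κ x)) := by
  have hn : 0 < n := by omega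
  have hρ : ∀ x, 0 < cmix i (hess φ x) (hess κ x) := fun x =>
    cmix_pos hi.le (h.posDef_zero x) (h.posDef_ref x)
  have hρc := h.continuous_rho (i := i)
  have hcont : Continuous fun x => (√(cmix i (hess φ x) (hess κ x)))⁻¹ :=
    hρc.sqrt.inv₀ fun x => (Real.sqrt_pos.2 (hρ x)).ne'
  have hk2 : Integrable fun x => k x ^ 2 := hk.integrable_sq
  have hm : Measurable fun x => k x * (√(cmix i (hess φ x) (hess κ x)))⁻¹ :=
    hkm.mul hcont.measurable
  have hsq : ∀ x, (k x * (√(cmix i (hess φ x) (hess κ x)))⁻¹) ^ 2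
      * cmix i (hess φ x) (hess κ x) = k x ^ 2 := fun x => by
    rw [mul_pow, inv_pow, Real.sq_sqrt (hρ x).le, mul_assoc, inv_mul_cancel₀ (hρ x).ne', mul_one]
  obtain ⟨c, hc⟩ := ae_const_of_weak_solution (h.contDiff_G (i := i))
    (fun x => gmat_posDef hi (h.posDef_zero x) (h.posDef_ref x)) (h.div_eq_zero hn)
    (h := fun x => k x * (√(cmix i (hess φ x) (hess κ x)))⁻¹) hm (fun R => by
      rw [memLp_indicator_iff_restrict measurableSet_closedBall,
        memLp_two_iff_integrable_sq hm.aestronglyMeasurable]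
      have := (hk2.integrableOn (s := Metric.closedBall 0 R)).mul_continuousOn
        (hcont.pow 2).continuousOn (isCompact_closedBall _ _)
      refine this.congr (Eventually.of_forall fun x => ?_)
      simp [mul_pow])
    (fun g hg hgc => by
      rw [← horth g hg hgc]
      congr 1
      ext x
      have : (gmat i (hess φ x) (hess κ x) * hess g x).trace
          = ∑ a, ∑ b, gmat i (hess φ x) (hess κ x) a b * hess g x a b := by
        simp only [Matrix.trace, diag_apply, Matrix.mul_apply]
        refine Finset.sum_congr rfl fun a _ => Finset.sum_congr rfl fun b _ => ?_
        have := (hess_symm hg x).apply a b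
        rw [star_trivial] at this
        rw [this]
      rw [this]
      ring)
    (fun r δ hδ => by
      obtain ⟨c, hc0, hc⟩ := h.exists_cutoff hi
      set Q := ∫ x, k x ^ 2
      have hQ : 0 ≤ Q := integral_nonneg fun x => sq_nonneg _
      set T := √((c * Q + 1) / δ) with hT
      have hT0 : 0 < T := Real.sqrt_pos.2 (by positivity)
      obtain ⟨χ, hχ, hχc, hχ1, hχ2⟩ := hc r T hT0
      refine ⟨χ, hχ, hχc, hχ1, ?_⟩
      calc ∫ x, (k x * (√(cmix i (hess φ x) (hess κ x)))⁻¹) ^ 2 * ((fun i => pd i χ x) ⬝ᵥ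
            gmat i (hess φ x) (hess κ x) *ᵥ (fun i => pd i χ x))
          ≤ ∫ x, c / T ^ 2 * k x ^ 2 := by
            refine integral_mono_of_nonneg (Eventually.of_forall fun x => ?_) (hk2.const_mul _)
              (Eventually.of_forall fun x => ?_)
            · refine mul_nonneg (sq_nonneg _) ?_
              simpa using (gmat_posDef hi (h.posDef_zero x)
                (h.posDef_ref x)).posSemidef.dotProduct_mulVec_nonneg (fun i => pd i χ x)
            · refine (mul_le_mul_of_nonneg_left (hχ2 x) (sq_nonneg _)).trans (le_of_eq ?_)
              rw [mul_left_comm, hsq]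
        _ = c / T ^ 2 * Q := integral_const_mul _ _
        _ ≤ δ := by
            rw [hT, Real.sq_sqrt (by positivity), div_div_eq_mul_div, div_mul_eq_mul_div,
              div_le_iff₀ (by positivity)]
            nlinarith)
  refine ⟨c, ?_⟩
  filter_upwards [hc] with x hx
  rw [← hx, mul_assoc, inv_mul_cancel₀ (Real.sqrt_pos.2 (hρ x)).ne', mul_one]

lemma memLp_div_sqrt (h : IsDeformation ε φ f κ D K) (hi : i < n) {t : Euc n → ℝ}
    (ht : Continuous t) {b : Euc n → ℝ} (hb : Integrable b)
    (htb : ∀ x, t x ^ 2 / cmix i (hess φ x) (hess κ x) ≤ b x) :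
    MemLp (fun x => t x / √(cmix i (hess φ x) (hess κ x))) 2 := by
  have hρ : ∀ x, 0 < cmix i (hess φ x) (hess κ x) := fun x =>
    cmix_pos hi.le (h.posDef_zero x) (h.posDef_ref x)
  have hc : Continuous fun x => t x / √(cmix i (hess φ x) (hess κ x)) :=
    ht.div (h.continuous_rho).sqrt fun x => (Real.sqrt_pos.2 (hρ x)).ne'
  rw [memLp_two_iff_integrable_sq hc.aestronglyMeasurable]
  refine hb.mono' (hc.pow 2).aestronglyMeasurable (Eventually.of_forall fun x => ?_)
  rw [Real.norm_eq_abs, abs_of_nonneg (sq_nonneg _), div_pow, Real.sq_sqrt (hρ x).le]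
  exact htb x

lemma continuous_trace (h : IsDeformation ε φ f κ D K) {g : Euc n → ℝ} (hg : ContDiff ℝ ∞ g) :
    Continuous fun x => (gmat i (hess φ x) (hess κ x) * hess g x).trace := by
  have h1 : Continuous fun x => gmat i (hess φ x) (hess κ x) :=
    continuous_matrix fun a b => (h.contDiff_G a b).continuous
  have h2 : Continuous fun x => hess g x :=
    continuous_matrix fun a b => (contDiff_hess hg a b).continuous
  exact (h1.matrix_mul h2).matrix_trace

lemma hess_eq_zero_of_notMem {g : Euc n → ℝ} {x : Euc n} (hx : x ∉ tsupport g) : hess g x = 0 := by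
  ext a b
  show pd b (pd a g) x = 0
  exact image_eq_zero_of_notMem_tsupport fun hmem =>
    hx (tsupport_pd_subset g a (tsupport_pd_subset (pd a g) b hmem))

lemma memLp_trace_div_sqrt (h : IsDeformation ε φ f κ D K) (hi : i < n) {g : Euc n → ℝ}
    (hg : ContDiff ℝ ∞ g) (hgc : HasCompactSupport g) :
    MemLp (fun x => (gmat i (hess φ x) (hess κ x) * hess g x).trace
      / √(cmix i (hess φ x) (hess κ x))) 2 := by
  have hρ : ∀ x, 0 < cmix i (hess φ x) (hess κ x) := fun x =>
    cmix_pos hi.le (h.posDef_zero x) (h.posDef_ref x)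
  refine h.memLp_div_sqrt hi (h.continuous_trace hg) (b := fun x =>
    (gmat i (hess φ x) (hess κ x) * hess g x).trace ^ 2 / cmix i (hess φ x) (hess κ x)) ?_
    fun x => le_rfl
  refine Continuous.integrable_of_hasCompactSupport
    (((h.continuous_trace hg).pow 2).div h.continuous_rho fun x => (hρ x).ne')
    (HasCompactSupport.intro hgc fun x hx => ?_)
  rw [hess_eq_zero_of_notMem hx]
  simp

lemma integral_rho_pos (hi : i < n) (h : IsDeformation ε φ f κ D K) :
    0 < ∫ x, cmix i (hess φ x) (hess κ x) := by
  have hρ : ∀ x, 0 < cmix i (hess φ x) (hess κ x) := fun x =>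
    cmix_pos hi.le (h.posDef_zero x) (h.posDef_ref x)
  rw [integral_pos_iff_support_of_nonneg (fun x => (hρ x).le) (h.integrable_rho (by omega))]
  have : (Function.support fun x => cmix i (hess φ x) (hess κ x)) = univ :=
    eq_univ_of_forall fun x => (hρ x).ne'
  rw [this]
  exact isOpen_univ.measure_pos _ univ_nonempty

theorem integral_newton (hi : i < n) (h : IsDeformation ε φ f κ D K) :
    2 * (∫ x, cmix i (hess φ x) (hess κ x))
        * (∫ x, (qpoly i (hess φ x) (hess κ x) (hess f x)).coeff 2)
      ≤ (1 - 1 / ((n : ℝ) - i))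
        * (∫ x, (gmat i (hess φ x) (hess κ x) * hess f x).trace) ^ 2 := by
  have hn : 0 < n := by omega
  have hε := h.pos
  have hm1 : 1 ≤ (n : ℝ) - i := by
    have : (i : ℝ) + 1 ≤ n := by exact_mod_cast hi
    linarith
  have hρ : ∀ x, 0 < cmix i (hess φ x) (hess κ x) := fun x =>
    cmix_pos hi.le (h.posDef_zero x) (h.posDef_ref x)
  set I0 := ∫ x, cmix i (hess φ x) (hess κ x) with hI0
  set I1 := ∫ x, (gmat i (hess φ x) (hess κ x) * hess f x).trace with hI1
  set I2 := ∫ x, (qpoly i (hess φ x) (hess κ x) (hess f x)).coeff 2 with hI2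
  have hI0pos : 0 < I0 := h.integral_rho_pos hi
  have hea : MemLp (fun x => √(cmix i (hess φ x) (hess κ x))) 2 := by
    rw [memLp_two_iff_integrable_sq h.continuous_rho.sqrt.aestronglyMeasurable]
    refine (h.integrable_rho hn (i := i)).congr (Eventually.of_forall fun x => ?_)
    exact (Real.sq_sqrt (hρ x).le).symm
  have haa : MemLp (fun x => (gmat i (hess φ x) (hess κ x) * hess f x).trace
      / √(cmix i (hess φ x) (hess κ x))) 2 := by
    refine h.memLp_div_sqrt hi (h.continuous_trace h.contDiff_right)
      ((h.integrable_rho hn (i := i)).const_mul ((2 / ε * ((n : ℝ) - i)) ^ 2)) fun x => ?_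
    rw [div_le_iff₀ (hρ x), ← sq_abs]
    refine (pow_le_pow_left₀ (abs_nonneg _) (h.abs_trace_le hi x) 2).trans (le_of_eq ?_)
    ring
  set e : Lp ℝ 2 (volume : Measure (Euc n)) := hea.toLp _ with he
  set a : Lp ℝ 2 (volume : Measure (Euc n)) := haa.toLp _ with ha
  have hee := hea.coeFn_toLp
  have haae := haa.coeFn_toLp
  have hnorm : ‖e‖ ^ 2 = I0 := by
    rw [Lp_two_norm_sq e hee]
    simp only [Real.sq_sqrt (hρ _).le, hI0]
  have hinner : inner ℝ a e = I1 := by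
    rw [Lp_two_inner haae hee]
    simp only [div_mul_cancel₀ _ (Real.sqrt_pos.2 (hρ _)).ne', hI1]
  have he0 : e ≠ 0 := fun h0 => by
    rw [h0] at hnorm
    simp at hnorm
    exact hI0pos.ne hnorm
  let W : Submodule ℝ (Lp ℝ 2 (volume : Measure (Euc n))) :=
    { carrier := {w | ∃ g : Euc n → ℝ, ContDiff ℝ ∞ g ∧ HasCompactSupport g ∧
        w =ᵐ[volume] fun x => (gmat i (hess φ x) (hess κ x) * hess g x).trace
          / √(cmix i (hess φ x) (hess κ x))}
      add_mem' := by
        rintro w w' ⟨g, hg, hgc, hw⟩ ⟨g', hg', hgc', hw'⟩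
        refine ⟨fun x => g x + g' x, hg.add hg', hgc.add hgc', ?_⟩
        filter_upwards [hw, hw', Lp.coeFn_add w w'] with x h1 h2 h3
        rw [h3, Pi.add_apply, h1, h2, hess_add hg hg', Matrix.mul_add, trace_add, add_div]
      zero_mem' := by
        refine ⟨fun _ => 0, contDiff_const, HasCompactSupport.zero, ?_⟩
        filter_upwards [Lp.coeFn_zero ℝ 2 (volume : Measure (Euc n))] with x hx
        have : hess (fun _ : Euc n => (0 : ℝ)) x = 0 := by
          ext a b
          rw [hess_apply, pd_const, pd_const]
          rfl
        rw [hx, this]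
        simp
      smul_mem' := by
        rintro c w ⟨g, hg, hgc, hw⟩
        refine ⟨fun x => c * g x, contDiff_const.mul hg, hgc.mul_left, ?_⟩
        filter_upwards [hw, Lp.coeFn_smul c w] with x h1 h2
        rw [h2, Pi.smul_apply, h1, hess_const_mul c hg, Matrix.mul_smul, trace_smul, smul_eq_mul,
          smul_eq_mul, mul_div_assoc] }
  have hW : ∀ k ∈ Wᗮ, ∃ c : ℝ, k = c • e := by
    intro k hk
    obtain ⟨c, hc⟩ := h.ae_eq_const_mul_sqrt hi (Lp.stronglyMeasurable k).measurable (Lp.memLp k)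
      fun g hg hgc => by
        have hgm := h.memLp_trace_div_sqrt hi hg hgc (i := i)
        have hmem : hgm.toLp _ ∈ W := ⟨g, hg, hgc, hgm.coeFn_toLp⟩
        have := (Submodule.mem_orthogonal' W k).1 hk _ hmem
        rwa [Lp_two_inner (ae_eq_refl _) hgm.coeFn_toLp] at this
    refine ⟨c, Lp.ext ?_⟩
    filter_upwards [hc, hee, Lp.coeFn_smul c e] with x h1 h2 h3
    rw [h1, h3, Pi.smul_apply, h2, smul_eq_mul]
  have hkey : ∀ δ : ℝ, 0 < δ → I2 ≤ (1 - 1 / ((n : ℝ) - i)) / 2 * (I1 ^ 2 / I0 + δ) := by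
    intro δ hδ
    obtain ⟨w, ⟨g, hg, hgc, hw⟩, hle⟩ := exists_norm_sq_add_le he0 hW a hδ
    rw [hinner, hnorm] at hle
    have hgrdc : HasCompactSupport (grd g) := by
      refine HasCompactSupport.intro hgc fun x hx => ?_
      ext a
      show pd a g x = 0
      exact image_eq_zero_of_notMem_tsupport fun hmem => hx (tsupport_pd_subset g a hmem)
    obtain ⟨hi2, -, hI2'⟩ := h.integral_coeff_add hn i (contDiff_grd hg) hgrdc 2
    rw [jac_grd] at hi2 hI2'
    set t : Euc n → ℝ := fun x => (gmat i (hess φ x) (hess κ x) * (hess f x + hess g x)).trace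
      / √(cmix i (hess φ x) (hess κ x)) with ht
    have haw : ⇑(a + w) =ᵐ[volume] t := by
      filter_upwards [haae, hw, Lp.coeFn_add a w] with x h1 h2 h3
      rw [h3, Pi.add_apply, h1, h2]
      simp only [ht, Matrix.mul_add, trace_add, add_div]
    have hti : Integrable fun x => t x ^ 2 :=
      ((memLp_congr_ae haw).1 (Lp.memLp (a + w))).integrable_sq
    rw [Lp_two_norm_sq _ haw] at hle
    calc I2 = ∫ x, (qpoly i (hess φ x) (hess κ x) (hess f x + hess g x)).coeff 2 := hI2'.symm
      _ ≤ ∫ x, (1 - 1 / ((n : ℝ) - i)) / 2 * t x ^ 2 := by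
          refine integral_mono hi2 (hti.const_mul _) fun x => ?_
          have := qpoly_newton hi (h.posDef_zero x) (h.posDef_ref x)
            ((hess_symm h.contDiff_right x).add (hess_symm hg x))
          show _ ≤ _ * t x ^ 2
          simp only [ht]
          rw [div_pow, Real.sq_sqrt (hρ x).le, ← mul_div_assoc, le_div_iff₀ (hρ x)]
          linarith
      _ = (1 - 1 / ((n : ℝ) - i)) / 2 * ∫ x, t x ^ 2 := integral_const_mul _ _
      _ ≤ _ := by
          refine mul_le_mul_of_nonneg_left hle ?_
          have : 1 / ((n : ℝ) - i) ≤ 1 := by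
            rw [div_le_one (by linarith)]
            exact hm1
          linarith
  have hlim : I2 ≤ (1 - 1 / ((n : ℝ) - i)) / 2 * (I1 ^ 2 / I0) := by
    have hc : Tendsto (fun δ : ℝ => (1 - 1 / ((n : ℝ) - i)) / 2 * (I1 ^ 2 / I0 + δ)) (𝓝[>] 0)
        (𝓝 ((1 - 1 / ((n : ℝ) - i)) / 2 * (I1 ^ 2 / I0 + 0))) :=
      ((tendsto_const_nhds.add tendsto_id).const_mul _).mono_left nhdsWithin_le_nhds
    rw [add_zero] at hc
    exact ge_of_tendsto hc (by filter_upwards [self_mem_nhdsWithin] with δ hδ using hkey δ hδ)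
  rw [← mul_div_assoc, le_div_iff₀ hI0pos] at hlim
  linarith

end IsDeformation

/-! ### Mixed volumes of convex bodies -/

variable {i : ℕ} {A B C K Ω : Set (Euc n)}

lemma integral_cmix_hess (hn : 0 < n) (i : ℕ) {φ κ : Euc n → ℝ} (hφ : IsPotential φ C)
    (hC : IsBody C) (hκ : IsPotential κ K) (hK : IsBody K) :
    Integrable (fun x => cmix i (hess φ x) (hess κ x)) ∧
      ∫ x, cmix i (hess φ x) (hess κ x) = mv i C K := by
  have h := integral_cmix hn i hφ hC hκ hK (v := fun _ => 0) contDiff_const HasCompactSupport.zero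
    (fun x u hu => by
      rw [jac_zero, add_zero]
      simpa using (hφ.posDef x).dotProduct_mulVec_pos hu)
  simpa only [jac_zero, add_zero] using h

lemma mv_pos (hi : i < n) (hC : IsBody C) (hK : IsBody K) : 0 < mv i C K := by
  have hφ := isPotential_logLap hC
  have hκ := isPotential_logLap hK
  obtain ⟨h1, h2⟩ := integral_cmix_hess (by omega) i hφ hC hκ hK
  have hρ : ∀ x, 0 < cmix i (hess (logLap C) x) (hess (logLap K) x) := fun x =>
    cmix_pos hi.le (hφ.posDef x) (hκ.posDef x)
  rw [← h2, integral_pos_iff_support_of_nonneg (fun x => (hρ x).le) h1]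
  have : (Function.support fun x => cmix i (hess (logLap C) x) (hess (logLap K) x)) = univ :=
    eq_univ_of_forall fun x => (hρ x).ne'
  rw [this]
  exact isOpen_univ.measure_pos _ univ_nonempty

/-- The Minkowski segment between two sets. -/
def blend (A B : Set (Euc n)) (t : ℝ) : Set (Euc n) := (1 - t) • A + t • B

lemma blend_zero (hB : B.Nonempty) : blend A B 0 = A := by
  simp [blend, zero_smul_set hB]

lemma blend_one (hA : A.Nonempty) : blend A B 1 = B := by
  simp [blend, zero_smul_set hA]

lemma IsBody.blend (hA : IsBody A) (hB : IsBody B) {t : ℝ} (ht : t ∈ Icc (0 : ℝ) 1) :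
    IsBody (blend A B t) := by
  rcases ht.1.eq_or_lt with rfl | h0
  · rwa [blend_zero hB.nonempty]
  rcases ht.2.eq_or_lt with rfl | h1
  · rwa [blend_one hA.nonempty]
  · exact (hA.smul (sub_pos.2 h1)).add (hB.smul h0)

lemma isPotential_blend (hA : IsBody A) (hB : IsBody B) {t : ℝ} (ht : t ∈ Icc (0 : ℝ) 1) :
    IsPotential (fun x => logLap A x + t * (logLap B x - logLap A x)) (blend A B t) := by
  rcases ht.1.eq_or_lt with rfl | h0
  · simpa [blend_zero hB.nonempty] using isPotential_logLap hA
  rcases ht.2.eq_or_lt with rfl | h1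
  · simpa [blend_one hA.nonempty] using isPotential_logLap hB
  · have := ((isPotential_logLap hA).smul (sub_pos.2 h1)).add ((isPotential_logLap hB).smul h0)
      (hA.smul (sub_pos.2 h1)) (hB.smul h0)
    have he : (fun x => logLap A x + t * (logLap B x - logLap A x))
        = fun x => (1 - t) * logLap A x + t * logLap B x := by
      ext x
      ring
    rw [he]
    exact this

lemma isDeformation_blend (hA : IsBody A) (hB : IsBody B) (hK : IsBody K) {t : ℝ}
    (ht : t ∈ Ioo (0 : ℝ) 1) :
    IsDeformation (min t (1 - t)) (fun x => logLap A x + t * (logLap B x - logLap A x))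
      (fun x => logLap B x - logLap A x) (logLap K) (fun s => blend A B (t + s)) K where
  pos := lt_min ht.1 (sub_pos.2 ht.2)
  contDiff_left := (isPotential_blend hA hB ⟨ht.1.le, ht.2.le⟩).contDiff
  contDiff_right := (isPotential_logLap hB).contDiff.sub (isPotential_logLap hA).contDiff
  isBody s hs := by
    obtain ⟨h1, h2⟩ := lt_min_iff.1 hs
    rw [abs_lt] at h1 h2
    exact hA.blend hB ⟨by linarith, by linarith⟩
  isPotential s hs := by
    obtain ⟨h1, h2⟩ := lt_min_iff.1 hs
    rw [abs_lt] at h1 h2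
    convert isPotential_blend hA hB (t := t + s) ⟨by linarith, by linarith⟩ using 2 with x
    ring
  isBody_ref := hK
  isPotential_ref := isPotential_logLap hK

theorem exists_polynomial_blend (hi : i < n) (hA : IsBody A) (hB : IsBody B) (hK : IsBody K) :
    ∃ P : Polynomial ℝ, (∀ t ∈ Icc (0 : ℝ) 1, P.eval t = mv i (blend A B t) K) ∧
      ∀ t ∈ Ioo (0 : ℝ) 1, P.derivative.eval t = ∫ x, (gmat i
          (hess (fun x => logLap A x + t * (logLap B x - logLap A x)) x) (hess (logLap K) x)
            * hess (fun x => logLap B x - logLap A x) x).trace ∧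
        P.derivative.derivative.eval t = 2 * ∫ x, (qpoly i
          (hess (fun x => logLap A x + t * (logLap B x - logLap A x)) x) (hess (logLap K) x)
            (hess (fun x => logLap B x - logLap A x) x)).coeff 2 := by
  have hn : 0 < n := by omega
  have hcA := (isPotential_logLap hA).contDiff
  have hf : ContDiff ℝ ∞ fun x => logLap B x - logLap A x :=
    (isPotential_logLap hB).contDiff.sub hcA
  have hI : ∀ t ∈ Icc (0 : ℝ) 1, Integrable (fun x => (qpoly i (hess (logLap A) x)
      (hess (logLap K) x) (hess (fun x => logLap B x - logLap A x) x)).eval t) ∧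
      ∫ x, (qpoly i (hess (logLap A) x)
      (hess (logLap K) x) (hess (fun x => logLap B x - logLap A x) x)).eval t
        = mv i (blend A B t) K := by
    intro t ht
    have := integral_cmix_hess hn i (isPotential_blend hA hB ht) (hA.blend hB ht)
      (isPotential_logLap hK) hK
    simpa only [qpoly_eval, hess_add hcA (contDiff_const.mul hf), hess_const_mul _ hf] using this
  have hd := fun x => qpoly_natDegree_le_card i (hess (logLap A) x)
    (hess (logLap K) x) (hess (fun x => logLap B x - logLap A x) x)
  obtain ⟨P, -, -, hP⟩ := exists_integral_polynomial hd
    (integrable_coeff hd (Icc_infinite zero_lt_one) fun t ht => (hI t ht).1)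
  refine ⟨P, fun t ht => by rw [hP, (hI t ht).2], fun t ht => ?_⟩
  have h := isDeformation_blend hA hB hK ht
  obtain ⟨δ, hδ, hδε, hQI⟩ := h.integral_qpoly_eval hn i (v := fun _ => 0) contDiff_const
    HasCompactSupport.zero
  simp only [jac_zero, add_zero] at hQI
  have hd' := fun x => qpoly_natDegree_le_card i
    (hess (fun x => logLap A x + t * (logLap B x - logLap A x)) x) (hess (logLap K) x)
      (hess (fun x => logLap B x - logLap A x) x)
  obtain ⟨Q, -, hQ, hQe⟩ := exists_integral_polynomial hd'
    (integrable_coeff hd' (IsDeformation.abs_lt_infinite hδ) fun s hs => (hQI s hs).1)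
  have hQP : Polynomial.taylor t P = Q := by
    refine Polynomial.eq_of_infinite_eval_eq _ _
      ((IsDeformation.abs_lt_infinite hδ).mono fun s hs => ?_)
    have hs' : |s| < δ := hs
    obtain ⟨h1, h2⟩ := lt_min_iff.1 (hs'.trans_le hδε)
    rw [abs_lt] at h1 h2
    show (Polynomial.taylor t P).eval s = Q.eval s
    rw [Polynomial.taylor_eval, hQe, (hQI s hs).2, add_comm, hP,
      (hI (t + s) ⟨by linarith, by linarith⟩).2]
  constructor
  · rw [← Polynomial.taylor_coeff_one, hQP, hQ]
    refine integral_congr_ae (Eventually.of_forall fun x => ?_)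
    exact qpoly_coeff_one i (h.posDef_zero x) (h.posDef_ref x) _
  · rw [← hQ, ← hQP, Polynomial.taylor_coeff]
    have := congrArg (fun F : Polynomial ℝ → Polynomial ℝ => (F P).eval t)
      (Polynomial.factorial_smul_hasseDeriv (R := ℝ) 2)
    simp only [LinearMap.smul_apply, Polynomial.eval_smul, Function.iterate_succ,
      Function.iterate_zero, Function.comp, id] at this
    rw [← this]
    norm_num [Nat.factorial]

lemma concaveOn_eval_rpow {P : Polynomial ℝ} {m : ℝ} (hm : 1 ≤ m)
    (hpos : ∀ t ∈ Icc (0 : ℝ) 1, 0 < P.eval t)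
    (h : ∀ t ∈ Ioo (0 : ℝ) 1, P.eval t * P.derivative.derivative.eval t
      ≤ (1 - 1 / m) * (P.derivative.eval t) ^ 2) :
    ConcaveOn ℝ (Icc (0 : ℝ) 1) fun t => (P.eval t) ^ (1 / m) := by
  have hd : ∀ (p : ℝ) (t : ℝ), t ∈ Icc (0 : ℝ) 1 → HasDerivAt (fun t => (P.eval t) ^ p)
      (P.derivative.eval t * p * (P.eval t) ^ (p - 1)) t := fun p t ht =>
    (P.hasDerivAt t).rpow_const (Or.inl (hpos t ht).ne')
  refine concaveOn_of_hasDerivWithinAt2_nonpos (convex_Icc 0 1)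
    (f' := fun t => P.derivative.eval t * (1 / m) * (P.eval t) ^ (1 / m - 1))
    (f'' := fun t => P.derivative.derivative.eval t * (1 / m) * (P.eval t) ^ (1 / m - 1)
      + P.derivative.eval t * (1 / m)
        * (P.derivative.eval t * (1 / m - 1) * (P.eval t) ^ (1 / m - 1 - 1)))
    (fun t ht => (hd _ t ht).continuousAt.continuousWithinAt) ?_ ?_ ?_
  · intro t ht
    exact (hd _ t (interior_subset ht)).hasDerivWithinAt
  · intro t ht
    exact (((P.derivative.hasDerivAt t).mul_const _).mul
      (hd _ t (interior_subset ht))).hasDerivWithinAt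
  · intro t ht
    have hP := hpos t (interior_subset ht)
    rw [interior_Icc] at ht
    have h2 : (P.eval t) ^ (1 / m - 1) = (P.eval t) ^ (1 / m - 1 - 1) * P.eval t := by
      rw [← Real.rpow_add_one hP.ne', sub_add_cancel]
    rw [h2]
    have h3 : 0 ≤ (1 / m) * (P.eval t) ^ (1 / m - 1 - 1) := by positivity
    nlinarith [mul_le_mul_of_nonneg_left (h t ht) h3]

theorem mv_rpow_blend_ge (hi : i < n) (hA : IsBody A) (hB : IsBody B) (hK : IsBody K) {t : ℝ}
    (ht : t ∈ Icc (0 : ℝ) 1) :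
    (1 - t) * mv i A K ^ (1 / ((n : ℝ) - i)) + t * mv i B K ^ (1 / ((n : ℝ) - i))
      ≤ mv i (blend A B t) K ^ (1 / ((n : ℝ) - i)) := by
  obtain ⟨P, hP, hP'⟩ := exists_polynomial_blend hi hA hB hK
  have hm1 : 1 ≤ (n : ℝ) - i := by
    have : (i : ℝ) + 1 ≤ n := by exact_mod_cast hi
    linarith
  have h := concaveOn_eval_rpow (P := P) hm1 (fun t ht => by
      rw [hP t ht]
      exact mv_pos hi (hA.blend hB ht) hK) fun t ht => by
    have h := isDeformation_blend hA hB hK ht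
    have h0 := (integral_cmix_hess (by omega) i h.isPotential_zero
      (by simpa using hA.blend hB ⟨ht.1.le, ht.2.le⟩) h.isPotential_ref hK).2
    have h1 := h.integral_newton hi
    rw [h0, ← (hP' t ht).1, add_zero, ← hP t ⟨ht.1.le, ht.2.le⟩] at h1
    rw [(hP' t ht).2]
    linarith
  have h01 := h.2 (left_mem_Icc.2 zero_le_one) (right_mem_Icc.2 zero_le_one) (sub_nonneg.2 ht.2)
    ht.1 (sub_add_cancel 1 t)
  simp only [smul_eq_mul, mul_zero, mul_one, zero_add] at h01
  rwa [hP t ht, hP 0 (left_mem_Icc.2 zero_le_one), hP 1 (right_mem_Icc.2 zero_le_one),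
    blend_zero hB.nonempty, blend_one hA.nonempty] at h01

lemma antitone_smoothTransition_sub : Antitone fun t : ℝ => Real.smoothTransition (2 - t) :=
  fun _ _ h => Real.smoothTransition.monotone (by linarith)

theorem IsDeformation.integral_trace_nonneg {ε : ℝ} {φ f κ : Euc n → ℝ} {D : ℝ → Set (Euc n)}
    (hi : i < n) (h : IsDeformation ε φ f κ D K) {u : Euc n → ℝ} (hu : ContDiff ℝ ∞ u)
    (hut : Tendsto u (cocompact (Euc n)) atTop)
    (hintg : Integrable fun x => (gmat i (hess φ x) (hess κ x) * hess u x).trace) :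
    0 ≤ ∫ x, (gmat i (hess φ x) (hess κ x) * hess u x).trace := by
  set θ : ℝ → ℝ := fun t => Real.smoothTransition (2 - t) with hθdef
  have hθ : ContDiff ℝ ∞ θ := Real.smoothTransition.contDiff.comp (contDiff_const.sub contDiff_id)
  have hζ : ∀ r : ℝ, ContDiff ℝ ∞ fun x => θ (r * u x) := fun r =>
    hθ.comp (contDiff_const.mul hu)
  have hpdζ : ∀ (r : ℝ) (j : Fin n) (x : Euc n), pd j (fun x => θ (r * u x)) x
      = deriv θ (r * u x) * (r * pd j u x) := by
    intro r j x
    have h1 : DifferentiableAt ℝ θ (r * u x) := hθ.differentiable (by simp) _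
    have h2 : HasFDerivAt (fun x => r * u x) (r • fderiv ℝ u x) x :=
      ((contDiff_differentiable hu) x).hasFDerivAt.const_mul r
    have h3 := h1.hasDerivAt.comp_hasFDerivAt x h2
    rw [pd]
    have h4 : fderiv ℝ (fun x => θ (r * u x)) x = deriv θ (r * u x) • (r • fderiv ℝ u x) :=
      h3.fderiv
    rw [h4]
    rfl
  have hpos : ∀ r : ℝ, 0 < r →
      0 ≤ ∫ x, θ (r * u x) * (gmat i (hess φ x) (hess κ x) * hess u x).trace := by
    intro r hr
    have hv : ContDiff ℝ ∞ fun x => θ (r * u x) • grd u x := (hζ r).smul (contDiff_grd hu)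
    have hvc : HasCompactSupport fun x => θ (r * u x) • grd u x := by
      have := hut.eventually (eventually_gt_atTop (2 / r))
      rw [Filter.Eventually, mem_cocompact] at this
      obtain ⟨S, hS, hS'⟩ := this
      refine HasCompactSupport.intro hS fun x hx => ?_
      have hx' : 2 / r < u x := hS' hx
      rw [div_lt_iff₀ hr] at hx'
      have : θ (r * u x) = 0 := Real.smoothTransition.zero_of_nonpos (by linarith)
      rw [this, zero_smul]
    have hjac : ∀ x, jac (fun x => θ (r * u x) • grd u x) x = θ (r * u x) • hess u x
        + (deriv θ (r * u x) * r) • vecMulVec (fun a => pd a u x) (fun a => pd a u x) := by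
      intro x
      ext a b
      have : (fun y => (θ (r * u y) • grd u y) a) = fun y => θ (r * u y) * pd a u y := rfl
      rw [jac_apply, this, pd_mul (contDiff_differentiable (hζ r))
        (contDiff_differentiable (contDiff_pd hu a))]
      simp only [hpdζ, Matrix.add_apply, Matrix.smul_apply, smul_eq_mul,
        vecMulVec_apply, hess_apply]
      ring
    obtain ⟨h1, h2⟩ := h.integral_trace_jac (by omega) (i := i) hv hvc
    rw [← h2]
    refine integral_mono h1 (hintg.bdd_mul (c := 1) (hζ r).continuous.aestronglyMeasurable
      (Eventually.of_forall fun x => ?_)) fun x => ?_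
    · rw [Real.norm_eq_abs, abs_of_nonneg (Real.smoothTransition.nonneg _)]
      exact Real.smoothTransition.le_one _
    · show _ ≤ θ (r * u x) * _
      rw [hjac, Matrix.mul_add, trace_add, Matrix.mul_smul, trace_smul, Matrix.mul_smul,
        trace_smul, trace_mul_vecMulVec, smul_eq_mul, smul_eq_mul]
      have h3 : deriv θ (r * u x) ≤ 0 := antitone_smoothTransition_sub.deriv_nonpos
      have h4 : 0 ≤ (fun a => pd a u x) ⬝ᵥ gmat i (hess φ x) (hess κ x) *ᵥ (fun a => pd a u x) := by
        simpa using (gmat_posDef hi (h.posDef_zero x)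
          (h.posDef_ref x)).posSemidef.dotProduct_mulVec_nonneg fun a => pd a u x
      have := mul_nonneg (mul_nonneg (neg_nonneg.2 h3) hr.le) h4
      linarith
  have hlim : Tendsto (fun N : ℕ => ∫ x, θ (1 / ((N : ℝ) + 1) * u x)
      * (gmat i (hess φ x) (hess κ x) * hess u x).trace) atTop
      (𝓝 (∫ x, (gmat i (hess φ x) (hess κ x) * hess u x).trace)) := by
    refine tendsto_integral_of_dominated_convergence
      (fun x => ‖(gmat i (hess φ x) (hess κ x) * hess u x).trace‖)
      (fun N => (hζ _).continuous.aestronglyMeasurable.mul hintg.aestronglyMeasurable) hintg.norm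
      (fun N => Eventually.of_forall fun x => ?_) (Eventually.of_forall fun x => ?_)
    · rw [norm_mul, Real.norm_eq_abs, abs_of_nonneg (Real.smoothTransition.nonneg _)]
      exact mul_le_of_le_one_left (norm_nonneg _) (Real.smoothTransition.le_one _)
    · have h1 : Tendsto (fun N : ℕ => 1 / ((N : ℝ) + 1) * u x) atTop (𝓝 0) := by
        simpa using tendsto_one_div_add_atTop_nhds_zero_nat.mul_const (u x)
      have h2 := (hθ.continuous.tendsto 0).comp h1
      have h3 : θ 0 = 1 := Real.smoothTransition.one_of_one_le (by norm_num)
      rw [h3] at h2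
      simpa using h2.mul_const (gmat i (hess φ x) (hess κ x) * hess u x).trace
  exact ge_of_tendsto' hlim fun N => hpos _ (by positivity)

lemma hess_inner_left (a x : Euc n) : hess (fun y : Euc n => inner ℝ y a) x = 0 := by
  ext b c
  have h : pd b (fun y : Euc n => inner ℝ y a) =
      fun _ => inner ℝ (EuclideanSpace.single b 1) a := by
    ext y
    have : (fun y : Euc n => inner ℝ y a) = innerSL ℝ a := by
      ext y
      exact real_inner_comm _ _
    rw [pd, this, ContinuousLinearMap.fderiv]
    exact real_inner_comm (EuclideanSpace.single b (1 : ℝ)) a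
  rw [hess_apply, h, pd_const]
  rfl

theorem mv_mono (hi : i < n) (hA : IsBody A) (hB : IsBody B) (hK : IsBody K) (hAB : A ⊆ B) :
    mv i A K ≤ mv i B K := by
  have hn : 0 < n := by omega
  obtain ⟨P, hP, hP'⟩ := exists_polynomial_blend hi hA hB hK
  obtain ⟨a, ha⟩ := hA.interior_nonempty
  have hφA := isPotential_logLap hA
  have hf : ContDiff ℝ ∞ fun x => logLap B x - logLap A x :=
    (isPotential_logLap hB).contDiff.sub hφA.contDiff
  have hder : ∀ t ∈ Ioo (0 : ℝ) 1, 0 ≤ P.derivative.eval t := by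
    intro t ht
    rw [(hP' t ht).1]
    have h := isDeformation_blend hA hB hK ht
    have hM : ∀ x, hess (fun x => logLap A x + t * (logLap B x - logLap A x)) x
        = hess (logLap A) x + t • hess (fun x => logLap B x - logLap A x) x := fun x => by
      rw [hess_add hφA.contDiff (contDiff_const.mul hf), hess_const_mul _ hf]
    have hXi := h.integrable_trace hn (i := i)
    set G : Euc n → Matrix (Fin n) (Fin n) ℝ := fun x => gmat i
      (hess (fun x => logLap A x + t * (logLap B x - logLap A x)) x) (hess (logLap K) x) with hG
    have hAi : Integrable fun x => (G x * hess (logLap A) x).trace := by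
      refine ((h.integrable_rho hn (i := i)).const_mul ((n : ℝ) - i)).sub (hXi.const_mul t)
        |>.congr (Eventually.of_forall fun x => ?_)
      have := trace_gmat_mul_self i (h.posDef_zero x) (h.posDef_ref x)
      simp only [Pi.sub_apply]
      rw [← this, sub_eq_iff_eq_add, hM x, Matrix.mul_add, trace_add, Matrix.mul_smul, trace_smul,
        smul_eq_mul]
      simp only [hG, hM x]
    have hlin : ContDiff ℝ ∞ fun x : Euc n => inner ℝ x a := contDiff_id.inner ℝ contDiff_const
    have key : ∀ η : ℝ, 0 < η → 0 ≤ (∫ x, (G x * hess (fun x => logLap B x - logLap A x) x).trace)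
        + η * ∫ x, (G x * hess (logLap A) x).trace := by
      intro η hη
      have hu : ContDiff ℝ ∞ fun x => (logLap B x - logLap A x)
          + η * (logLap A x - inner ℝ x a) := hf.add (contDiff_const.mul (hφA.contDiff.sub hlin))
      have hut : Tendsto (fun x => (logLap B x - logLap A x) + η * (logLap A x - inner ℝ x a))
          (cocompact (Euc n)) atTop := by
        refine tendsto_atTop_mono (fun x => ?_) ((hφA.tendsto_sub_inner a ha).const_mul_atTop hη)
        have := logLap_mono hA hB hAB x
        linarith
      have hH : ∀ x, hess (fun x => (logLap B x - logLap A x) + η * (logLap A x - inner ℝ x a)) x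
          = hess (fun x => logLap B x - logLap A x) x + η • hess (logLap A) x := by
        intro x
        have h1 : (fun x : Euc n => logLap A x - inner ℝ x a)
            = fun x => logLap A x + (-1) * inner ℝ x a := by
          ext x
          ring
        rw [hess_add hf (contDiff_const.mul (hφA.contDiff.sub hlin)),
          hess_const_mul _ (hφA.contDiff.sub hlin), h1,
          hess_add hφA.contDiff (contDiff_const.mul hlin), hess_const_mul _ hlin,
          hess_inner_left, smul_zero, add_zero]
      have htr : ∀ x, (G x * hess (fun x => (logLap B x - logLap A x)
          + η * (logLap A x - inner ℝ x a)) x).trace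
          = (G x * hess (fun x => logLap B x - logLap A x) x).trace
            + η * (G x * hess (logLap A) x).trace := fun x => by
        rw [hH, Matrix.mul_add, trace_add, Matrix.mul_smul, trace_smul, smul_eq_mul]
      have hle := h.integral_trace_nonneg hi hu hut (by
        refine (hXi.add (hAi.const_mul η)).congr (Eventually.of_forall fun x => ?_)
        exact (htr x).symm)
      have heq : ∫ x, (G x * hess (fun x => (logLap B x - logLap A x)
          + η * (logLap A x - inner ℝ x a)) x).trace
          = (∫ x, (G x * hess (fun x => logLap B x - logLap A x) x).trace)
            + η * ∫ x, (G x * hess (logLap A) x).trace := by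
        rw [← integral_const_mul, ← integral_add hXi (hAi.const_mul η)]
        exact integral_congr_ae (Eventually.of_forall htr)
      exact hle.trans_eq heq
    have hlim : Tendsto (fun η : ℝ =>
        (∫ x, (G x * hess (fun x => logLap B x - logLap A x) x).trace)
          + η * ∫ x, (G x * hess (logLap A) x).trace) (𝓝[>] 0)
        (𝓝 ((∫ x, (G x * hess (fun x => logLap B x - logLap A x) x).trace)
          + 0 * ∫ x, (G x * hess (logLap A) x).trace)) :=
      (tendsto_const_nhds.add (tendsto_id.mul_const _)).mono_left nhdsWithin_le_nhds
    rw [zero_mul, add_zero] at hlim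
    exact ge_of_tendsto hlim (by filter_upwards [self_mem_nhdsWithin] with η hη using key η hη)
  have hmono : MonotoneOn (fun t => P.eval t) (Icc (0 : ℝ) 1) := by
    refine monotoneOn_of_deriv_nonneg (convex_Icc 0 1) P.continuous.continuousOn
      P.differentiable.differentiableOn fun t ht => ?_
    rw [Polynomial.deriv]
    rw [interior_Icc] at ht
    exact hder t ht
  have := hmono (left_mem_Icc.2 zero_le_one) (right_mem_Icc.2 zero_le_one) zero_le_one
  simp only at this
  rwa [hP 0 (left_mem_Icc.2 zero_le_one), hP 1 (right_mem_Icc.2 zero_le_one),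
    blend_zero hB.nonempty, blend_one hA.nonempty] at this

/-! ### Steiner polynomials -/

lemma IsBody.exists_volume_polynomial (hn : 0 < n) (hC : IsBody C) (hK : IsBody K) :
    ∃ P : Polynomial ℝ, P.natDegree ≤ n ∧
      ∀ t : ℝ, 0 ≤ t → (volume (C + t • K)).toReal = P.eval t := by
  have hφ := isPotential_logLap hC
  have hκ := isPotential_logLap hK
  have hI : ∀ t : ℝ, 0 ≤ t → Integrable (fun x => (detPoly (hess (logLap C) x)
      (hess (logLap K) x)).eval t) ∧ ∫ x, (detPoly (hess (logLap C) x)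
      (hess (logLap K) x)).eval t = (volume (C + t • K)).toReal := by
    intro t ht
    have hp := hφ.add_smul hκ hC hK ht
    have h := hp.integral_det hn (hC.add_smul hK ht) (v := fun _ => 0) contDiff_const
      HasCompactSupport.zero (fun x u hu => by
        rw [jac_zero, add_zero]
        simpa using (hp.posDef x).dotProduct_mulVec_pos hu)
    simpa only [jac_zero, add_zero, detPoly_eval, hess_add hφ.contDiff
      (contDiff_const.mul hκ.contDiff), hess_const_mul _ hκ.contDiff] using h
  have hd := fun x => detPoly_natDegree_le (hess (logLap C) x) (hess (logLap K) x)
  obtain ⟨P, hPd, -, hP⟩ := exists_integral_polynomial hd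
    (integrable_coeff hd (Ici_infinite (0 : ℝ)) fun t ht => (hI t ht).1)
  exact ⟨P, hPd, fun t ht => by rw [hP, (hI t ht).2]⟩

lemma isBody_add_smul (hCc : IsCompact C) (hC : Convex ℝ C) (hne : C.Nonempty) (hK : IsBody K)
    {s : ℝ} (hs : 0 < s) : IsBody (C + s • K) where
  compact := hCc.add (hK.compact.smul s)
  convex := hC.add (hK.convex.smul s)
  interior_nonempty :=
    (hne.add (hK.smul hs).interior_nonempty).mono
      (interior_maximal (add_subset_add_left interior_subset) isOpen_interior.add_left)

lemma add_smul_add_smul (hK : Convex ℝ K) {s t : ℝ} (hs : 0 ≤ s) (ht : 0 ≤ t) :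
    C + s • K + t • K = C + (s + t) • K := by
  rw [add_assoc, hK.add_smul hs ht]

lemma tendsto_volume_add_smul (hC : IsCompact C) (hK : IsBody K) :
    Tendsto (fun t : ℝ => (volume (C + t • K)).toReal) (𝓝[>] 0) (𝓝 (volume C).toReal) := by
  refine (ENNReal.tendsto_toReal hC.measure_lt_top.ne).comp ?_
  obtain ⟨k, hk⟩ := hK.nonempty
  obtain ⟨M, hM⟩ := hK.compact.isBounded.exists_norm_le
  have h0 : Tendsto (fun t : ℝ => t * M) (𝓝[>] 0) (𝓝 0) := by
    have : Tendsto (fun t : ℝ => t * M) (𝓝 0) (𝓝 (0 * M)) := tendsto_id.mul_const M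
    rw [zero_mul] at this
    exact this.mono_left nhdsWithin_le_nhds
  refine tendsto_of_tendsto_of_tendsto_of_le_of_le' tendsto_const_nhds
    ((tendsto_measure_cthickening_of_isCompact hC).comp h0) ?_ ?_
  · refine Eventually.of_forall fun t => ?_
    rw [← measure_vadd volume (t • k) C]
    refine measure_mono ?_
    rintro _ ⟨c, hc, rfl⟩
    show t • k + c ∈ _
    rw [add_comm (t • k)]
    exact add_mem_add hc (smul_mem_smul_set hk)
  · filter_upwards [self_mem_nhdsWithin] with t ht
    refine measure_mono ?_
    rintro _ ⟨c, hc, _, ⟨y, hy, rfl⟩, rfl⟩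
    refine Metric.mem_cthickening_of_dist_le _ c _ _ hc ?_
    have ht' : (0 : ℝ) < t := ht
    simp only [dist_self_add_left, norm_smul, Real.norm_eq_abs, abs_of_pos ht']
    exact mul_le_mul_of_nonneg_left (hM y hy) ht'.le

/-- Steiner's formula for compact convex sets, possibly of empty interior. -/
theorem exists_volume_polynomial (hn : 0 < n) (hCc : IsCompact C) (hC : Convex ℝ C)
    (hne : C.Nonempty) (hK : IsBody K) :
    ∃ P : Polynomial ℝ, P.natDegree ≤ n ∧
      ∀ t : ℝ, 0 ≤ t → (volume (C + t • K)).toReal = P.eval t := by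
  choose P hPd hP using fun s : Ioi (0 : ℝ) =>
    (isBody_add_smul hCc hC hne hK s.2).exists_volume_polynomial hn hK
  have hP' : ∀ (s : Ioi (0 : ℝ)) (u : ℝ), s ≤ u →
      (volume (C + u • K)).toReal = (Polynomial.taylor (-(s : ℝ)) (P s)).eval u := by
    intro s u hsu
    have hs : (0 : ℝ) < s := s.2
    rw [Polynomial.taylor_eval, ← sub_eq_add_neg, ← hP s (u - s) (sub_nonneg.2 hsu),
      add_smul_add_smul hK.convex hs.le (sub_nonneg.2 hsu), add_sub_cancel]
  let one : Ioi (0 : ℝ) := ⟨1, mem_Ioi.2 one_pos⟩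
  have heq : ∀ s : Ioi (0 : ℝ), Polynomial.taylor (-(s : ℝ)) (P s)
      = Polynomial.taylor (-(one : ℝ)) (P one) := by
    intro s
    refine Polynomial.eq_of_infinite_eval_eq _ _ ((Ici_infinite (max (s : ℝ) one)).mono ?_)
    intro u hu
    have hu' : max (s : ℝ) one ≤ u := hu
    show Polynomial.eval _ _ = Polynomial.eval _ _
    rw [← hP' s u ((le_max_left _ _).trans hu'), ← hP' one u ((le_max_right _ _).trans hu')]
  have hpos : ∀ u : ℝ, 0 < u → (volume (C + u • K)).toReal
      = (Polynomial.taylor (-(one : ℝ)) (P one)).eval u := by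
    intro u hu
    rw [← heq ⟨u, hu⟩, ← hP' ⟨u, hu⟩ u le_rfl]
  refine ⟨Polynomial.taylor (-(one : ℝ)) (P one), by rw [Polynomial.natDegree_taylor]; exact hPd _,
    fun t ht => ?_⟩
  rcases ht.eq_or_lt with rfl | ht
  · rw [zero_smul_set hK.nonempty, add_zero]
    refine tendsto_nhds_unique (tendsto_volume_add_smul hCc hK) ?_
    refine (((Polynomial.taylor (-(one : ℝ)) (P one)).continuous.tendsto 0).mono_left
      nhdsWithin_le_nhds).congr' ?_
    filter_upwards [self_mem_nhdsWithin] with u hu using (hpos u hu).symm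
  · exact hpos t ht

lemma mv_eq_coeff {P : Polynomial ℝ} (hd : P.natDegree ≤ n)
    (h : ∀ t : ℝ, 0 ≤ t → (volume (C + t • K)).toReal = P.eval t) (i : ℕ) :
    mv i C K = P.coeff i := by
  rw [coeff_eq_sum_wt hd, mv]
  exact Finset.sum_congr rfl fun k _ => by rw [h _ (Nat.cast_nonneg k)]

lemma iteratedDeriv_eval_zero (P : Polynomial ℝ) (i : ℕ) :
    iteratedDeriv i (fun t => P.eval t) 0 = i.factorial * P.coeff i := by
  have h : ∀ (k : ℕ), deriv^[k] (fun t => P.eval t)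
      = fun t => (Polynomial.derivative^[k] P).eval t := by
    intro k
    induction k with
    | zero => rfl
    | succ k ih =>
      rw [Function.iterate_succ_apply', ih, Function.iterate_succ_apply']
      ext t
      exact Polynomial.deriv _
  rw [iteratedDeriv_eq_iterate, h]
  show Polynomial.eval 0 _ = _
  rw [← Polynomial.coeff_zero_eq_eval_zero, Polynomial.coeff_iterate_derivative, zero_add,
    Nat.descFactorial_self, nsmul_eq_mul]

theorem mixedVol_eq_mv_div (hn : 0 < n) (i : ℕ) (hCc : IsCompact C) (hC : Convex ℝ C)
    (hne : C.Nonempty) (hK : IsBody K) : mixedVol i C K = mv i C K / n.choose i := by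
  obtain ⟨P, hd, hP⟩ := exists_volume_polynomial hn hCc hC hne hK
  have hE : EqOn (fun t : ℝ => (volume (C + t • K)).toReal) (fun t => P.eval t) (Ici 0) :=
    fun t ht => hP t ht
  have hsmooth : ContDiff ℝ i fun t => P.eval t := by
    simpa [Polynomial.coe_aeval_eq_eval] using P.contDiff_aeval (𝕜 := ℝ) i
  rw [mixedVol, iteratedDerivWithin_congr hE (mem_Ici.2 le_rfl),
    iteratedDerivWithin_eq_iteratedDeriv (uniqueDiffOn_Ici 0) hsmooth.contDiffAt
    (mem_Ici.2 le_rfl), iteratedDeriv_eval_zero, mv_eq_coeff hd hP,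
    mul_comm (n.choose i : ℝ), mul_div_mul_left]
  exact_mod_cast i.factorial_ne_zero

lemma tendsto_mv_add_smul (hn : 0 < n) (i : ℕ) (hCc : IsCompact C) (hC : Convex ℝ C)
    (hne : C.Nonempty) (hK : IsBody K) :
    Tendsto (fun s : ℝ => mv i (C + s • K) K) (𝓝[>] 0) (𝓝 (mv i C K)) := by
  obtain ⟨P, hd, hP⟩ := exists_volume_polynomial hn hCc hC hne hK
  have h : ∀ s : ℝ, 0 ≤ s → mv i (C + s • K) K = (Polynomial.hasseDeriv i P).eval s := by
    intro s hs
    rw [← Polynomial.taylor_coeff]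
    refine mv_eq_coeff (by rwa [Polynomial.natDegree_taylor]) (fun t ht => ?_) i
    rw [Polynomial.taylor_eval, add_smul_add_smul hK.convex hs ht, hP _ (by positivity), add_comm]
  have h0 : mv i C K = (Polynomial.hasseDeriv i P).eval 0 := by
    rw [← h 0 le_rfl, zero_smul_set hK.nonempty, add_zero]
  rw [h0]
  refine (((Polynomial.hasseDeriv i P).continuous.tendsto 0).mono_left nhdsWithin_le_nhds).congr' ?_
  filter_upwards [self_mem_nhdsWithin] with s hs using (h s (le_of_lt hs)).symm

lemma mv_nonneg (hi : i < n) (hCc : IsCompact C) (hC : Convex ℝ C) (hne : C.Nonempty)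
    (hK : IsBody K) : 0 ≤ mv i C K := by
  refine ge_of_tendsto (tendsto_mv_add_smul (by omega) i hCc hC hne hK) ?_
  filter_upwards [self_mem_nhdsWithin] with s hs
  exact (mv_pos hi (isBody_add_smul hCc hC hne hK hs) hK).le

lemma mv_vadd (i : ℕ) (a : Euc n) (C K : Set (Euc n)) : mv i (a +ᵥ C) K = mv i C K := by
  simp only [mv, vadd_add_assoc, measure_vadd]

/-- Monotonicity of the mixed volume up to a translation, without interior on the left. -/
theorem mv_le_of_add_smul_subset (hi : i < n) (hAc : IsCompact A) (hA : Convex ℝ A)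
    (hne : A.Nonempty) (hB : IsBody B) (hK : IsBody K) {ε : ℝ} (hε : 0 < ε) (h : A + ε • K ⊆ B) :
    mv i A K ≤ mv i B K := by
  obtain ⟨k, hk⟩ := hK.nonempty
  refine le_of_tendsto (tendsto_mv_add_smul (by omega) i hAc hA hne hK) ?_
  filter_upwards [Ioo_mem_nhdsGT hε] with s hs
  have hbody := isBody_add_smul hAc hA hne hK hs.1
  rw [← mv_vadd i ((-(ε - s)) • k) B]
  refine mv_mono hi hbody ?_ hK ?_
  · exact ⟨hB.compact.vadd _, hB.convex.vadd _, by
      rw [interior_vadd]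
      exact hB.interior_nonempty.vadd_set⟩
  · rintro _ ⟨a, ha, _, ⟨y, hy, rfl⟩, rfl⟩
    refine ⟨a + (s • y + (ε - s) • k), h ?_, ?_⟩
    · rw [← add_sub_cancel s ε, hK.convex.add_smul hs.1.le (sub_nonneg.2 hs.2.le),
        add_sub_cancel]
      exact add_mem_add ha (add_mem_add (smul_mem_smul_set hy) (smul_mem_smul_set hk))
    · simp only [vadd_eq_add, neg_smul]
      abel

/-! ### Inner parallel bodies -/

lemma isCompact_innerPar (hΩ : IsCompact Ω) (hK : K.Nonempty) (l : ℝ) :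
    IsCompact (innerPar Ω K l) := by
  obtain ⟨k, hk⟩ := hK
  have hclosed : IsClosed (innerPar Ω K l) := by
    have : innerPar Ω K l = ⋂ y ∈ K, (fun x => x + l • y) ⁻¹' Ω := by
      ext x
      simp [innerPar]
    rw [this]
    exact isClosed_biInter fun y _ => hΩ.isClosed.preimage (by fun_prop)
  refine (hΩ.image (continuous_id.sub (continuous_const (y := l • k)))).of_isClosed_subset
    hclosed ?_
  intro x hx
  exact ⟨x + l • k, hx k hk, by simp⟩

lemma blend_innerPar_subset (hΩ : Convex ℝ Ω) {x y t : ℝ} (ht : t ∈ Icc (0 : ℝ) 1) :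
    blend (innerPar Ω K x) (innerPar Ω K y) t ⊆ innerPar Ω K ((1 - t) * x + t * y) := by
  rintro _ ⟨_, ⟨u, hu, rfl⟩, _, ⟨v, hv, rfl⟩, rfl⟩ k hk
  have := hΩ (hu k hk) (hv k hk) (sub_nonneg.2 ht.2) ht.1 (sub_add_cancel 1 t)
  convert this using 1
  simp only [smul_add, add_smul, mul_smul]
  abel

lemma convex_innerPar (hΩ : Convex ℝ Ω) (l : ℝ) : Convex ℝ (innerPar Ω K l) := by
  intro u hu v hv a b ha hb hab k hk
  have := hΩ (hu k hk) (hv k hk) ha hb hab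
  convert this using 1
  rw [smul_add, smul_add, add_add_add_comm, ← add_smul, hab, one_smul]

lemma innerPar_add_smul_subset (hK : Convex ℝ K) {l m : ℝ} (hl : 0 ≤ l) (hlm : l ≤ m) :
    innerPar Ω K m + (m - l) • K ⊆ innerPar Ω K l := by
  rintro _ ⟨u, hu, _, ⟨y, hy, rfl⟩, rfl⟩ k hk
  have h : (m - l) • y + l • k ∈ m • K := by
    rw [← sub_add_cancel m l, hK.add_smul (sub_nonneg.2 hlm) hl, sub_add_cancel]
    exact add_mem_add (smul_mem_smul_set hy) (smul_mem_smul_set hk)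
  obtain ⟨z, hz, hz'⟩ := h
  have := hu z hz
  simp only at hz'
  rwa [hz', ← add_assoc] at this

lemma isBody_innerPar (hΩc : IsCompact Ω) (hΩ : Convex ℝ Ω) (hK : IsBody K) {l : ℝ} (hl : 0 ≤ l)
    (hlr : l < inrad Ω K) : IsBody (innerPar Ω K l) where
  compact := isCompact_innerPar hΩc hK.nonempty l
  convex := convex_innerPar hΩ l
  interior_nonempty := by
    have hne : {l : ℝ | 0 ≤ l ∧ ∃ x, ∀ y ∈ K, x + l • y ∈ Ω}.Nonempty := by
      by_contra h
      rw [not_nonempty_iff_eq_empty] at h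
      rw [inrad, h, Real.sSup_empty] at hlr
      linarith
    obtain ⟨m, ⟨-, x, hx⟩, hlm⟩ := exists_lt_of_lt_csSup hne hlr
    have hsub := innerPar_add_smul_subset hK.convex hl hlm.le (Ω := Ω)
    exact (isBody_add_smul (isCompact_innerPar hΩc hK.nonempty m) (convex_innerPar hΩ m)
      ⟨x, hx⟩ hK (sub_pos.2 hlm)).interior_nonempty.mono (interior_mono hsub)

lemma mixedVol_empty (i : ℕ) (K : Set (Euc n)) : mixedVol i (∅ : Set (Euc n)) K = 0 := by
  simp [mixedVol, iteratedDerivWithin_fun_const_zero]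

lemma mixedVol_rpow (hi : i < n) (hCc : IsCompact C) (hC : Convex ℝ C) (hne : C.Nonempty)
    (hK : IsBody K) (p : ℝ) :
    mixedVol i C K ^ p = mv i C K ^ p / (n.choose i : ℝ) ^ p := by
  rw [mixedVol_eq_mv_div (by omega) i hCc hC hne hK,
    Real.div_rpow (mv_nonneg hi hCc hC hne hK) (Nat.cast_nonneg _)]

theorem concaveOn_mixedVol_rpow (hi : i < n) (hΩc : IsCompact Ω) (hΩ : Convex ℝ Ω)
    (hK : IsBody K) : ConcaveOn ℝ (Icc 0 (inrad Ω K))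
      fun l => mixedVol i (innerPar Ω K l) K ^ ((1 : ℝ) / ((n : ℝ) - i)) := by
  set f : ℝ → ℝ := fun l => mixedVol i (innerPar Ω K l) K ^ ((1 : ℝ) / ((n : ℝ) - i)) with hf
  set r := inrad Ω K
  have hp : 0 < (1 : ℝ) / ((n : ℝ) - i) := by
    have : (i : ℝ) < n := by exact_mod_cast hi
    exact one_div_pos.2 (by linarith)
  have hc : (0 : ℝ) < (n.choose i : ℝ) ^ ((1 : ℝ) / ((n : ℝ) - i)) :=
    Real.rpow_pos_of_pos (by exact_mod_cast Nat.choose_pos hi.le) _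
  have hbody : ∀ l, 0 ≤ l → l < r → IsBody (innerPar Ω K l) := fun l h1 h2 =>
    isBody_innerPar hΩc hΩ hK h1 h2
  have hfeq : ∀ l, (innerPar Ω K l).Nonempty → f l = mv i (innerPar Ω K l) K
      ^ ((1 : ℝ) / ((n : ℝ) - i)) / (n.choose i : ℝ) ^ ((1 : ℝ) / ((n : ℝ) - i)) := fun l hl =>
    mixedVol_rpow hi (isCompact_innerPar hΩc hK.nonempty l) (convex_innerPar hΩ l) hl hK _
  have hlt : ∀ x y t : ℝ, 0 ≤ x → x < r → 0 ≤ y → y < r → t ∈ Icc (0 : ℝ) 1 →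
      (1 - t) * f x + t * f y ≤ f ((1 - t) * x + t * y) := by
    intro x y t hx hxr hy hyr ht
    have hz0 : 0 ≤ (1 - t) * x + t * y :=
      add_nonneg (mul_nonneg (sub_nonneg.2 ht.2) hx) (mul_nonneg ht.1 hy)
    have hzr : (1 - t) * x + t * y < r :=
      (convex_Iio r).add_smul_sub_mem hxr hyr ht |> fun h => by
        have h' : x + t • (y - x) < r := h
        rw [smul_eq_mul] at h'
        linarith
    have hX := hbody x hx hxr
    have hY := hbody y hy hyr
    have hZ := hbody _ hz0 hzr
    have h1 := mv_rpow_blend_ge hi hX hY hK ht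
    have h2 := Real.rpow_le_rpow (mv_pos hi (hX.blend hY ht) hK).le
      (mv_mono hi (hX.blend hY ht) hZ hK (blend_innerPar_subset hΩ ht)) hp.le
    rw [hfeq x hX.nonempty, hfeq y hY.nonempty, hfeq _ hZ.nonempty, mul_div_assoc',
      mul_div_assoc', ← add_div]
    exact div_le_div_of_nonneg_right (h1.trans h2) hc.le
  have hend : ∀ l, 0 ≤ l → l < r → f r ≤ f l := by
    intro l hl hlr
    have hL := hbody l hl hlr
    rcases (innerPar Ω K r).eq_empty_or_nonempty with he | hne
    · have h0 : f r = 0 := by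
        simp only [hf]
        rw [he, mixedVol_empty, Real.zero_rpow hp.ne']
      rw [h0, hfeq l hL.nonempty]
      exact div_nonneg (Real.rpow_nonneg (mv_pos hi hL hK).le _) hc.le
    · rw [hfeq r hne, hfeq l hL.nonempty]
      refine div_le_div_of_nonneg_right (Real.rpow_le_rpow ?_ ?_ hp.le) hc.le
      · exact mv_nonneg hi (isCompact_innerPar hΩc hK.nonempty r) (convex_innerPar hΩ r) hne hK
      · exact mv_le_of_add_smul_subset hi (isCompact_innerPar hΩc hK.nonempty r)
          (convex_innerPar hΩ r) hne hL hK (sub_pos.2 hlr)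
          (innerPar_add_smul_subset hK.convex hl hlr.le)
  refine LinearOrder.concaveOn_of_lt (convex_Icc 0 r) fun x hx y hy hxy a b ha hb hab => ?_
  obtain rfl : a = 1 - b := by linarith
  simp only [smul_eq_mul]
  have hb1 : b < 1 := by linarith
  rcases hy.2.lt_or_eq with hyr | hyr
  · exact hlt x y b hx.1 (hxy.trans hyr) hy.1 hyr ⟨hb.le, hb1.le⟩
  set z := (1 - b) * x + b * y with hz
  rw [← hyr] at hlt hend
  have hzx : z - x = b * (y - x) := by
    rw [hz]
    ring
  have hxz : x < z := by nlinarith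
  have hzy : z < y := by nlinarith
  have hbz : b = (z - x) / (y - x) := by
    rw [hzx, mul_div_cancel_right₀ _ (sub_pos.2 hxy).ne']
  have hkey : ∀ m ∈ Ioo z y,
      (1 - (z - x) / (m - x)) * f x + (z - x) / (m - x) * f y ≤ f z := by
    intro m hm
    have hmx : 0 < m - x := by linarith [hm.1]
    have ht : (z - x) / (m - x) ∈ Icc (0 : ℝ) 1 :=
      ⟨div_nonneg (by linarith) hmx.le, (div_le_one hmx).2 (by linarith [hm.1])⟩
    have h1 := hlt x m _ hx.1 hxy (by linarith [hx.1, hm.1]) hm.2 ht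
    have h2 : (1 - (z - x) / (m - x)) * x + (z - x) / (m - x) * m = z := by
      field_simp
      ring
    rw [h2] at h1
    have h3 := mul_le_mul_of_nonneg_left (hend m (by linarith [hx.1, hm.1]) hm.2) ht.1
    linarith
  have hq : Tendsto (fun m => (z - x) / (m - x)) (𝓝[<] y) (𝓝 b) := by
    rw [show 𝓝 b = 𝓝 ((z - x) / (y - x)) by rw [← hbz]]
    refine Tendsto.mono_left ?_ nhdsWithin_le_nhds
    exact tendsto_const_nhds.div (tendsto_id.sub_const x) (sub_pos.2 hxy).ne'
  have hlim : Tendsto (fun m => (1 - (z - x) / (m - x)) * f x + (z - x) / (m - x) * f y) (𝓝[<] y)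
      (𝓝 ((1 - b) * f x + b * f y)) :=
    ((hq.const_sub 1).mul_const _).add (hq.mul_const _)
  refine le_of_tendsto hlim ?_
  filter_upwards [Ioo_mem_nhdsLT hzy] with m hm using hkey m hm

end ConvexMixed

/-- for each `i < n`, `λ ↦ v_i(λ)^{1/(n-i)}` is concave on `[0, r(Ω,K)]`,
where `v_i(λ)` is the mixed volume of `n - i` copies of `Ω ∼ λK` and `i` copies of `K`. -/
theorem stmt7 {n : ℕ} (hn : 1 ≤ n) (Ω K : Set (EuclideanSpace ℝ (Fin n)))
    (hΩc : IsCompact Ω) (hΩconv : Convex ℝ Ω) (hΩint : (interior Ω).Nonempty)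
    (hKc : IsCompact K) (hKconv : Convex ℝ K) (hKint : (interior K).Nonempty)
    (i : ℕ) (hi : i < n) :
    ConcaveOn ℝ (Set.Icc 0 (inrad Ω K))
      (fun l => (mixedVol i (innerPar Ω K l) K) ^ ((1:ℝ) / ((n : ℝ) - i))) := by
  exact ConvexMixed.concaveOn_mixedVol_rpow hi hΩc hΩconv ⟨hKc, hKconv, hKint⟩
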